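/- Let ρ be the unique function analytic on a neighborhood of y = 1 with ρ(1) = 1/(e−1) satisfying 1 + ρ(y) = (1 + (e^{yρ(y)} − 1)/y) · ρ(y) · e^{1−ρ(y)}, and set R(y) = ρ(y)/(1 + ρ(y)). Define μ = −R′(1)/R(1) and σ² = −R″(1)/R(1) − R′(1)/R(1) + (R′(1)/R(1))². Then σ² ≠ 0, and if T_n (respectively F_n) denotes a tree (respectively forest) chosen uniformly at random among all labelled trees (respectively forests) on {1,…,n}, then E[β(T_n)] = μ n (1+o(1)), E[β(F_n)] = μ n (1+o(1)), Var[β(T_n)] = σ² n (1+o(1)) and Var[β(F_n)] = σ² n (1+o(1)) as n → ∞. -/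

import Mathlib

open scoped Classical BigOperators
open Filter Topology

noncomputable section

namespace MetricDimPaper

/-- `R` is a resolving set of `G`: every pair of distinct vertices is distinguished by its
vector of (extended, possibly infinite) distances to the vertices of `R`. -/
def Resolves {V : Type*} (G : SimpleGraph V) (R : Set V) : Prop :=
  ∀ u v : V, u ≠ v → ∃ w ∈ R, G.edist u w ≠ G.edist v w

/-- The metric dimension of a graph: the least cardinality of a resolving set, with the
convention that a single isolated vertex has metric dimension 1. -/
def metricDim {V : Type*} (G : SimpleGraph V) : ℕ :=
  if Nat.card V = 1 then 1
  else sInf {m : ℕ | ∃ R : Set V, R.ncard = m ∧ Resolves G R}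

/-- A tree: a connected acyclic graph. -/
def IsTree {V : Type*} (G : SimpleGraph V) : Prop := G.Connected ∧ G.IsAcyclic

/-- degree of a vertex (as `Nat.card` of the neighbor set). -/
def ndeg {V : Type*} (G : SimpleGraph V) (v : V) : ℕ := (G.neighborSet v).ncard

/-- metric dimension as a real number -/
def betaR {n : ℕ} (G : SimpleGraph (Fin n)) : ℝ := (metricDim G : ℝ)

def treeSet (n : ℕ) : Set (SimpleGraph (Fin n)) := {G | IsTree G}

def forestSet (n : ℕ) : Set (SimpleGraph (Fin n)) := {G | G.IsAcyclic}

/-- Expectation of `f` under the uniform distribution on the (finite) set `S` of graphs. -/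
def unifExp {n : ℕ} (S : Set (SimpleGraph (Fin n))) (f : SimpleGraph (Fin n) → ℝ) : ℝ :=
  (∑ᶠ G ∈ S, f G) / (Nat.card ↥S)

/-- Variance of `f` under the uniform distribution on `S`. -/
def unifVar {n : ℕ} (S : Set (SimpleGraph (Fin n))) (f : SimpleGraph (Fin n) → ℝ) : ℝ :=
  unifExp S (fun G => (f G - unifExp S f) ^ 2)

/-- Probability of the event `A` under the uniform distribution on `S`. -/
def unifPr {n : ℕ} (S A : Set (SimpleGraph (Fin n))) : ℝ :=
  (Nat.card ↥(S ∩ A) : ℝ) / (Nat.card ↥S)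

/-- The probability weight of an individual graph in the Erdős–Rényi model `G(n,p)`. -/
def erWeight (n : ℕ) (p : ℝ) (G : SimpleGraph (Fin n)) : ℝ :=
  p ^ (Nat.card ↥G.edgeSet) * (1 - p) ^ (n.choose 2 - Nat.card ↥G.edgeSet)

/-- Expectation of `f` in the Erdős–Rényi model `G(n,p)`. -/
def erExp (n : ℕ) (p : ℝ) (f : SimpleGraph (Fin n) → ℝ) : ℝ :=
  ∑ᶠ G : SimpleGraph (Fin n), erWeight n p G * f G

/-- Variance of `f` in the Erdős–Rényi model `G(n,p)`. -/
def erVar (n : ℕ) (p : ℝ) (f : SimpleGraph (Fin n) → ℝ) : ℝ :=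
  erExp n p (fun G => (f G - erExp n p f) ^ 2)

/-- Probability of the event `A` in the Erdős–Rényi model `G(n,p)`. -/
def erPr (n : ℕ) (p : ℝ) (A : Set (SimpleGraph (Fin n))) : ℝ :=
  ∑ᶠ G ∈ A, erWeight n p G

/-- The cumulative distribution function of the standard normal law. -/
def stdGaussianCDF (x : ℝ) : ℝ :=
  (Real.sqrt (2 * Real.pi))⁻¹ * ∫ t in Set.Iic x, Real.exp (-(t ^ 2) / 2)

/-- The normalized metric dimension `(β - E β)/sqrt (Var β)` for the uniform model on `S`. -/
def normβ {n : ℕ} (S : Set (SimpleGraph (Fin n))) (G : SimpleGraph (Fin n)) : ℝ :=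
  (betaR G - unifExp S betaR) / Real.sqrt (unifVar S betaR)

/-- The normalized metric dimension `(β - E β)/sqrt (Var β)` for the `G(n,p)` model. -/
def erNormβ (n : ℕ) (p : ℝ) (G : SimpleGraph (Fin n)) : ℝ :=
  (betaR G - erExp n p betaR) / Real.sqrt (erVar n p betaR)



/-- `G` is a tree with vertex set `S`, all other vertices being isolated. -/
def TreeOn {V : Type*} (S : Finset V) (G : SimpleGraph V) : Prop :=
  S.Nonempty ∧ (∀ u v, G.Adj u v → u ∈ S) ∧ (∀ u ∈ S, ∀ v ∈ S, G.Reachable u v) ∧ G.IsAcyclic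

/-- The trees with vertex set `S`. -/
def trees {V : Type*} [Fintype V] (S : Finset V) : Finset (SimpleGraph V) :=
  Finset.univ.filter (TreeOn S)

/-- `G` with all edges meeting `D` removed. -/
def detach {V : Type*} (G : SimpleGraph V) (D : Finset V) : SimpleGraph V where
  Adj x y := G.Adj x y ∧ x ∉ D ∧ y ∉ D
  symm := ⟨fun _ _ h => ⟨h.1.symm, h.2.2, h.2.1⟩⟩
  loopless := ⟨fun _ h => h.1.ne rfl⟩

/-- The path graph visiting the vertices of a list in order. -/
def chain {V : Type*} : List V → SimpleGraph V
  | [] => ⊥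
  | [_] => ⊥
  | x :: y :: l => SimpleGraph.edge x y ⊔ chain (y :: l)

/-- `a` lists the vertices of a pendant path (a leg) attached to `v`, starting next to `v`. -/
def IsLeg {V : Type*} (G : SimpleGraph V) (v : V) (a : List V) : Prop :=
  a ≠ [] ∧ (v :: a).Nodup ∧ ∀ x ∈ a, ∀ y, G.Adj x y ↔ (chain (v :: a)).Adj x y

section Chain

variable {V : Type*}

lemma chain_adj_mem {l : List V} {x y : V} (h : (chain l).Adj x y) : x ∈ l ∧ y ∈ l := by
  induction l using chain.induct with
  | case1 => simp [chain] at h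
  | case2 => simp [chain] at h
  | case3 a b l ih =>
    simp only [chain, SimpleGraph.sup_adj, SimpleGraph.edge_adj] at h
    rcases h with h | h
    · grind
    · have := ih h; grind

lemma chain_cons_adj_head {v y : V} {a : List V} (hn : (v :: a).Nodup)
    (h : (chain (v :: a)).Adj v y) :
    a.head? = some y := by
  cases a with
  | nil => simp [chain] at h
  | cons b l =>
    simp only [chain, SimpleGraph.sup_adj, SimpleGraph.edge_adj] at h
    rcases h with h | h
    · grind
    · have := chain_adj_mem h; grind

lemma chain_cons_cons_adj (x y : V) (l : List V) (hxy : x ≠ y) : (chain (x :: y :: l)).Adj x y := by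
  simp [chain, SimpleGraph.edge_adj, hxy]

/-- Each vertex of a nodup chain other than the first one has a predecessor. -/
lemma chain_exists_adj {v : V} {a : List V} (hn : (v :: a).Nodup) {x : V} (hx : x ∈ a) :
    ∃ y, (chain (v :: a)).Adj x y := by
  induction a generalizing v with
  | nil => simp at hx
  | cons b l ih =>
    rcases List.mem_cons.1 hx with rfl | h
    · exact ⟨v, (chain_cons_cons_adj v x l (by grind)).symm⟩
    · obtain ⟨y, hy⟩ := ih (v := b) (by grind) h
      exact ⟨y, by simp [chain, hy]⟩

lemma chain_adj_mem_tail {v x y : V} {a : List V} (h : (chain (v :: a)).Adj x y) :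
    x ∈ a ∨ y ∈ a := by
  have h1 := chain_adj_mem h
  have h2 := h.ne
  grind

/-- A graph-closed set which meets a chain and is only left through vertices outside the chain
contains the first vertex of the chain. -/
lemma chain_head_mem {G : SimpleGraph V} {P : V → Prop} {h : V} {l : List V}
    (hG : chain (h :: l) ≤ G) (hn : (h :: l).Nodup)
    (hP : ∀ x y, P x → G.Adj x y → y ∈ h :: l → P y) {x : V} (hx : x ∈ h :: l) (hPx : P x) :
    P h := by
  induction l generalizing h with
  | nil => simp at hx; exact hx ▸ hPx
  | cons b l ih =>
    rcases List.mem_cons.1 hx with rfl | hx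
    · exact hPx
    · have hb : P b := ih (le_trans le_sup_right hG) (by grind)
        (fun x y hx hxy hy => hP x y hx hxy (by grind)) hx
      exact hP b h hb (hG (chain_cons_cons_adj h b l (by grind)).symm) (by simp)

end Chain

section Legs

variable {V : Type*} {G : SimpleGraph V} {v w : V} {a b : List V}

lemma IsLeg.exists_cons (h : IsLeg G v a) : ∃ x l, a = x :: l ∧ G.Adj v x := by
  obtain ⟨h1, h2, h3⟩ := h
  cases a with
  | nil => exact absurd rfl h1
  | cons x l =>
    refine ⟨x, l, rfl, ?_⟩
    have : (chain (v :: x :: l)).Adj x v := (chain_cons_cons_adj v x l (by grind)).symm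
    exact ((h3 x (by simp) v).2 this).symm

lemma IsLeg.closed (h : IsLeg G v a) {x y : V} (hx : x ∈ a) (hxy : G.Adj x y) : y ∈ a ∨ y = v := by
  have := (chain_adj_mem ((h.2.2 x hx y).1 hxy)).2
  grind

lemma IsLeg.chain_le (h : IsLeg G v a) : chain (v :: a) ≤ G := by
  intro x y hxy
  rcases chain_adj_mem_tail hxy with hx | hy
  · exact (h.2.2 x hx y).2 hxy
  · exact ((h.2.2 y hy x).2 hxy.symm).symm

lemma chain_tail_le (v : V) (a : List V) : chain a ≤ chain (v :: a) := by
  cases a with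
  | nil => simp [chain]
  | cons x l => exact le_sup_right

lemma IsLeg.exists_adj (h : IsLeg G v a) {x : V} (hx : x ∈ a) : ∃ y, G.Adj x y := by
  obtain ⟨y, hy⟩ := chain_exists_adj h.2.1 hx
  exact ⟨y, (h.2.2 x hx y).2 hy⟩

lemma IsLeg.adj_base (h : IsLeg G v a) {x : V} (hx : x ∈ a) (hxv : G.Adj v x) :
    a.head? = some x :=
  chain_cons_adj_head h.2.1 ((h.2.2 x hx v).1 hxv.symm).symm

/-- If two legs share a vertex and the first one avoids the base of the second,
the first vertex of the first leg lies on the second leg. -/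
lemma IsLeg.head_mem {x : V} {l : List V} (ha : IsLeg G v (x :: l)) (hb : IsLeg G w b)
    (hw : w ∉ x :: l) {z : V} (hza : z ∈ x :: l) (hzb : z ∈ b) : x ∈ b := by
  refine chain_head_mem (G := G) (P := (· ∈ b)) ((chain_tail_le v _).trans ha.chain_le)
    (by have := ha.2.1; grind) ?_ hza hzb
  intro p q hp hpq hq
  rcases hb.closed hp hpq with h | h
  · exact h
  · subst h; exact absurd hq hw

lemma IsLeg.tail {x : V} {l : List V} (ha : IsLeg G v (x :: l)) (hl : l ≠ []) : IsLeg G x l := by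
  obtain ⟨h1, h2, h3⟩ := ha
  refine ⟨hl, by grind, fun p hp y => ?_⟩
  rw [h3 p (by simp [hp]) y]
  simp only [chain, SimpleGraph.sup_adj, SimpleGraph.edge_adj]
  grind

lemma IsLeg.eq_of_head {x : V} {l m : List V} (ha : IsLeg G v (x :: l)) (hb : IsLeg G v (x :: m)) :
    l = m := by
  induction l generalizing v x m with
  | nil =>
    cases m with
    | nil => rfl
    | cons y m =>
      exfalso
      have h1 := (hb.2.2 x (by simp) y).2
        ((chain_tail_le v _) (chain_cons_cons_adj x y m (by have := hb.2.1; grind)))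
      have h2 := ha.closed (by simp) h1
      have := hb.2.1
      grind
  | cons z l ih =>
    cases m with
    | nil =>
      exfalso
      have h1 := (ha.2.2 x (by simp) z).2
        ((chain_tail_le v _) (chain_cons_cons_adj x z l (by have := ha.2.1; grind)))
      have h2 := hb.closed (by simp) h1
      have := ha.2.1
      grind
    | cons y m =>
      have h1 := (hb.2.2 x (by simp) y).2
        ((chain_tail_le v _) (chain_cons_cons_adj x y m (by have := hb.2.1; grind)))
      have h2 := (ha.2.2 x (by simp) y).1 h1
      have h3 : y = z := by
        have hna := ha.2.1
        have hnb := hb.2.1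
        simp only [chain, SimpleGraph.sup_adj, SimpleGraph.edge_adj] at h2
        have h4 : (chain (z :: l)).Adj x y → False := fun h => by
          have := chain_adj_mem h; grind
        grind
      subst h3
      rw [ih (ha.tail (by simp)) (hb.tail (by simp))]

lemma IsLeg.base_notMem (ha : IsLeg G v a) : v ∉ a := by
  have := ha.2.1; grind

lemma IsLeg.eq_of_mem (ha : IsLeg G v a) (hb : IsLeg G v b) {z : V} (hza : z ∈ a) (hzb : z ∈ b) :
    a = b := by
  obtain ⟨x, l, rfl, hx⟩ := ha.exists_cons
  obtain ⟨y, m, rfl, hy⟩ := hb.exists_cons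
  have h1 := ha.head_mem hb ha.base_notMem hza hzb
  have h2 := hb.adj_base h1 hx
  simp at h2
  subst h2
  rw [ha.eq_of_head hb]

end Legs

section Detach

variable {V : Type*} {G : SimpleGraph V} {v w : V} {a b : List V}

lemma reachable_map {H : SimpleGraph V} (φ : V → V)
    (h : ∀ x y, G.Adj x y → φ x = φ y ∨ H.Adj (φ x) (φ y)) {x y : V} (hxy : G.Reachable x y) :
    H.Reachable (φ x) (φ y) := by
  obtain ⟨p⟩ := hxy
  induction p with
  | nil => exact SimpleGraph.Reachable.refl _
  | cons hadj _ ih =>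
    rcases h _ _ hadj with h | h
    · rw [h]; exact ih
    · exact h.reachable.trans ih

lemma TreeOn.mem_left {S : Finset V} (h : TreeOn S G) {x y : V} (hxy : G.Adj x y) : x ∈ S :=
  h.2.1 x y hxy

lemma TreeOn.mem_right {S : Finset V} (h : TreeOn S G) {x y : V} (hxy : G.Adj x y) : y ∈ S :=
  h.2.1 y x hxy.symm

lemma detach_le (G : SimpleGraph V) (D : Finset V) : detach G D ≤ G := fun _ _ h => h.1

lemma TreeOn.detach {S D : Finset V} (h : TreeOn S G) (hv : v ∈ S) (hvD : v ∉ D)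
    (hD : ∀ x ∈ D, ∀ y, G.Adj x y → y ∈ D ∨ y = v) : TreeOn (S \ D) (detach G D) := by
  refine ⟨⟨v, by simp [hv, hvD]⟩, fun x y hxy => by simp [h.mem_left hxy.1, hxy.2.1], ?_,
    h.2.2.2.anti (detach_le G D)⟩
  intro x hx y hy
  have := reachable_map (G := G) (H := MetricDimPaper.detach G D)
    (fun z => if z ∈ D then v else z) ?_
    (h.2.2.1 x (by grind) y (by grind))
  · have hx' : x ∉ D := by grind
    have hy' : y ∉ D := by grind
    simpa [hx', hy'] using this
  · intro x y hxy
    by_cases hx : x ∈ D <;> by_cases hy : y ∈ D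
    · simp [hx, hy]
    · left; have := hD x hx y hxy; grind
    · left; have := hD y hy x hxy.symm; grind
    · right; simp [hx, hy, MetricDimPaper.detach, hxy]

lemma TreeOn.sup_edge {S : Finset V} (h : TreeOn S G) (hv : v ∈ S) (hw : w ∉ S) :
    TreeOn (insert w S) (G ⊔ SimpleGraph.edge v w) := by
  have hvw : v ≠ w := fun e => hw (e ▸ hv)
  have hadj : (G ⊔ SimpleGraph.edge v w).Adj v w := by simp [SimpleGraph.edge_adj, hvw]
  refine ⟨⟨w, by simp⟩, fun x y hxy => ?_, ?_, ?_⟩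
  · simp only [SimpleGraph.sup_adj, SimpleGraph.edge_adj] at hxy
    rcases hxy with hxy | hxy
    · simp [h.mem_left hxy]
    · grind
  · have key : ∀ x ∈ insert w S, (G ⊔ SimpleGraph.edge v w).Reachable x v := by
      intro x hx
      rcases Finset.mem_insert.1 hx with rfl | hx
      · exact hadj.symm.reachable
      · exact (h.2.2.1 x hx v hv).mono le_sup_left
    exact fun x hx y hy => (key x hx).trans (key y hy).symm
  · refine SimpleGraph.IsAcyclic.sup_edge_of_not_reachable ?_ h.2.2.2
    rintro ⟨p⟩
    cases p.reverse with
    | nil => exact hvw rfl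
    | cons hadj _ => exact hw (h.mem_left hadj)

lemma TreeOn.sup_chain {S : Finset V} (h : TreeOn S G) (hv : v ∈ S) (hn : (v :: a).Nodup)
    (ha : ∀ x ∈ a, x ∉ S) : TreeOn (S ∪ a.toFinset) (G ⊔ chain (v :: a)) := by
  induction a generalizing v S G with
  | nil => simpa [chain] using h
  | cons x l ih =>
    have h1 := h.sup_edge hv (ha x (by simp))
    have h2 := ih (v := x) h1 (by simp) (by grind) (by grind)
    have e : S ∪ (x :: l).toFinset = insert x S ∪ l.toFinset := by ext; simp
    rw [e, chain, ← sup_assoc]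
    exact h2

lemma detach_sup_chain {S : Finset V} (h : TreeOn S G) (ha : ∀ x ∈ a, x ∉ S) :
    detach (G ⊔ chain (v :: a)) a.toFinset = G := by
  ext x y
  simp only [detach, SimpleGraph.sup_adj, List.mem_toFinset]
  constructor
  · rintro ⟨h1 | h1, hx, hy⟩
    · exact h1
    · have := chain_adj_mem_tail h1; tauto
  · intro hxy
    exact ⟨Or.inl hxy, fun hx => ha x hx (h.mem_left hxy), fun hy => ha y hy (h.mem_right hxy)⟩

lemma isLeg_sup_chain {S : Finset V} (h : TreeOn S G) (hne : a ≠ [])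
    (hn : (v :: a).Nodup) (ha : ∀ x ∈ a, x ∉ S) : IsLeg (G ⊔ chain (v :: a)) v a := by
  refine ⟨hne, hn, fun x hx y => ?_⟩
  simp only [SimpleGraph.sup_adj, or_iff_right_iff_imp]
  exact fun hxy => absurd (h.mem_left hxy) (ha x hx)

lemma IsLeg.detach_sup_chain (h : IsLeg G v a) : detach G a.toFinset ⊔ chain (v :: a) = G := by
  ext x y
  simp only [SimpleGraph.sup_adj, detach, List.mem_toFinset]
  constructor
  · rintro (h1 | h1)
    · exact h1.1
    · exact h.chain_le h1
  · intro hxy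
    by_cases hx : x ∈ a
    · exact Or.inr ((h.2.2 x hx y).1 hxy)
    · by_cases hy : y ∈ a
      · exact Or.inr ((h.2.2 y hy x).1 hxy.symm).symm
      · exact Or.inl ⟨hxy, hx, hy⟩

lemma IsLeg.treeOn_detach {S : Finset V} (h : IsLeg G v a) (hG : TreeOn S G) (hv : v ∈ S) :
    TreeOn (S \ a.toFinset) (MetricDimPaper.detach G a.toFinset) :=
  hG.detach hv (by simpa using h.base_notMem)
    (fun x hx y hxy => by simpa using h.closed (by simpa using hx) hxy)

lemma IsLeg.mem_of_treeOn {S : Finset V} (h : IsLeg G v a) (hG : TreeOn S G) {x : V} (hx : x ∈ a) :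
    x ∈ S := by
  obtain ⟨y, hy⟩ := h.exists_adj hx
  exact hG.mem_left hy

/-- Removing a leg does not affect the other disjoint legs. -/
lemma IsLeg.isLeg_detach_iff (h : IsLeg G v a) (hab : ∀ x ∈ b, x ∉ a) (hvb : v ∉ b) :
    IsLeg (MetricDimPaper.detach G a.toFinset) w b ↔ IsLeg G w b := by
  unfold IsLeg
  refine and_congr_right fun _ => and_congr_right fun _ =>
    forall_congr' fun x => forall_congr' fun hx => forall_congr' fun y => ?_
  have : (MetricDimPaper.detach G a.toFinset).Adj x y ↔ G.Adj x y := by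
    simp only [MetricDimPaper.detach, List.mem_toFinset]
    refine ⟨fun h => h.1, fun hxy => ⟨hxy, hab x hx, fun hy => ?_⟩⟩
    rcases h.closed hy hxy.symm with h | h
    · exact hab x hx h
    · exact hvb (h ▸ hx)
  rw [this]

lemma isLeg_detach_disjoint {D : Finset V} (hb : IsLeg (detach G D) w b) {x : V} (hx : x ∈ b) :
    x ∉ D := by
  obtain ⟨y, hy⟩ := hb.exists_adj hx
  exact hy.2.1

/-- Summing over the trees on `S` with the prescribed leg `a` at `v` amounts to summing over the
trees on `S \ a`. -/
lemma sum_trees_isLeg [Fintype V] {M : Type*} [AddCommMonoid M] {S : Finset V} (hv : v ∈ S)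
    (hne : a ≠ []) (hn : (v :: a).Nodup) (ha : ∀ x ∈ a, x ∈ S) (F : SimpleGraph V → M) :
    ∑ G ∈ (trees S).filter (fun G => IsLeg G v a), F (detach G a.toFinset) =
      ∑ G ∈ trees (S \ a.toFinset), F G := by
  have hv' : v ∈ S \ a.toFinset := by simp [hv]; grind
  have hS : S \ a.toFinset ∪ a.toFinset = S := by ext x; simp; grind
  have hd : ∀ x ∈ a, x ∉ S \ a.toFinset := by intro x hx; simp [hx]
  refine Finset.sum_bij' (fun G _ => detach G a.toFinset) (fun G _ => G ⊔ chain (v :: a))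
    ?_ ?_ ?_ ?_ ?_
  · intro G hG
    simp only [trees, Finset.mem_filter, Finset.mem_univ, true_and] at hG ⊢
    exact hG.2.treeOn_detach hG.1 hv
  · intro G hG
    simp only [trees, Finset.mem_filter, Finset.mem_univ, true_and] at hG ⊢
    exact ⟨hS ▸ hG.sup_chain hv' hn hd, isLeg_sup_chain hG hne hn hd⟩
  · intro G hG
    simp only [trees, Finset.mem_filter, Finset.mem_univ, true_and] at hG
    exact hG.2.detach_sup_chain
  · intro G hG
    simp only [trees, Finset.mem_filter, Finset.mem_univ, true_and] at hG
    exact detach_sup_chain hG hd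
  · intros; rfl

end Detach

section Cayley

variable {V : Type*} {G : SimpleGraph V} {S : Finset V}

lemma isLeg_singleton {u w : V} : IsLeg G u [w] ↔ u ≠ w ∧ ∀ y, G.Adj w y ↔ y = u := by
  simp only [IsLeg, chain, ne_eq, List.cons_ne_self, not_false_eq_true, List.nodup_cons,
    List.mem_cons, List.not_mem_nil, or_false, List.nodup_nil, and_true, forall_eq,
    SimpleGraph.sup_adj, SimpleGraph.edge_adj, SimpleGraph.bot_adj, true_and]
  refine and_congr_right fun h => forall_congr' fun y => ?_
  constructor <;> intro h' <;> grind

lemma TreeOn.subset_of_closed (h : TreeOn S G) {P : V → Prop} {x : V} (hx : x ∈ S) (hPx : P x)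
    (hP : ∀ y z, P y → G.Adj y z → P z) : ∀ y ∈ S, P y := by
  intro y hy
  obtain ⟨p⟩ := h.2.2.1 x hx y hy
  clear hy hx
  induction p with
  | nil => exact hPx
  | cons hadj _ ih => exact ih (hP _ _ hPx hadj)

lemma TreeOn.exists_adj (h : TreeOn S G) (hS : 2 ≤ S.card) {x : V} (hx : x ∈ S) :
    ∃ y, G.Adj x y := by
  by_contra! hno
  have := h.subset_of_closed (P := (· = x)) hx rfl
    (fun y z hy hyz => by subst hy; exact absurd hyz (hno z))
  have : S ⊆ {x} := fun y hy => by simpa using this y hy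
  have := Finset.card_le_card this
  simp at this
  omega

lemma TreeOn.exists_leaf [Finite V] (h : TreeOn S G) (hS : 2 ≤ S.card) :
    ∃ w ∈ S, ∃ u, IsLeg G u [w] := by
  obtain ⟨x, hx⟩ := h.1
  obtain ⟨y, hxy⟩ := h.exists_adj hS hx
  have : Nonempty V := ⟨x⟩
  obtain ⟨u, v, p, hp, hmax⟩ := SimpleGraph.Walk.exists_isPath_forall_isPath_length_le_length G
  have hnil : ¬p.Nil := by
    intro hn
    have h1 := hmax x y (SimpleGraph.Walk.cons hxy .nil) (by simp [hxy.ne])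
    have := SimpleGraph.Walk.length_eq_zero_iff.2 hn
    simp at h1
    omega
  refine ⟨u, h.mem_left (p.adj_snd hnil), p.snd, isLeg_singleton.2 ⟨(p.adj_snd hnil).ne', ?_⟩⟩
  refine fun w => ⟨fun hadj => ?_, fun hw => hw ▸ p.adj_snd hnil⟩
  apply h.2.2.2.eq_snd_of_adj_start hp hadj
  have : ¬(p.cons hadj.symm).IsPath := by
    intro h'
    have := hmax _ _ _ h'
    simp at this
  grind [hp.cons]

lemma sum_powerset_pow {j : ℕ} (hj : j < S.card) :
    ∑ W ∈ S.powerset, (-1 : ℤ) ^ W.card * ((S.card - W.card : ℕ) : ℤ) ^ j = 0 := by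
  have h := fwdDiff_iter_pow_eq_zero_of_lt (R := ℤ) hj
  have h2 := congrFun h 0
  rw [fwdDiff_iter_eq_sum_shift] at h2
  rw [Finset.sum_powerset_apply_card (fun k => (-1 : ℤ) ^ k * ((S.card - k : ℕ) : ℤ) ^ j),
    ← Finset.sum_range_reflect]
  simp only [Pi.zero_apply] at h2
  rw [← h2]
  refine Finset.sum_congr rfl fun k hk => ?_
  have hk : k ≤ S.card := by simpa [Nat.lt_succ_iff] using hk
  have e1 : S.card + 1 - 1 - k = S.card - k := by omega
  rw [e1, Nat.choose_symm hk, Nat.sub_sub_self hk]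
  simp
  ring

variable [Fintype V]

/-- The number of trees on `S` in which every vertex of `W` is a leaf attached to a vertex
outside `W`. -/
def hang (S W : Finset V) : ℕ :=
  ((trees S).filter (fun G => ∀ w ∈ W, ∃ u ∈ S \ W, IsLeg G u [w])).card

lemma mem_trees : G ∈ trees S ↔ TreeOn S G := by simp [trees]

lemma hang_insert {W : Finset V} {w : V} (hw : w ∈ S) (hwW : w ∉ W) :
    hang S (insert w W) = (S \ insert w W).card * hang (S \ {w}) W := by
  have h1 : hang S (insert w W) = ∑ G ∈ trees S, ∑ u ∈ S \ insert w W,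
      if IsLeg G u [w] then (if ∀ w' ∈ W, ∃ u' ∈ S \ insert w W, IsLeg G u' [w'] then 1 else 0)
        else 0 := by
    rw [hang, Finset.card_filter]
    refine Finset.sum_congr rfl fun G hG => ?_
    by_cases hu : ∃ u ∈ S \ insert w W, IsLeg G u [w]
    · have hu' := hu
      obtain ⟨u, huS, hu⟩ := hu
      rw [Finset.sum_eq_single_of_mem u huS, if_pos hu]
      · simp only [Finset.mem_insert, forall_eq_or_imp, hu', true_and]
      · intro u' _ hne
        rw [if_neg]
        intro h
        exact hne (((isLeg_singleton.1 hu).2 u').1 (((isLeg_singleton.1 h).2 u').2 rfl))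
    · rw [if_neg fun h => hu (h w (by simp))]
      exact (Finset.sum_eq_zero fun u hu' => if_neg fun h => hu ⟨u, hu', h⟩).symm
  rw [h1, Finset.sum_comm, Finset.card_eq_sum_ones, Finset.sum_mul]
  refine Finset.sum_congr rfl fun u hu => ?_
  have hu' : u ∈ S ∧ u ≠ w ∧ u ∉ W := by simpa using hu
  have h2 := sum_trees_isLeg (S := S) (v := u) (a := [w]) hu'.1 (by simp) (by simp [hu'.2.1])
    (by simpa using hw)
    (fun G => if ∀ w' ∈ W, ∃ u' ∈ (S \ {w}) \ W, IsLeg G u' [w'] then 1 else 0)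
  rw [one_mul, hang, Finset.card_filter]
  simp only [List.toFinset_cons, List.toFinset_nil, insert_empty_eq] at h2
  rw [← h2, Finset.sum_filter]
  refine Finset.sum_congr rfl fun G hG => ?_
  by_cases hl : IsLeg G u [w]
  · rw [if_pos hl, if_pos hl]
    have e : S \ insert w W = (S \ {w}) \ W := by ext; simp; tauto
    rw [e]
    refine if_congr ?_ rfl rfl
    refine forall_congr' fun w' => forall_congr' fun hw' => exists_congr fun u' =>
      and_congr_right fun _ => ?_
    have := hl.isLeg_detach_iff (b := [w']) (w := u') (by grind) (by grind)
    simpa using this.symm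
  · rw [if_neg hl, if_neg hl]

lemma hang_eq {W : Finset V} (hW : W ⊆ S) :
    hang S W = (S.card - W.card) ^ W.card * (trees (S \ W)).card := by
  induction W using Finset.induction_on generalizing S with
  | empty => simp [hang]
  | insert w W hw ih =>
    have hwS : w ∈ S := hW (by simp)
    have e : S \ insert w W = (S \ {w}) \ W := by ext; simp; tauto
    rw [hang_insert hwS hw, ih (by intro x hx; have := hW (Finset.mem_insert_of_mem hx); grind), e,
      ← e, Finset.card_sdiff_of_subset hW, Finset.card_insert_of_notMem hw,
      Finset.card_sdiff_of_subset (by simpa using hwS), Finset.card_singleton, pow_succ,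
      Nat.sub_sub, add_comm 1]
    ring

lemma trees_empty : trees (∅ : Finset V) = ∅ := by
  ext G; simp [mem_trees, TreeOn]

lemma sum_hang (hS : 3 ≤ S.card) : ∑ W ∈ S.powerset, (-1 : ℤ) ^ W.card * hang S W = 0 := by
  have h1 : ∀ G ∈ trees S, ∑ W ∈ S.powerset,
      (if ∀ w ∈ W, ∃ u ∈ S \ W, IsLeg G u [w] then (-1 : ℤ) ^ W.card else 0) = 0 := by
    intro G hG
    rw [mem_trees] at hG
    set L := S.filter (fun w => ∃ u, IsLeg G u [w]) with hL
    have hLne : L.Nonempty := by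
      obtain ⟨w, hw, u, hu⟩ := hG.exists_leaf (by omega)
      exact ⟨w, by simp [hL, hw]; exact ⟨u, hu⟩⟩
    refine Eq.trans ?_ (Finset.sum_powerset_neg_one_pow_card_of_nonempty hLne)
    rw [← Finset.sum_filter]
    refine Finset.sum_congr ?_ fun _ _ => rfl
    ext W
    simp only [Finset.mem_filter, Finset.mem_powerset]
    constructor
    · rintro ⟨hWS, h⟩ w hw
      obtain ⟨u, _, hu⟩ := h w hw
      simp only [hL, Finset.mem_filter]
      exact ⟨hWS hw, u, hu⟩
    · intro hWL
      refine ⟨hWL.trans (Finset.filter_subset _ _), fun w hw => ?_⟩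
      have hwL := hWL hw
      simp only [hL, Finset.mem_filter] at hwL
      obtain ⟨hwS, u, hu⟩ := hwL
      refine ⟨u, ?_, hu⟩
      have hu' := isLeg_singleton.1 hu
      have huS : u ∈ S := hG.mem_right ((hu'.2 u).2 rfl)
      refine Finset.mem_sdiff.2 ⟨huS, fun huW => ?_⟩
      have huL := hWL huW
      simp only [hL, Finset.mem_filter] at huL
      obtain ⟨_, x, hx⟩ := huL
      have hx' := isLeg_singleton.1 hx
      have hxw : w = x := (hx'.2 w).1 ((hu'.2 u).2 rfl).symm
      have := hG.subset_of_closed (P := fun y => y = u ∨ y = w) huS (Or.inl rfl) (by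
        rintro y z (rfl | rfl) hyz
        · right; rw [hxw]; exact (hx'.2 z).1 hyz
        · left; exact (hu'.2 z).1 hyz)
      have h2 : S ⊆ {u, w} := fun y hy => by simpa using this y hy
      have := (Finset.card_le_card h2).trans Finset.card_le_two
      omega
  calc _ = ∑ W ∈ S.powerset, ∑ G ∈ trees S,
        (if ∀ w ∈ W, ∃ u ∈ S \ W, IsLeg G u [w] then (-1 : ℤ) ^ W.card else 0) := by
        refine Finset.sum_congr rfl fun W _ => ?_
        rw [← Finset.sum_filter, Finset.sum_const, hang, nsmul_eq_mul, mul_comm]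
    _ = 0 := by rw [Finset.sum_comm]; exact Finset.sum_eq_zero h1

/-- **Cayley's formula.** -/
theorem card_trees (hS : S.Nonempty) : (trees S).card = S.card ^ (S.card - 2) := by
  induction' hs : S.card using Nat.strong_induction_on with s ih generalizing S
  have hs0 : 0 < s := hs ▸ hS.card_pos
  rcases Nat.lt_or_ge s 3 with hlt | hge
  · have h1 : (trees S).card = 1 := by
      obtain rfl | rfl : s = 1 ∨ s = 2 := by omega
      · obtain ⟨x, rfl⟩ := Finset.card_eq_one.1 hs
        rw [Finset.card_eq_one]
        refine ⟨⊥, ?_⟩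
        ext G
        rw [mem_trees, Finset.mem_singleton]
        constructor
        · intro h
          ext u v
          simp only [SimpleGraph.bot_adj, iff_false]
          intro huv
          have h1 := h.mem_left huv
          have h2 := h.mem_right huv
          simp at h1 h2
          exact huv.ne (h1.trans h2.symm)
        · rintro rfl
          exact ⟨by simp, by simp, by simp, SimpleGraph.isAcyclic_bot⟩
      · obtain ⟨x, y, hxy, rfl⟩ := Finset.card_eq_two.1 hs
        rw [Finset.card_eq_one]
        refine ⟨SimpleGraph.edge x y, ?_⟩
        ext G
        rw [mem_trees, Finset.mem_singleton]
        constructor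
        · intro h
          obtain ⟨z, hz⟩ := h.exists_adj hs.ge (x := x) (by simp)
          have hzy : z = y := by
            have := h.mem_right hz
            have := hz.ne
            grind
          subst hzy
          ext u v
          rw [SimpleGraph.edge_adj]
          constructor
          · intro huv
            have h1 := h.mem_left huv
            have h2 := h.mem_right huv
            have := huv.ne
            grind
          · rintro ⟨⟨rfl, rfl⟩ | ⟨rfl, rfl⟩, _⟩
            exacts [hz, hz.symm]
        · rintro rfl
          have h0 : TreeOn {x} (⊥ : SimpleGraph V) :=
            ⟨by simp, by simp, by simp, SimpleGraph.isAcyclic_bot⟩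
          have := h0.sup_edge (v := x) (w := y) (by simp) (by simpa using hxy.symm)
          rwa [bot_sup_eq, Finset.pair_comm] at this
    rw [h1]
    interval_cases s <;> rfl
  · have h1 := sum_hang (S := S) (by omega)
    have h2 := sum_powerset_pow (S := S) (j := s - 2) (by omega)
    rw [← Finset.sum_erase_add _ _ (Finset.empty_mem_powerset S)] at h1 h2
    have h3 : ∀ W ∈ S.powerset.erase ∅, (-1 : ℤ) ^ W.card * hang S W =
        (-1 : ℤ) ^ W.card * ((S.card - W.card : ℕ) : ℤ) ^ (s - 2) := by
      intro W hW
      rw [Finset.mem_erase, Finset.mem_powerset] at hW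
      obtain ⟨hW0, hWS⟩ := hW
      have hWpos : 0 < W.card := Finset.card_pos.2 (Finset.nonempty_iff_ne_empty.2 hW0)
      have hWle : W.card ≤ s := hs ▸ Finset.card_le_card hWS
      congr 1
      rw [hang_eq hWS, hs]
      have hc : (S \ W).card = s - W.card := by rw [Finset.card_sdiff_of_subset hWS, hs]
      rcases Nat.eq_or_lt_of_le hWle with he | hl
      · have : S \ W = ∅ := by rw [← Finset.card_eq_zero, hc]; omega
        rw [this, trees_empty, he]
        have : s - 2 ≠ 0 := by omega
        simp [this]
      · rw [ih (s - W.card) (by omega) (Finset.card_pos.1 (by omega)) hc]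
        push_cast
        rcases Nat.eq_or_lt_of_le (show W.card ≤ s - 1 by omega) with he | hl
        · have : s - W.card = 1 := by omega
          simp [this]
        · rw [← pow_add]
          congr 1
          omega
    rw [Finset.sum_congr rfl h3] at h1
    have h4 : hang S ∅ = (trees S).card := by simp [hang]
    simp only [Finset.card_empty, pow_zero, one_mul, h4, Nat.sub_zero, hs] at h1 h2
    have : ((trees S).card : ℤ) = (s : ℤ) ^ (s - 2) := by linarith
    exact_mod_cast this

end Cayley

section Moments

variable {V : Type*} [Fintype V] {G : SimpleGraph V} {S : Finset V} {v w : V} {a : List V}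

/-- The duplicate-free lists with entries in `N`. -/
def nlists (N : Finset V) : Finset (List V) :=
  ((Finset.univ : Finset {l : List V // l.Nodup}).image Subtype.val).filter (fun l => ∀ x ∈ l, x ∈ N)

lemma mem_nlists {N : Finset V} {l : List V} : l ∈ nlists N ↔ l.Nodup ∧ ∀ x ∈ l, x ∈ N := by
  simp [nlists]

lemma sum_nlists {M : Type*} [AddCommMonoid M] (N : Finset V) (f : List V → M) :
    ∑ l ∈ nlists N, f l = f [] + ∑ x ∈ N, ∑ l ∈ nlists (N \ {x}), f (x :: l) := by
  have h1 : [] ∈ nlists N := by simp [mem_nlists]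
  rw [← Finset.add_sum_erase _ _ h1, Finset.sum_sigma']
  congr 1
  symm
  refine Finset.sum_bij (fun p _ => p.1 :: p.2) ?_ ?_ ?_ ?_
  · rintro ⟨x, l⟩ h
    simp only [Finset.mem_sigma, mem_nlists, Finset.mem_erase] at h ⊢
    grind
  · rintro ⟨x, l⟩ _ ⟨y, m⟩ _ h
    simpa using h
  · intro l hl
    cases l with
    | nil => simp at hl
    | cons x l =>
      refine ⟨⟨x, l⟩, ?_, rfl⟩
      simp only [Finset.mem_sigma, mem_nlists, Finset.mem_erase] at hl ⊢
      grind
  · intros; rfl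

lemma sum_nlists_length (N : Finset V) (g : ℕ → ℝ) :
    ∑ l ∈ nlists N, ((N.card - l.length).factorial : ℝ) * g (N.card - l.length) =
      N.card.factorial * ∑ m ∈ Finset.range (N.card + 1), g m := by
  induction' hn : N.card with n ih generalizing N
  · rw [Finset.card_eq_zero.1 hn, sum_nlists]
    simp
  · rw [sum_nlists, Finset.sum_congr rfl (g := fun _ => (n.factorial : ℝ) *
      ∑ m ∈ Finset.range (n + 1), g m)]
    · rw [Finset.sum_const, hn, Finset.sum_range_succ _ (n + 1)]
      simp [Nat.factorial_succ]
      ring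
    · intro x hx
      rw [← ih (N \ {x}) (by rw [Finset.card_sdiff_of_subset (by simpa using hx)]; simp [hn])]
      simp

lemma sum_nlists_erase_length (N : Finset V) (g : ℕ → ℝ) :
    ∑ l ∈ (nlists N).erase [], ((N.card - l.length).factorial : ℝ) * g (N.card - l.length) =
      N.card.factorial * ∑ m ∈ Finset.range N.card, g m := by
  have h1 : [] ∈ nlists N := by simp [mem_nlists]
  have h2 := sum_nlists_length N g
  rw [← Finset.add_sum_erase _ _ h1, Finset.sum_range_succ, mul_add] at h2
  simp only [List.length_nil, Nat.sub_zero] at h2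
  linarith

/-- The legs attached to `v` that avoid `w`. -/
def legs (G : SimpleGraph V) (v w : V) : Finset (List V) :=
  (nlists Finset.univ).filter (fun a => IsLeg G v a ∧ w ∉ a)

lemma mem_legs : a ∈ legs G v w ↔ IsLeg G v a ∧ w ∉ a := by
  simp only [legs, Finset.mem_filter, mem_nlists, Finset.mem_univ, implies_true, and_true,
    and_iff_right_iff_imp]
  intro h
  have := h.1.2.1
  grind

lemma sum_trees_legs {M : Type*} [AddCommMonoid M] (hv : v ∈ S) (F : SimpleGraph V → M) :
    ∑ G ∈ trees S, ∑ a ∈ legs G v w, F (detach G a.toFinset) =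
      ∑ a ∈ (nlists (S \ {v, w})).erase [], ∑ G ∈ trees (S \ a.toFinset), F G := by
  rw [Finset.sum_comm' (t' := (nlists (S \ {v, w})).erase [])
    (s' := fun a => (trees S).filter (fun G => IsLeg G v a))]
  · refine Finset.sum_congr rfl fun a ha => ?_
    simp only [Finset.mem_erase, mem_nlists] at ha
    exact sum_trees_isLeg hv ha.1 (by grind) (by grind) F
  · intro G a
    simp only [Finset.mem_filter, mem_trees, mem_legs, Finset.mem_erase, mem_nlists]
    constructor
    · rintro ⟨h1, h2, h3⟩
      have := h2.base_notMem
      have := h2.2.1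
      refine ⟨⟨h1, h2⟩, h2.1, by grind, fun x hx => ?_⟩
      have := h2.mem_of_treeOn h1 hx
      grind
    · rintro ⟨⟨h1, h2⟩, h3, h4, h5⟩
      exact ⟨h1, h2, by grind⟩

lemma legs_detach (ha : a ∈ legs G v w) :
    legs (detach G a.toFinset) v w = (legs G v w).erase a := by
  have ha' := mem_legs.1 ha
  ext b
  rw [Finset.mem_erase, mem_legs, mem_legs]
  constructor
  · rintro ⟨h1, h2⟩
    have hd : ∀ x ∈ b, x ∉ a := fun x hx => by simpa using isLeg_detach_disjoint h1 hx
    refine ⟨?_, (ha'.1.isLeg_detach_iff hd h1.base_notMem).1 h1, h2⟩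
    rintro rfl
    obtain ⟨x, hx⟩ := List.exists_mem_of_ne_nil _ h1.1
    exact hd x hx hx
  · rintro ⟨h0, h1, h2⟩
    refine ⟨(ha'.1.isLeg_detach_iff (fun x hx hxa => h0 (h1.eq_of_mem ha'.1 hx hxa))
      h1.base_notMem).2 h1, h2⟩

lemma legs_detach_other (ha : a ∈ legs G v w) (hvw : v ≠ w) :
    legs (detach G a.toFinset) w v = legs G w v := by
  have ha' := mem_legs.1 ha
  ext b
  rw [mem_legs, mem_legs]
  constructor
  · rintro ⟨h1, h2⟩
    have hd : ∀ x ∈ b, x ∉ a := fun x hx => by simpa using isLeg_detach_disjoint h1 hx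
    exact ⟨(ha'.1.isLeg_detach_iff hd h2).1 h1, h2⟩
  · rintro ⟨h1, h2⟩
    refine ⟨(ha'.1.isLeg_detach_iff (fun z hz hza => ?_) h2).2 h1, h2⟩
    obtain ⟨x, l, rfl, hx⟩ := ha'.1.exists_cons
    rcases h1.closed (ha'.1.head_mem h1 ha'.2 hza hz) hx.symm with h | h
    · exact h2 h
    · exact hvw h

/-- Iterated partial sums. -/
def psum (f : ℕ → ℝ) : ℕ → ℕ → ℝ
  | 0 => f
  | j + 1 => fun n => ∑ m ∈ Finset.range n, psum f j m

lemma psum_eq_zero {f : ℕ → ℝ} {c : ℕ} (hf : ∀ m < c, f m = 0) (j : ℕ) {n : ℕ} (hn : n < c + j) :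
    psum f j n = 0 := by
  induction j generalizing n with
  | zero => exact hf n hn
  | succ j ih =>
    exact Finset.sum_eq_zero fun m hm => ih (by have := Finset.mem_range.1 hm; omega)

/-- Exponential coefficients of the tree function. -/
def tau (n : ℕ) : ℝ := (n : ℝ) ^ n / (n * n.factorial)

/-- Coefficients for trees with two marked vertices. -/
def tau2 (n : ℕ) : ℝ := ((n : ℝ) - 1) * tau n

lemma tau_zero : tau 0 = 0 := by simp [tau]

lemma tau_eq_zero : ∀ m < 1, tau m = 0 := by
  intro m hm; interval_cases m; exact tau_zero

lemma tau2_eq_zero : ∀ m < 2, tau2 m = 0 := by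
  intro m hm; interval_cases m <;> simp [tau2, tau_zero]

lemma card_trees_tau (hS : S.Nonempty) :
    ((trees S).card : ℝ) = (S.card - 1).factorial * tau S.card := by
  rw [card_trees hS, tau]
  obtain ⟨n, hn⟩ : ∃ n, S.card = n + 1 := ⟨S.card - 1, by have := hS.card_pos; omega⟩
  rw [hn, Nat.factorial_succ]
  have h1 := (Nat.factorial_pos n).ne'
  have h2 : ((n : ℝ) + 1) ≠ 0 := by positivity
  have h3 : (n.factorial : ℝ) ≠ 0 := by exact_mod_cast h1
  rcases n with _ | n
  · simp
  · have e1 : n + 1 + 1 - 2 = n := by omega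
    rw [e1]
    push_cast at h2 ⊢
    field_simp
    ring

lemma card_trees_tau2 (hS : 2 ≤ S.card) :
    ((trees S).card : ℝ) = (S.card - 2).factorial * tau2 S.card := by
  rw [card_trees_tau (Finset.card_pos.1 (by omega)), tau2]
  obtain ⟨n, hn⟩ : ∃ n, S.card = n + 2 := ⟨S.card - 2, by omega⟩
  rw [hn]
  have e1 : n + 2 - 1 = n + 1 := by omega
  rw [e1, Nat.factorial_succ]
  push_cast
  ring

lemma sum_descFactorial_legs (hv : v ∈ S) (j : ℕ) :
    ∑ G ∈ trees S, (((legs G v v).card.descFactorial j : ℕ) : ℝ) =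
      (S.card - 1).factorial * psum tau j S.card := by
  induction j generalizing S with
  | zero => simp [psum, card_trees_tau ⟨v, hv⟩]
  | succ j ih =>
    have h1 : ∀ G ∈ trees S, (((legs G v v).card.descFactorial (j + 1) : ℕ) : ℝ) =
        ∑ a ∈ legs G v v, (((legs (detach G a.toFinset) v v).card.descFactorial j : ℕ) : ℝ) := by
      intro G _
      rw [Finset.sum_congr rfl (g := fun _ => ((((legs G v v).card - 1).descFactorial j : ℕ) : ℝ))]
      · rw [Finset.sum_const]
        rcases (legs G v v).card with _ | n
        · simp
        · rw [Nat.succ_descFactorial_succ]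
          simp
      · intro a ha
        rw [legs_detach ha, Finset.card_erase_of_mem ha]
    rw [Finset.sum_congr rfl h1, sum_trees_legs hv
      (fun G => (((legs G v v).card.descFactorial j : ℕ) : ℝ))]
    have hc : (S \ {v, v}).card = S.card - 1 := by
      rw [Finset.card_sdiff_of_subset (by simpa using hv)]; simp
    have hpos : 0 < S.card := Finset.card_pos.2 ⟨v, hv⟩
    have h2 := sum_nlists_erase_length (S \ {v, v}) (fun m => psum tau j (m + 1))
    rw [hc] at h2
    have e : psum tau (j + 1) S.card = ∑ m ∈ Finset.range (S.card - 1), psum tau j (m + 1) := by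
      obtain ⟨n, hn⟩ : ∃ n, S.card = n + 1 := ⟨S.card - 1, by omega⟩
      change ∑ m ∈ Finset.range S.card, psum tau j m = _
      rw [hn, Finset.sum_range_succ', psum_eq_zero tau_eq_zero j (n := 0) (by omega)]
      simp
    rw [e, ← h2]
    refine Finset.sum_congr rfl fun a ha => ?_
    simp only [Finset.mem_erase, mem_nlists] at ha
    have hlen : a.toFinset.card = a.length := List.toFinset_card_of_nodup ha.2.1
    have hsub : a.toFinset ⊆ S \ {v} := fun x hx => by
      have := ha.2.2 x (by simpa using hx); simpa using this
    have hle := Finset.card_le_card hsub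
    rw [Finset.card_sdiff_of_subset (by simpa using hv), Finset.card_singleton] at hle
    have hc' : (S \ a.toFinset).card = S.card - a.length := by
      rw [Finset.card_sdiff_of_subset (hsub.trans Finset.sdiff_subset), hlen]
    rw [ih (S := S \ a.toFinset) (by have := ha.2.2 v; grind), hc']
    have e1 : S.card - a.length - 1 = S.card - 1 - a.length := by omega
    have e2 : S.card - 1 - a.length + 1 = S.card - a.length := by omega
    rw [e1, e2]

lemma sum_descFactorial_legs_pair_succ {i j : ℕ}
    (h : ∀ S : Finset V, v ∈ S → w ∈ S → ∑ G ∈ trees S, (((legs G v w).card.descFactorial i : ℕ) : ℝ) *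
      (((legs G w v).card.descFactorial j : ℕ) : ℝ) =
      (S.card - 2).factorial * psum tau2 (i + j) S.card)
    (hv : v ∈ S) (hw : w ∈ S) (hvw : v ≠ w) :
    ∑ G ∈ trees S, (((legs G v w).card.descFactorial (i + 1) : ℕ) : ℝ) *
      (((legs G w v).card.descFactorial j : ℕ) : ℝ) =
      (S.card - 2).factorial * psum tau2 (i + 1 + j) S.card := by
  have h1 : ∀ G ∈ trees S, (((legs G v w).card.descFactorial (i + 1) : ℕ) : ℝ) *
      (((legs G w v).card.descFactorial j : ℕ) : ℝ) =
      ∑ a ∈ legs G v w, (((legs (detach G a.toFinset) v w).card.descFactorial i : ℕ) : ℝ) *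
        (((legs (detach G a.toFinset) w v).card.descFactorial j : ℕ) : ℝ) := by
    intro G _
    rw [Finset.sum_congr rfl (g := fun _ => ((((legs G v w).card - 1).descFactorial i : ℕ) : ℝ) *
      (((legs G w v).card.descFactorial j : ℕ) : ℝ))]
    · rw [Finset.sum_const]
      rcases (legs G v w).card with _ | n
      · simp
      · rw [Nat.succ_descFactorial_succ]
        simp
        ring
    · intro a ha
      rw [legs_detach ha, Finset.card_erase_of_mem ha, legs_detach_other ha hvw]
  rw [Finset.sum_congr rfl h1, sum_trees_legs hv
    (fun G => (((legs G v w).card.descFactorial i : ℕ) : ℝ) *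
      (((legs G w v).card.descFactorial j : ℕ) : ℝ))]
  have hsubS : ({v, w} : Finset V) ⊆ S := by
    intro x hx; simp at hx; rcases hx with rfl | rfl <;> assumption
  have hc : (S \ {v, w}).card = S.card - 2 := by
    rw [Finset.card_sdiff_of_subset hsubS, Finset.card_pair hvw]
  have hpos : 2 ≤ S.card := by
    have := Finset.card_le_card hsubS
    rwa [Finset.card_pair hvw] at this
  have h2 := sum_nlists_erase_length (S \ {v, w}) (fun m => psum tau2 (i + j) (m + 2))
  rw [hc] at h2
  have e : psum tau2 (i + 1 + j) S.card =
      ∑ m ∈ Finset.range (S.card - 2), psum tau2 (i + j) (m + 2) := by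
    obtain ⟨n, hn⟩ : ∃ n, S.card = n + 2 := ⟨S.card - 2, by omega⟩
    have e0 : i + 1 + j = i + j + 1 := by omega
    rw [e0]
    change ∑ m ∈ Finset.range S.card, psum tau2 (i + j) m = _
    rw [hn, Finset.sum_range_succ', Finset.sum_range_succ',
      psum_eq_zero tau2_eq_zero (i + j) (n := 0) (by omega),
      psum_eq_zero tau2_eq_zero (i + j) (n := 0 + 1) (by omega)]
    simp
  rw [e, ← h2]
  refine Finset.sum_congr rfl fun a ha => ?_
  simp only [Finset.mem_erase, mem_nlists] at ha
  have hlen : a.toFinset.card = a.length := List.toFinset_card_of_nodup ha.2.1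
  have hsub : a.toFinset ⊆ S \ {v, w} := fun x hx => ha.2.2 x (by simpa using hx)
  have hle := Finset.card_le_card hsub
  rw [hc, hlen] at hle
  have hc' : (S \ a.toFinset).card = S.card - a.length := by
    rw [Finset.card_sdiff_of_subset (hsub.trans Finset.sdiff_subset), hlen]
  rw [h (S \ a.toFinset) (by have := ha.2.2 v; grind) (by have := ha.2.2 w; grind), hc']
  have e1 : S.card - a.length - 2 = S.card - 2 - a.length := by omega
  have e2 : S.card - 2 - a.length + 2 = S.card - a.length := by omega
  rw [e1, e2]

lemma sum_descFactorial_legs_pair (hv : v ∈ S) (hw : w ∈ S) (hvw : v ≠ w) (i j : ℕ) :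
    ∑ G ∈ trees S, (((legs G v w).card.descFactorial i : ℕ) : ℝ) *
      (((legs G w v).card.descFactorial j : ℕ) : ℝ) =
      (S.card - 2).factorial * psum tau2 (i + j) S.card := by
  have h0 : ∀ (v w : V), v ≠ w → ∀ (S : Finset V), v ∈ S → w ∈ S →
      ∑ G ∈ trees S, (((legs G v w).card.descFactorial i : ℕ) : ℝ) *
      (((legs G w v).card.descFactorial 0 : ℕ) : ℝ) =
      (S.card - 2).factorial * psum tau2 (i + 0) S.card := by
    intro v w hvw
    induction i with
    | zero =>
      intro S hv hw
      have hsubS : ({v, w} : Finset V) ⊆ S := by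
        intro x hx; simp at hx; rcases hx with rfl | rfl <;> assumption
      have hpos : 2 ≤ S.card := by
        have := Finset.card_le_card hsubS
        rwa [Finset.card_pair hvw] at this
      simp [psum, card_trees_tau2 hpos]
    | succ i ih => exact fun S hv hw => sum_descFactorial_legs_pair_succ ih hv hw hvw
  induction j generalizing S with
  | zero => exact h0 v w hvw S hv hw
  | succ j ih =>
    have := sum_descFactorial_legs_pair_succ (v := w) (w := v) (i := j) (j := i) (S := S)
      (fun S hw hv => by
        rw [← add_comm i j, ← ih hv hw]
        exact Finset.sum_congr rfl fun _ _ => mul_comm _ _) hw hv hvw.symm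
    rw [show i + (j + 1) = j + 1 + i by ring, ← this]
    exact Finset.sum_congr rfl fun _ _ => mul_comm _ _

lemma TreeOn.card_legs_lt (hG : TreeOn S G) (hv : v ∈ S) : (legs G v v).card < S.card := by
  have h := sum_descFactorial_legs hv S.card
  rw [psum_eq_zero tau_eq_zero S.card (by omega), mul_zero] at h
  have h1 := (Finset.sum_eq_zero_iff_of_nonneg (fun _ _ => by positivity)).1 h G (mem_trees.2 hG)
  have h2 : (legs G v v).card.descFactorial S.card = 0 := by exact_mod_cast h1
  exact Nat.descFactorial_eq_zero_iff_lt.1 h2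

lemma legs_subset_legs_self (G : SimpleGraph V) (v w : V) : legs G v w ⊆ legs G v v := by
  intro a ha
  rw [mem_legs] at ha ⊢
  exact ⟨ha.1, ha.1.base_notMem⟩

/-- `c` are the coefficients of `g` with respect to the falling factorials. -/
def FallingCoeff (g c : ℕ → ℝ) : Prop :=
  ∀ l, g l = ∑ j ∈ Finset.range (l + 1), c j * l.descFactorial j

lemma FallingCoeff.eq_of_lt {g c : ℕ → ℝ} (h : FallingCoeff g c) {l n : ℕ} (hl : l < n) :
    g l = ∑ j ∈ Finset.range n, c j * l.descFactorial j := by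
  rw [h l]
  refine Finset.sum_subset (by simpa using hl) fun j _ hj => ?_
  rw [Nat.descFactorial_eq_zero_iff_lt.2 (by simpa [Nat.lt_succ_iff] using hj)]
  simp

lemma sum_legs {g c : ℕ → ℝ} (h : FallingCoeff g c) (hv : v ∈ S) :
    ∑ G ∈ trees S, g (legs G v v).card =
      (S.card - 1).factorial * ∑ j ∈ Finset.range S.card, c j * psum tau j S.card := by
  rw [Finset.sum_congr rfl fun G hG => h.eq_of_lt ((mem_trees.1 hG).card_legs_lt hv),
    Finset.sum_comm, Finset.mul_sum]
  refine Finset.sum_congr rfl fun j _ => ?_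
  rw [← Finset.mul_sum, sum_descFactorial_legs hv]
  ring

lemma sum_legs_pair {g c : ℕ → ℝ} (h : FallingCoeff g c) (hv : v ∈ S) (hw : w ∈ S)
    (hvw : v ≠ w) :
    ∑ G ∈ trees S, g (legs G v w).card * g (legs G w v).card =
      (S.card - 2).factorial * ∑ i ∈ Finset.range S.card, ∑ j ∈ Finset.range S.card,
        c i * c j * psum tau2 (i + j) S.card := by
  have h1 : ∀ G ∈ trees S, g (legs G v w).card * g (legs G w v).card =
      ∑ i ∈ Finset.range S.card, ∑ j ∈ Finset.range S.card, c i * c j *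
        ((((legs G v w).card.descFactorial i : ℕ) : ℝ) *
        (((legs G w v).card.descFactorial j : ℕ) : ℝ)) := by
    intro G hG
    have hG := mem_trees.1 hG
    rw [h.eq_of_lt ((Finset.card_le_card (legs_subset_legs_self G v w)).trans_lt
      (hG.card_legs_lt hv)), h.eq_of_lt ((Finset.card_le_card (legs_subset_legs_self G w v)).trans_lt
      (hG.card_legs_lt hw)), Finset.sum_mul_sum]
    exact Finset.sum_congr rfl fun i _ => Finset.sum_congr rfl fun j _ => by ring
  rw [Finset.sum_congr rfl h1, Finset.sum_comm, Finset.mul_sum]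
  refine Finset.sum_congr rfl fun i _ => ?_
  rw [Finset.sum_comm, Finset.mul_sum]
  refine Finset.sum_congr rfl fun j _ => ?_
  rw [← Finset.mul_sum, sum_descFactorial_legs_pair hv hw hvw]
  ring

end Moments

section Branch

variable {V : Type*} {G : SimpleGraph V} {S : Finset V} {v w m z x y : V} {a b : List V}

/-- `v` has at least three neighbours. -/
def Branch (G : SimpleGraph V) (v : V) : Prop :=
  ∃ p q r, p ≠ q ∧ p ≠ r ∧ q ≠ r ∧ G.Adj v p ∧ G.Adj v q ∧ G.Adj v r

lemma not_branch_chain {l : List V} (hl : l.Nodup) (x : V) : ¬ Branch (chain l) x := by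
  induction l using chain.induct with
  | case1 => simp [chain, Branch]
  | case2 => simp [chain, Branch]
  | case3 a b l ih =>
    rintro ⟨p, q, r, hpq, hpr, hqr, hp, hq, hr⟩
    by_cases hxa : x = a
    · subst hxa
      have h1 := chain_cons_adj_head hl hp
      have h2 := chain_cons_adj_head hl hq
      simp at h1 h2
      exact hpq (h1.symm.trans h2)
    have hbl : (b :: l).Nodup := by grind
    simp only [chain, SimpleGraph.sup_adj, SimpleGraph.edge_adj] at hp hq hr
    by_cases hxb : x = b
    · subst hxb
      have h3 : ∀ {s t}, (chain (x :: l)).Adj x s → (chain (x :: l)).Adj x t → s = t := by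
        intro s t hs ht
        have h1 := chain_cons_adj_head hbl hs
        have h2 := chain_cons_adj_head hbl ht
        rw [h1] at h2
        exact Option.some.inj h2
      grind
    · exact ih hbl ⟨p, q, r, hpq, hpr, hqr, by tauto, by tauto, by tauto⟩

lemma IsLeg.not_branch (h : IsLeg G v a) (hx : x ∈ a) : ¬ Branch G x := by
  rintro ⟨p, q, r, hpq, hpr, hqr, hp, hq, hr⟩
  exact not_branch_chain h.2.1 x ⟨p, q, r, hpq, hpr, hqr, (h.2.2 x hx p).1 hp,
    (h.2.2 x hx q).1 hq, (h.2.2 x hx r).1 hr⟩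

lemma TreeOn.reachable (h : TreeOn S G) (hx : x ∈ S) (hy : y ∈ S) : G.Reachable x y :=
  h.2.2.1 x hx y hy

lemma TreeOn.dist_adj (h : TreeOn S G) (hxy : G.Adj x y) (hw : w ∈ S) :
    G.dist x w = G.dist y w + 1 ∨ G.dist y w = G.dist x w + 1 := by
  have := h.2.2.2.dist_eq_dist_add_one_of_adj_of_reachable w hxy (h.reachable hw (h.mem_left hxy))
  rwa [G.dist_comm (u := w), G.dist_comm (u := w)] at this

lemma TreeOn.exists_closer (h : TreeOn S G) (hx : x ∈ S) (hw : w ∈ S) (hne : x ≠ w) :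
    ∃ y, G.Adj x y ∧ G.dist x w = G.dist y w + 1 := by
  obtain ⟨p, hp⟩ := (h.reachable hx hw).exists_walk_length_eq_dist
  cases p with
  | nil => exact absurd rfl hne
  | @cons _ y _ hadj q =>
    refine ⟨y, hadj, ?_⟩
    rw [SimpleGraph.Walk.length_cons] at hp
    have := G.dist_le q
    rcases h.dist_adj hadj hw with h | h <;> omega

lemma TreeOn.closer_unique (h : TreeOn S G) (hw : w ∈ S) (hy : G.Adj x y) (hz : G.Adj x z)
    (hyw : G.dist x w = G.dist y w + 1) (hzw : G.dist x w = G.dist z w + 1) : y = z := by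
  obtain ⟨p, hp⟩ := (h.reachable (h.mem_right hy) hw).exists_walk_length_eq_dist
  obtain ⟨q, hq⟩ := (h.reachable (h.mem_right hz) hw).exists_walk_length_eq_dist
  have hp' := (SimpleGraph.Walk.cons hy p).isPath_of_length_eq_dist (by simp [hp, hyw])
  have hq' := (SimpleGraph.Walk.cons hz q).isPath_of_length_eq_dist (by simp [hq, hzw])
  have := (h.2.2.2.subsingleton_path x w).elim ⟨_, hp'⟩ ⟨_, hq'⟩
  have h2 := congrArg (fun r : G.Path x w => r.1.snd) this
  simpa using h2

/-- A walk leaving a set that can only be left through `v` is longer than the distance to `v`. -/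
lemma dist_lt_length {P : V → Prop} (hP : ∀ x y, P x → G.Adj x y → P y ∨ y = v)
    (hx : P x) (hw : ¬ P w) (p : G.Walk x w) : G.dist v w < p.length := by
  induction p with
  | nil => exact absurd hx hw
  | cons hadj q ih =>
    rw [SimpleGraph.Walk.length_cons]
    rcases hP _ _ hx hadj with h | h
    · exact (ih h hw).trans (Nat.lt_succ_self _)
    · subst h
      exact Nat.lt_succ_of_le (G.dist_le q)

lemma TreeOn.dist_lt_dist {P : V → Prop} (h : TreeOn S G)
    (hP : ∀ x y, P x → G.Adj x y → P y ∨ y = v)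
    (hxS : x ∈ S) (hwS : w ∈ S) (hx : P x) (hw : ¬ P w) : G.dist v w < G.dist x w := by
  obtain ⟨p, hp⟩ := (h.reachable hxS hwS).exists_walk_length_eq_dist
  exact hp ▸ dist_lt_length hP hx hw p

/-- The vertices of the branch at `m` through its neighbour `z`. -/
def Br (S : Finset V) (G : SimpleGraph V) (m z : V) : Finset V :=
  S.filter (fun w => G.dist m w = G.dist z w + 1)

lemma mem_Br : w ∈ Br S G m z ↔ w ∈ S ∧ G.dist m w = G.dist z w + 1 := by simp [Br]

lemma TreeOn.self_mem_Br (h : TreeOn S G) (hmz : G.Adj m z) : z ∈ Br S G m z :=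
  mem_Br.2 ⟨h.mem_right hmz, by simp [SimpleGraph.dist_eq_one_iff_adj.2 hmz]⟩

lemma notMem_Br : m ∉ Br S G m z := by simp [mem_Br]

lemma TreeOn.Br_closed (h : TreeOn S G) (hmz : G.Adj m z) (hx : x ∈ Br S G m z) (hxy : G.Adj x y) :
    y ∈ Br S G m z ∨ (x = z ∧ y = m) := by
  rw [mem_Br] at hx
  have hy := h.mem_right hxy
  by_contra! hcon
  obtain ⟨h1, h2⟩ := hcon
  rw [mem_Br, not_and] at h1
  have h3 := (h.dist_adj hmz hy).resolve_left (h1 hy)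
  have e1 := h.dist_adj hxy (h.mem_left hmz)
  have e2 := h.dist_adj hxy (h.mem_right hmz)
  have hmS := h.mem_left hmz
  rw [G.dist_comm (u := x), G.dist_comm (u := y)] at e1 e2
  have h4 : G.dist m x = G.dist m y + 1 := by omega
  by_cases hym : y = m
  · subst hym
    rw [SimpleGraph.dist_self] at h4
    have h5 : G.dist z x = 0 := by omega
    exact h2 ((h.reachable (h.mem_right hmz) hx.1).dist_eq_zero_iff.1 h5).symm rfl
  · obtain ⟨k, hk, hk2⟩ := h.exists_closer hmS hy (Ne.symm hym)
    have e3 := h.dist_adj hxy (h.mem_right hk)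
    have e4 := h.dist_adj hk hx.1
    rw [G.dist_comm (u := x), G.dist_comm (u := y)] at e3
    have h6 : k = z := h.closer_unique hx.1 hk hmz (by omega) hx.2
    subst h6
    omega

lemma TreeOn.Br_subset (h : TreeOn S G) (hmz : G.Adj m z) (hzx : G.Adj z x) (hx : x ≠ m) :
    Br S G z x ⊆ Br S G m z := by
  intro w hw
  rw [mem_Br] at hw ⊢
  refine ⟨hw.1, (h.dist_adj hmz hw.1).resolve_right fun h1 => ?_⟩
  exact hx (h.closer_unique hw.1 hzx hmz.symm hw.2 h1)

lemma TreeOn.Br_ssubset (h : TreeOn S G) (hmz : G.Adj m z) (hzx : G.Adj z x) (hx : x ≠ m) :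
    Br S G z x ⊂ Br S G m z :=
  (Finset.ssubset_iff_of_subset (h.Br_subset hmz hzx hx)).2 ⟨z, h.self_mem_Br hmz, notMem_Br⟩

lemma TreeOn.dist_lt_of_mem_Br (h : TreeOn S G) (hmz : G.Adj m z) (hw : w ∈ Br S G m z)
    (hy : y ∈ S) (hy' : y ∉ Br S G m z) : G.dist z w < G.dist y w := by
  refine h.dist_lt_dist (P := fun x => x ∉ Br S G m z) ?_ hy (mem_Br.1 hw).1 hy' (by simpa using hw)
  intro x y hx hxy
  by_cases hyB : y ∈ Br S G m z
  · rcases h.Br_closed hmz hyB hxy.symm with h1 | h1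
    · exact absurd h1 hx
    · exact Or.inr h1.1
  · exact Or.inl hyB

lemma chain_head_mem' {G : SimpleGraph V} {P : V → Prop} {h : V} {l : List V}
    (hG : chain (h :: l) ≤ G) (hn : (h :: l).Nodup)
    (hP : ∀ x y, P x → x ∈ h :: l → G.Adj x y → y ∈ h :: l → P y) {x : V} (hx : x ∈ h :: l)
    (hPx : P x) : P h :=
  (chain_head_mem (P := fun x => P x ∧ x ∈ h :: l) hG hn
    (fun x y hx hxy hy => ⟨hP x y hx.1 hx.2 hxy hy, hy⟩) hx ⟨hPx, hx⟩).1

lemma IsLeg.subset_Br {l : List V} (ha : IsLeg G m (z :: l)) (h : TreeOn S G) (hmz : G.Adj m z)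
    (hx : x ∈ z :: l) : x ∈ Br S G m z := by
  by_contra hxB
  refine chain_head_mem' (P := fun x => x ∉ Br S G m z) ((chain_tail_le m _).trans ha.chain_le)
    (by have := ha.2.1; grind) ?_ hx hxB (h.self_mem_Br hmz)
  intro x y hx hxl hxy _ hyB
  rcases h.Br_closed hmz hyB hxy.symm with h1 | h1
  · exact hx h1
  · exact ha.base_notMem (h1.2 ▸ hxl)

lemma IsLeg.cons_cons {l : List V} (ha : IsLeg G z (x :: l)) (hzx : ∀ y, G.Adj z y ↔ y = m ∨ y = x)
    (hxm : x ≠ m) : IsLeg G m (z :: x :: l) := by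
  have hzm : G.Adj z m := (hzx m).2 (Or.inl rfl)
  have hm : m ∉ x :: l := fun hm => by
    have := ha.adj_base hm hzm
    simp at this
    exact hxm this
  have h1 := ha.2.1
  have h2 := hzm.ne
  refine ⟨by simp, by grind, fun u hu y => ?_⟩
  have e : (chain (m :: z :: x :: l)).Adj u y ↔
      (((m = u ∧ z = y ∨ m = y ∧ z = u) ∧ u ≠ y) ∨ (chain (z :: x :: l)).Adj u y) := by
    rw [chain, SimpleGraph.sup_adj, SimpleGraph.edge_adj]
    grind
  rw [e]
  rcases List.mem_cons.1 hu with rfl | hu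
  · rw [hzx]
    constructor
    · rintro (rfl | rfl)
      · exact Or.inl ⟨Or.inr ⟨rfl, rfl⟩, h2⟩
      · exact Or.inr (chain_cons_cons_adj _ _ _ (by grind))
    · rintro (h | h)
      · grind
      · have := chain_cons_adj_head h1 h
        simp at this
        exact Or.inr this.symm
  · rw [ha.2.2 u hu y]
    grind

/-- A branch is either a leg or contains a vertex carrying two legs. -/
lemma TreeOn.leg_or_branch (h : TreeOn S G) (hmz : G.Adj m z) :
    (∃ l, IsLeg G m (z :: l)) ∨ ∃ v ∈ Br S G m z, Branch G v ∧ ∃ a b, a ≠ b ∧ IsLeg G v a ∧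
      IsLeg G v b ∧ (∀ x ∈ a, x ∈ Br S G m z) ∧ ∀ x ∈ b, x ∈ Br S G m z := by
  induction' hn : (Br S G m z).card using Nat.strong_induction_on with n ih generalizing m z
  have key : ∀ x, G.Adj z x → x ≠ m → (∃ l, IsLeg G z (x :: l)) ∨ ∃ v ∈ Br S G m z, Branch G v ∧
      ∃ a b, a ≠ b ∧ IsLeg G v a ∧
      IsLeg G v b ∧ (∀ x ∈ a, x ∈ Br S G m z) ∧ ∀ x ∈ b, x ∈ Br S G m z := by
    intro x hzx hxm
    have hs := h.Br_subset hmz hzx hxm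
    rcases ih _ (hn ▸ Finset.card_lt_card (h.Br_ssubset hmz hzx hxm)) hzx rfl with h1 | h1
    · exact Or.inl h1
    · obtain ⟨v, hv, hb, a, b, hab, ha, hb', h2, h3⟩ := h1
      exact Or.inr ⟨v, hs hv, hb, a, b, hab, ha, hb', fun x hx => hs (h2 x hx),
        fun x hx => hs (h3 x hx)⟩
  by_cases h0 : ∃ x, G.Adj z x ∧ x ≠ m
  · obtain ⟨x, hzx, hxm⟩ := h0
    rcases key x hzx hxm with ⟨l, hl⟩ | h1
    · by_cases h2 : ∃ y, G.Adj z y ∧ y ≠ m ∧ y ≠ x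
      · obtain ⟨y, hzy, hym, hyx⟩ := h2
        rcases key y hzy hym with ⟨k, hk⟩ | h3
        · refine Or.inr ⟨z, h.self_mem_Br hmz, ⟨m, x, y, hxm.symm, hym.symm, hyx.symm, hmz.symm,
            hzx, hzy⟩, x :: l, y :: k, by grind, hl, hk, fun u hu => ?_, fun u hu => ?_⟩
          · exact h.Br_subset hmz hzx hxm (hl.subset_Br h hzx hu)
          · exact h.Br_subset hmz hzy hym (hk.subset_Br h hzy hu)
        · exact Or.inr h3
      · push Not at h2
        refine Or.inl ⟨x :: l, hl.cons_cons (fun y => ?_) hxm⟩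
        constructor
        · intro hy
          by_cases hym : y = m
          · exact Or.inl hym
          · exact Or.inr (h2 y hy hym)
        · rintro (rfl | rfl)
          exacts [hmz.symm, hzx]
    · exact Or.inr h1
  · push Not at h0
    exact Or.inl ⟨[], isLeg_singleton.2 ⟨hmz.ne, fun y =>
      ⟨fun hy => h0 y hy, fun hy => hy ▸ hmz.symm⟩⟩⟩

end Branch

section ResolvingDimension

variable {V : Type*} {G : SimpleGraph V} {S R : Finset V} {v w m z x y : V} {a b : List V}

/-- `R` distinguishes the vertices of `S`. -/
def Res (S : Finset V) (G : SimpleGraph V) (R : Finset V) : Prop :=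
  ∀ u ∈ S, ∀ v ∈ S, u ≠ v → ∃ w ∈ R, G.edist u w ≠ G.edist v w

/-- The least cardinality of a subset of `S` distinguishing the vertices of `S`. -/
def rdim (S : Finset V) (G : SimpleGraph V) : ℕ :=
  sInf {m | ∃ R ⊆ S, R.card = m ∧ Res S G R}

lemma rdim_le (hRS : R ⊆ S) (hR : Res S G R) : rdim S G ≤ R.card :=
  Nat.sInf_le ⟨R, hRS, rfl, hR⟩

lemma res_self (S : Finset V) (G : SimpleGraph V) : Res S G S := by
  intro u hu v hv huv
  refine ⟨u, hu, ?_⟩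
  rw [SimpleGraph.edist_self]
  exact (SimpleGraph.edist_pos_of_ne huv.symm).ne

lemma exists_rdim (S : Finset V) (G : SimpleGraph V) : ∃ R ⊆ S, R.card = rdim S G ∧ Res S G R :=
  Nat.sInf_mem (s := {m | ∃ R ⊆ S, R.card = m ∧ Res S G R})
    ⟨S.card, S, Finset.Subset.refl S, rfl, res_self S G⟩

lemma rdim_le_card (S : Finset V) (G : SimpleGraph V) : rdim S G ≤ S.card :=
  rdim_le (Finset.Subset.refl S) (res_self S G)

lemma TreeOn.edist_eq_iff (h : TreeOn S G) (hx : x ∈ S) (hy : y ∈ S) (hw : w ∈ S) :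
    G.edist x w = G.edist y w ↔ G.dist x w = G.dist y w := by
  rw [← (h.reachable hx hw).coe_dist_eq_edist, ← (h.reachable hy hw).coe_dist_eq_edist]
  exact Nat.cast_inj

lemma TreeOn.branch_of_two_legs (h : TreeOn S G) (hS : ∃ u ∈ S, Branch G u) (ha : IsLeg G v a)
    (hb : IsLeg G v b) (hab : a ≠ b) : Branch G v := by
  obtain ⟨p, k, rfl, hp⟩ := ha.exists_cons
  obtain ⟨q, l, rfl, hq⟩ := hb.exists_cons
  have hpq : p ≠ q := by
    rintro rfl
    exact hab (by rw [ha.eq_of_head hb])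
  by_contra hno
  have hnbr : ∀ r, G.Adj v r → r = p ∨ r = q := by
    intro r hr
    by_contra! hcon
    exact hno ⟨p, q, r, hpq, hcon.1.symm, hcon.2.symm, hp, hq, hr⟩
  obtain ⟨u, hu, hbu⟩ := hS
  rcases h.subset_of_closed (P := fun x => x = v ∨ x ∈ p :: k ∨ x ∈ q :: l) (h.mem_left hp)
    (Or.inl rfl) (by
      rintro x y (rfl | hx | hx) hxy
      · have := hnbr y hxy
        grind
      · have := ha.closed hx hxy
        tauto
      · have := hb.closed hx hxy
        tauto) u hu with rfl | h1 | h1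
  · exact hno hbu
  · exact ha.not_branch h1 hbu
  · exact hb.not_branch h1 hbu

/-- Legs at different branch vertices are disjoint. -/
lemma legs_disjoint_of_branch (hw : Branch G w) (hvw : v ≠ w)
    (ha : IsLeg G v a) (hb : IsLeg G w b) (hza : z ∈ a) (hzb : z ∈ b) : v ∈ b := by
  obtain ⟨x, k, rfl, hx⟩ := ha.exists_cons
  have h1 := ha.head_mem hb (fun hw' => ha.not_branch hw' hw) hza hzb
  exact (hb.closed h1 hx.symm).resolve_right hvw

lemma IsLeg.dist_head {l : List V} (h : TreeOn S G) (ha : IsLeg G v (x :: l)) (hvx : G.Adj v x)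
    (hw : w ∈ S) (hwa : w ∉ x :: l) : G.dist x w = G.dist v w + 1 := by
  have h1 := h.dist_lt_dist (P := fun u => u ∈ x :: l) (v := v)
    (fun p q hp hpq => ha.closed hp hpq) (h.mem_right hvx) hw (by simp) hwa
  have := h.dist_adj hvx hw
  omega

lemma TreeOn.legs_hit (h : TreeOn S G) (hRS : R ⊆ S) (hR : Res S G R) (ha : IsLeg G v a)
    (hb : IsLeg G v b) (hab : a ≠ b) : (∃ z ∈ R, z ∈ a) ∨ ∃ z ∈ R, z ∈ b := by
  obtain ⟨x, k, rfl, hx⟩ := ha.exists_cons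
  obtain ⟨y, l, rfl, hy⟩ := hb.exists_cons
  have hxy : x ≠ y := by
    rintro rfl
    exact hab (by rw [ha.eq_of_head hb])
  obtain ⟨w, hwR, hw⟩ := hR x (h.mem_right hx) y (h.mem_right hy) hxy
  by_contra! hcon
  have h1 := ha.dist_head h hx (hRS hwR) (hcon.1 w hwR)
  have h2 := hb.dist_head h hy (hRS hwR) (hcon.2 w hwR)
  exact hw ((h.edist_eq_iff (h.mem_right hx) (h.mem_right hy) (hRS hwR)).2 (h1.trans h2.symm))

variable [Fintype V]

lemma TreeOn.branch_of_card_legs (h : TreeOn S G) (hS : ∃ u ∈ S, Branch G u)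
    (hv : 2 ≤ (legs G v v).card) : Branch G v := by
  obtain ⟨a, ha, b, hb, hab⟩ := Finset.one_lt_card.1 hv
  exact h.branch_of_two_legs hS (mem_legs.1 ha).1 (mem_legs.1 hb).1 hab

lemma TreeOn.sum_legs_le_rdim (h : TreeOn S G) (hS : ∃ u ∈ S, Branch G u) :
    ∑ v ∈ S, ((legs G v v).card - 1) ≤ rdim S G := by
  obtain ⟨R, hRS, hRc, hR⟩ := exists_rdim S G
  rw [← hRc]
  let H : V → Finset (List V) := fun v =>
    if 2 ≤ (legs G v v).card then (legs G v v).filter (fun a => ∃ z ∈ R, z ∈ a) else ∅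
  have hH : ∀ v a, a ∈ H v → Branch G v ∧ IsLeg G v a ∧ ∃ z ∈ R, z ∈ a := by
    intro v a ha
    by_cases h2 : 2 ≤ (legs G v v).card
    · simp only [H, if_pos h2, Finset.mem_filter] at ha
      exact ⟨h.branch_of_card_legs hS h2, (mem_legs.1 ha.1).1, ha.2⟩
    · simp [H, h2] at ha
  have h1 : ∀ v ∈ S, (legs G v v).card - 1 ≤ (H v).card := by
    intro v _
    by_cases h2 : 2 ≤ (legs G v v).card
    · simp only [H, if_pos h2]
      have h3 : ((legs G v v).filter (fun a => ¬ ∃ z ∈ R, z ∈ a)).card ≤ 1 := by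
        rw [Finset.card_le_one]
        intro a ha b hb
        rw [Finset.mem_filter] at ha hb
        by_contra hab
        rcases h.legs_hit hRS hR (mem_legs.1 ha.1).1 (mem_legs.1 hb.1).1 hab with h4 | h4
        exacts [ha.2 h4, hb.2 h4]
      have := Finset.card_filter_add_card_filter_not (s := legs G v v) (fun a => ∃ z ∈ R, z ∈ a)
      omega
    · omega
  refine (Finset.sum_le_sum h1).trans ?_
  rw [← Finset.card_sigma]
  have h2 : ∀ p : (Σ _ : V, List V), p ∈ S.sigma H → ∃ z, z ∈ R ∧ z ∈ p.2 := by
    rintro ⟨v, a⟩ hp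
    exact (hH v a (Finset.mem_sigma.1 hp).2).2.2
  have : Nonempty V := ⟨h.1.choose⟩
  choose! f hf using h2
  refine Finset.card_le_card_of_injOn f (fun p hp => (hf p hp).1) ?_
  rintro ⟨v, a⟩ hp ⟨w, b⟩ hq hpq
  have h3 := hH v a (Finset.mem_sigma.1 hp).2
  have h4 := hH w b (Finset.mem_sigma.1 hq).2
  have h5 := (hf _ hp).2
  have h6 := (hf _ hq).2
  rw [← hpq] at h6
  have hvw : v = w := by
    by_contra hvw
    exact h4.2.1.not_branch (legs_disjoint_of_branch h4.1 hvw h3.2.1 h4.2.1 h5 h6) h3.1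
  subst hvw
  rw [h3.2.1.eq_of_mem h4.2.1 h5 h6]

lemma TreeOn.rdim_le_sum_legs (h : TreeOn S G) (hS : ∃ u ∈ S, Branch G u) :
    rdim S G ≤ ∑ v ∈ S, ((legs G v v).card - 1) := by
  have hc : ∀ v, ∃ c, (legs G v v).Nonempty → c ∈ legs G v v := by
    intro v
    by_cases hne : (legs G v v).Nonempty
    · exact ⟨hne.choose, fun _ => hne.choose_spec⟩
    · exact ⟨[], fun h => absurd h hne⟩
  choose c hc using hc
  let R : Finset V := S.biUnion fun v => ((legs G v v).erase (c v)).image (fun a => a.getLastD v)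
  have hlast : ∀ (v : V) (a : List V), a ≠ [] → a.getLastD v ∈ a := by
    intro v a ha
    cases a with
    | nil => exact absurd rfl ha
    | cons x l => rw [List.getLastD_cons]; exact List.getLastD_mem_cons
  have hmem : ∀ v ∈ S, ∀ a, IsLeg G v a → a ≠ c v → ∃ z ∈ R, z ∈ a := by
    intro v hv a ha hac
    refine ⟨a.getLastD v, ?_, hlast v a ha.1⟩
    refine Finset.mem_biUnion.2 ⟨v, hv, Finset.mem_image.2 ⟨a, ?_, rfl⟩⟩
    exact Finset.mem_erase.2 ⟨hac, mem_legs.2 ⟨ha, ha.base_notMem⟩⟩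
  have hmem2 : ∀ v ∈ S, ∀ a b, IsLeg G v a → IsLeg G v b → a ≠ b → ∃ z ∈ R, z ∈ a ∨ z ∈ b := by
    intro v hv a b ha hb hab
    by_cases hac : a = c v
    · obtain ⟨z, hz, hzb⟩ := hmem v hv b hb (fun e => hab (hac.trans e.symm))
      exact ⟨z, hz, Or.inr hzb⟩
    · obtain ⟨z, hz, hza⟩ := hmem v hv a ha hac
      exact ⟨z, hz, Or.inl hza⟩
  have hbr : ∀ m z, G.Adj m z → (∃ l, IsLeg G m (z :: l)) ∨ ∃ r ∈ R, r ∈ Br S G m z := by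
    intro m z hmz
    rcases h.leg_or_branch hmz with h1 | ⟨v, hv, _, a, b, hab, ha, hb, haB, hbB⟩
    · exact Or.inl h1
    · obtain ⟨r, hr, h2⟩ := hmem2 v (mem_Br.1 hv).1 a b ha hb hab
      exact Or.inr ⟨r, hr, h2.elim (haB r) (hbB r)⟩
  have hbr2 : ∀ m y z, G.Adj m y → G.Adj m z → y ≠ z →
      ∃ r ∈ R, r ∈ Br S G m y ∨ r ∈ Br S G m z := by
    intro m y z hy hz hyz
    rcases hbr m y hy with ⟨k, hk⟩ | ⟨r, hr, h1⟩
    · rcases hbr m z hz with ⟨l, hl⟩ | ⟨r, hr, h1⟩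
      · obtain ⟨r, hr, h1⟩ := hmem2 m (h.mem_left hy) _ _ hk hl (by grind)
        exact ⟨r, hr, h1.imp (hk.subset_Br h hy) (hl.subset_Br h hz)⟩
      · exact ⟨r, hr, Or.inr h1⟩
    · exact ⟨r, hr, Or.inl h1⟩
  have hRS : R ⊆ S := by
    intro r hr
    obtain ⟨v, hv, hr⟩ := Finset.mem_biUnion.1 hr
    obtain ⟨a, ha, rfl⟩ := Finset.mem_image.1 hr
    have ha := (mem_legs.1 (Finset.mem_of_mem_erase ha)).1
    exact ha.mem_of_treeOn h (hlast v a ha.1)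
  have hne : R.Nonempty := by
    obtain ⟨u, _, p, q, _, hpq, _, _, hp, hq, _⟩ := hS
    obtain ⟨r, hr, _⟩ := hbr2 u p q hp hq hpq
    exact ⟨r, hr⟩
  have key : ∀ n, ∀ x ∈ S, ∀ y ∈ S, x ≠ y → G.dist x y = n →
      ¬ ∀ r ∈ R, G.dist x r = G.dist y r := by
    intro n
    induction' n using Nat.strong_induction_on with n ih
    intro x hx y hy hxy hn hall
    obtain ⟨x', hx', hd⟩ := h.exists_closer hx hy hxy
    have hx'S := h.mem_right hx'
    by_cases hxy' : x' = y
    · subst hxy'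
      obtain ⟨r, hr⟩ := hne
      have := h.dist_adj hx' (hRS hr)
      have := hall r hr
      omega
    obtain ⟨y', hy', hd'⟩ := h.exists_closer hy hx'S (Ne.symm hxy')
    have hy'S := h.mem_right hy'
    rw [G.dist_comm (u := y), G.dist_comm (u := y')] at hd'
    have hd2 := h.dist_adj hx' hy'S
    have hd3 := h.dist_adj hy' hx
    rw [G.dist_comm (u := y), G.dist_comm (u := y')] at hd3
    have hxB : ∀ r ∈ R, r ∉ Br S G x' x := by
      intro r hr hB
      have := h.dist_lt_of_mem_Br hx'.symm hB hy (by
        rw [mem_Br, not_and, G.dist_comm (v := y), G.dist_comm (v := y)]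
        intro _
        rw [G.dist_comm (v := x'), G.dist_comm (v := x)]
        omega)
      have := hall r hr
      omega
    have hyB : ∀ r ∈ R, r ∉ Br S G y' y := by
      intro r hr hB
      have := h.dist_lt_of_mem_Br hy'.symm hB hx (by
        rw [mem_Br, not_and, G.dist_comm (v := x), G.dist_comm (v := x)]
        intro _
        omega)
      have := hall r hr
      omega
    by_cases he : x' = y'
    · subst he
      obtain ⟨r, hr, h1 | h1⟩ := hbr2 x' x y hx'.symm hy'.symm hxy
      exacts [hxB r hr h1, hyB r hr h1]
    · refine ih (G.dist x' y') (by omega) x' hx'S y' hy'S he rfl fun r hr => ?_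
      have h1 := hxB r hr
      have h2 := hyB r hr
      rw [mem_Br, not_and] at h1 h2
      have h1 := h1 (hRS hr)
      have h2 := h2 (hRS hr)
      have := hall r hr
      have := h.dist_adj hx' (hRS hr)
      have := h.dist_adj hy' (hRS hr)
      omega
  have hres : Res S G R := by
    intro x hx y hy hxy
    by_contra! hall
    exact key _ x hx y hy hxy rfl fun r hr => (h.edist_eq_iff hx hy (hRS hr)).1 (hall r hr)
  refine (rdim_le hRS hres).trans (Finset.card_biUnion_le.trans (Finset.sum_le_sum fun v _ => ?_))
  refine Finset.card_image_le.trans ?_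
  by_cases h1 : (legs G v v).Nonempty
  · rw [Finset.card_erase_of_mem (hc v h1)]
  · rw [Finset.not_nonempty_iff_eq_empty.1 h1]
    simp

/-- The metric dimension of a tree which is not a path. -/
theorem TreeOn.rdim_eq (h : TreeOn S G) (hS : ∃ u ∈ S, Branch G u) :
    rdim S G = ∑ v ∈ S, ((legs G v v).card - 1) :=
  le_antisymm (h.rdim_le_sum_legs hS) (h.sum_legs_le_rdim hS)

lemma TreeOn.legs_pair (h : TreeOn S G) (hS : ∃ u ∈ S, Branch G u) :
    ((legs G v v).card - 1) * ((legs G w w).card - 1) =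
      ((legs G v w).card - 1) * ((legs G w v).card - 1) := by
  have h1 := Finset.card_le_card (legs_subset_legs_self G v w)
  have h2 := Finset.card_le_card (legs_subset_legs_self G w v)
  by_cases hv : 2 ≤ (legs G v v).card
  · by_cases hw : 2 ≤ (legs G w w).card
    · have e : ∀ v w : V, 2 ≤ (legs G w w).card → legs G v v = legs G v w := by
        intro v w hw
        ext a
        rw [mem_legs, mem_legs]
        constructor
        · exact fun ha => ⟨ha.1, fun hwa => ha.1.not_branch hwa (h.branch_of_card_legs hS hw)⟩
        · exact fun ha => ⟨ha.1, ha.1.base_notMem⟩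
      rw [e v w hw, e w v hv]
    · have h3 : (legs G w w).card - 1 = 0 := by omega
      have h4 : (legs G w v).card - 1 = 0 := by omega
      rw [h3, h4, mul_zero, mul_zero]
  · have h3 : (legs G v v).card - 1 = 0 := by omega
    have h4 : (legs G v w).card - 1 = 0 := by omega
    rw [h3, h4, zero_mul, zero_mul]

/-- A tree without branch vertices is a path. -/
lemma TreeOn.exists_chain (h : TreeOn S G) (hS : 2 ≤ S.card) (hno : ¬ ∃ u ∈ S, Branch G u) :
    ∃ l ∈ nlists S, l.length = S.card ∧ G = chain l := by
  obtain ⟨w, hw, u, hu⟩ := h.exists_leaf hS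
  have hu := isLeg_singleton.1 hu
  have hwu : G.Adj w u := (hu.2 u).2 rfl
  rcases h.leg_or_branch hwu with ⟨l, hl⟩ | ⟨v, hv, hb, _⟩
  · have hcl : ∀ x ∈ S, x ∈ w :: u :: l := by
      refine h.subset_of_closed hw (by simp) ?_
      intro y z hy hyz
      rcases List.mem_cons.1 hy with rfl | hy
      · rw [(hu.2 z).1 hyz]; simp
      · rcases hl.closed hy hyz with h1 | h1
        · simp [h1]
        · simp [h1]
    have hsub : ∀ x ∈ w :: u :: l, x ∈ S := by
      intro x hx
      rcases List.mem_cons.1 hx with rfl | hx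
      · exact hw
      · exact hl.mem_of_treeOn h hx
    refine ⟨w :: u :: l, mem_nlists.2 ⟨hl.2.1, hsub⟩, ?_, ?_⟩
    · rw [← List.toFinset_card_of_nodup hl.2.1]
      congr 1
      ext x
      rw [List.mem_toFinset]
      exact ⟨hsub x, hcl x⟩
    · refine le_antisymm ?_ hl.chain_le
      intro x y hxy
      by_cases hx : x ∈ u :: l
      · exact (hl.2.2 x hx y).1 hxy
      · have hxw : x = w := by
          have := hcl x (h.mem_left hxy)
          grind
        subst hxw
        rw [(hu.2 y).1 hxy]
        exact chain_cons_cons_adj _ _ _ hwu.ne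
  · exact absurd ⟨v, (mem_Br.1 hv).1, hb⟩ hno

lemma card_paths_le (hS : 2 ≤ S.card) :
    ((trees S).filter (fun G => ¬ ∃ u ∈ S, Branch G u)).card ≤ S.card.factorial := by
  have h1 : (trees S).filter (fun G => ¬ ∃ u ∈ S, Branch G u) ⊆
      ((nlists S).filter (fun l => l.length = S.card)).image chain := by
    intro G hG
    rw [Finset.mem_filter, mem_trees] at hG
    obtain ⟨l, hl, h2, h3⟩ := hG.1.exists_chain hS hG.2
    exact Finset.mem_image.2 ⟨l, Finset.mem_filter.2 ⟨hl, h2⟩, h3.symm⟩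
  refine (Finset.card_le_card h1).trans (Finset.card_image_le.trans ?_)
  have h2 := sum_nlists_length S (fun m => if m = 0 then 1 else 0)
  have h3 : ∑ m ∈ Finset.range (S.card + 1), (if m = 0 then (1 : ℝ) else 0) = 1 := by simp
  rw [h3, mul_one] at h2
  have h4 : (((nlists S).filter (fun l => l.length = S.card)).card : ℝ) ≤ S.card.factorial := by
    rw [← h2, Finset.card_filter]
    push_cast
    refine Finset.sum_le_sum fun l _ => ?_
    by_cases hl : l.length = S.card
    · simp [hl]
    · rw [if_neg hl]; positivity
  exact_mod_cast h4

end ResolvingDimension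

section RatioAsymptotics

/-- Ratio of consecutive values of `tau`. -/
def ratio (m : ℕ) : ℝ := tau (m - 1) / tau m

lemma tau_pos {n : ℕ} (hn : n ≠ 0) : 0 < tau n := by
  have : (0 : ℝ) < n := by exact_mod_cast Nat.pos_of_ne_zero hn
  unfold tau
  positivity

lemma tau_nonneg (n : ℕ) : 0 ≤ tau n := by
  unfold tau
  positivity

lemma ratio_add_two (m : ℕ) : ratio (m + 2) = (1 - 1 / ((m : ℝ) + 2)) ^ m := by
  have h1 : ((m : ℝ) + 1) ≠ 0 := by positivity
  have h2 : ((m : ℝ) + 2) ≠ 0 := by positivity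
  have h3 : (1 - 1 / ((m : ℝ) + 2)) = (m + 1) / (m + 2) := by
    field_simp
    ring
  rw [h3, div_pow, ratio, tau, tau, show m + 2 - 1 = m + 1 by omega, Nat.factorial_succ (m + 1)]
  have h4 : ((m + 1).factorial : ℝ) ≠ 0 := by positivity
  push_cast
  rw [show (m : ℝ) + 1 + 1 = m + 2 by ring, pow_succ, pow_succ, pow_succ]
  field_simp

lemma ratio_nonneg (m : ℕ) : 0 ≤ ratio m := div_nonneg (tau_nonneg _) (tau_nonneg _)

lemma ratio_le (m : ℕ) (hm : 3 ≤ m) : ratio m ≤ 2 / 3 := by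
  obtain ⟨k, rfl⟩ : ∃ k, m = k + 3 := ⟨m - 3, by omega⟩
  have h := ratio_add_two (k + 1)
  rw [show k + 1 + 2 = k + 3 by ring] at h
  have h1 : (1 - 1 / (((k + 1 : ℕ) : ℝ) + 2)) = (1 + 1 / ((k : ℝ) + 2))⁻¹ := by
    push_cast
    have : (k : ℝ) + 2 ≠ 0 := by positivity
    have : (k : ℝ) + 3 ≠ 0 := by positivity
    rw [show (k : ℝ) + 1 + 2 = k + 3 by ring, show 1 + 1 / ((k : ℝ) + 2) = (k + 3) / (k + 2) by
      field_simp; ring]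
    field_simp
    ring
  rw [h, h1, inv_pow]
  have h2 : (3 : ℝ) / 2 ≤ (1 + 1 / ((k : ℝ) + 2)) ^ (k + 1) := by
    have h3 := one_add_mul_le_pow (a := 1 / ((k : ℝ) + 2))
      (by have : (0 : ℝ) ≤ 1 / ((k : ℝ) + 2) := by positivity
          linarith) (k + 1)
    refine le_trans ?_ h3
    push_cast
    have : (0 : ℝ) < (k : ℝ) + 2 := by positivity
    rw [mul_one_div, ← sub_nonneg]
    have h4 : 1 + ((k : ℝ) + 1) / (k + 2) - 3 / 2 = k / (2 * (k + 2)) := by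
      field_simp
      ring
    rw [h4]
    positivity
  rw [show (2 : ℝ) / 3 = (3 / 2)⁻¹ by norm_num]
  exact inv_anti₀ (by norm_num) h2

lemma ratio_le_one (m : ℕ) : ratio m ≤ 1 := by
  rcases Nat.lt_or_ge m 3 with h | h
  · interval_cases m
    · simp [ratio, tau_zero]
    · simp [ratio, tau_zero]
    · have := ratio_add_two 0
      simp only [zero_add, pow_zero] at this
      exact this.le
  · exact (ratio_le m h).trans (by norm_num)

lemma ratio_le_one_eq_zero {m : ℕ} (hm : m ≤ 1) : ratio m = 0 := by
  interval_cases m <;> simp [ratio, tau_zero]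

/-- `x k n` is the ratio `tau (n - k) / tau n`. -/
def xr (k n : ℕ) : ℝ := tau (n - k) / tau n

lemma xr_nonneg (k n : ℕ) : 0 ≤ xr k n := div_nonneg (tau_nonneg _) (tau_nonneg _)

lemma xr_eq_zero {k n : ℕ} (h : n ≤ k) : xr k n = 0 := by
  rw [xr, Nat.sub_eq_zero_of_le h, tau_zero, zero_div]

lemma xr_succ (k n : ℕ) : xr (k + 1) n = xr k n * ratio (n - k) := by
  rcases Nat.lt_or_ge k n with h | h
  · have := (tau_pos (show n - k ≠ 0 by omega)).ne'
    rw [xr, xr, ratio, show n - (k + 1) = n - k - 1 by omega]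
    field_simp
  · rw [xr_eq_zero h, xr_eq_zero (by omega), zero_mul]

lemma xr_zero {n : ℕ} (hn : n ≠ 0) : xr 0 n = 1 := div_self (tau_pos hn).ne'

lemma xr_le (k n : ℕ) : xr k n ≤ 3 / 2 * (2 / 3) ^ k := by
  have h : xr k n ≤ (2 / 3) ^ k * (if n ≤ k + 1 then 3 / 2 else 1) := by
    induction k with
    | zero =>
      rcases Nat.eq_zero_or_pos n with rfl | hn
      · rw [xr_eq_zero le_rfl]
        norm_num
      · rw [xr_zero hn.ne']
        split_ifs <;> norm_num
    | succ k ih =>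
      rw [xr_succ]
      rcases Nat.lt_or_ge (n - k) 2 with h | h
      · rw [ratio_le_one_eq_zero (by omega), mul_zero]
        split_ifs <;> positivity
      rw [if_neg (by omega), mul_one] at ih
      rcases Nat.lt_or_ge (n - k) 3 with h' | h'
      · rw [if_pos (by omega)]
        calc xr k n * ratio (n - k) ≤ (2 / 3) ^ k * 1 :=
              mul_le_mul ih (ratio_le_one _) (ratio_nonneg _) (by positivity)
          _ = _ := by rw [pow_succ]; ring
      · rw [if_neg (by omega)]
        calc xr k n * ratio (n - k) ≤ (2 / 3) ^ k * (2 / 3) :=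
              mul_le_mul ih (ratio_le _ h') (ratio_nonneg _) (by positivity)
          _ = _ := by rw [pow_succ]; ring
  refine h.trans ?_
  rw [mul_comm]
  refine mul_le_mul_of_nonneg_right ?_ (by positivity)
  split_ifs <;> norm_num

lemma tendsto_log_ratio :
    Tendsto (fun m : ℕ => ((m : ℝ) + 2) * (m * Real.log (1 - 1 / ((m : ℝ) + 2)) + 1)) atTop
      (𝓝 (3 / 2)) := by
  have hx : Tendsto (fun m : ℕ => 1 / ((m : ℝ) + 2)) atTop (𝓝 0) := by
    have := (tendsto_const_div_atTop_nhds_zero_nat (1 : ℝ)).comp (tendsto_add_atTop_nat 2)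
    refine this.congr fun m => ?_
    simp
  have hδ : Tendsto (fun m : ℕ => (1 - 2 * (1 / ((m : ℝ) + 2))) * (((m : ℝ) + 2) ^ 2 *
      (1 / ((m : ℝ) + 2) + (1 / ((m : ℝ) + 2)) ^ 2 / 2 + Real.log (1 - 1 / ((m : ℝ) + 2)))))
      atTop (𝓝 0) := by
    have h1 : Tendsto (fun m : ℕ => ((m : ℝ) + 2) ^ 2 *
      (1 / ((m : ℝ) + 2) + (1 / ((m : ℝ) + 2)) ^ 2 / 2 + Real.log (1 - 1 / ((m : ℝ) + 2))))
      atTop (𝓝 0) := by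
      have hx2 := hx.const_mul 2
      rw [mul_zero] at hx2
      refine squeeze_zero_norm (fun m => ?_) hx2
      have hp : (0 : ℝ) < (m : ℝ) + 2 := by positivity
      set x := 1 / ((m : ℝ) + 2) with hxd
      have hx0 : 0 < x := by positivity
      have hx1 : x ≤ 1 / 2 := by
        rw [hxd]
        exact one_div_le_one_div_of_le (by norm_num)
          (by linarith [(Nat.cast_nonneg m : (0 : ℝ) ≤ m)])
      have h2 := Real.abs_log_sub_add_sum_range_le (x := x) (by rw [abs_of_pos hx0]; linarith) 2
      rw [abs_of_pos hx0] at h2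
      simp only [Finset.sum_range_succ, Finset.sum_range_zero] at h2
      norm_num at h2
      have h3 : (m : ℝ) + 2 = 1 / x := by rw [hxd]; field_simp
      rw [Real.norm_eq_abs, abs_mul, h3, abs_of_pos (by positivity)]
      have h4 : x ^ 3 / (1 - x) ≤ 2 * x ^ 3 := by
        rw [div_le_iff₀ (by linarith)]
        nlinarith [pow_pos hx0 3]
      calc (1 / x) ^ 2 * |x + x ^ 2 / 2 + Real.log (1 - x)| ≤ (1 / x) ^ 2 * (2 * x ^ 3) := by
            gcongr
            exact h2.trans h4
        _ = 2 * x := by field_simp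
    have h2 := ((tendsto_const_nhds (x := (1 : ℝ))).sub (hx.const_mul 2)).mul h1
    simpa using h2
  have h := ((tendsto_const_nhds (x := (3 / 2 : ℝ))).add hx).add hδ
  rw [add_zero, add_zero] at h
  refine h.congr fun m => ?_
  have hp : ((m : ℝ) + 2) ≠ 0 := by positivity
  field_simp
  ring

lemma tendsto_ratio_aux :
    Tendsto (fun m : ℕ => ((m : ℝ) + 2) * (ratio (m + 2) - Real.exp (-1))) atTop
      (𝓝 (3 / 2 * Real.exp (-1))) := by
  set d : ℕ → ℝ := fun m => m * Real.log (1 - 1 / ((m : ℝ) + 2)) + 1 with hd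
  have hrd : ∀ m, ratio (m + 2) = Real.exp (-1) * Real.exp (d m) := by
    intro m
    have hp : (0 : ℝ) < 1 - 1 / ((m : ℝ) + 2) := by
      rw [sub_pos, div_lt_one (by positivity)]
      linarith [(Nat.cast_nonneg m : (0 : ℝ) ≤ m)]
    rw [← Real.exp_add, hd]
    simp only
    rw [show -1 + ((m : ℝ) * Real.log (1 - 1 / ((m : ℝ) + 2)) + 1) =
      Real.log (1 - 1 / ((m : ℝ) + 2)) * m by ring, Real.exp_mul, Real.exp_log hp,
      Real.rpow_natCast, ratio_add_two]
  have h1 := tendsto_log_ratio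
  have hx : Tendsto (fun m : ℕ => 1 / ((m : ℝ) + 2)) atTop (𝓝 0) := by
    have := (tendsto_const_div_atTop_nhds_zero_nat (1 : ℝ)).comp (tendsto_add_atTop_nat 2)
    refine this.congr fun m => ?_
    simp
  have hd0 : Tendsto d atTop (𝓝 0) := by
    have := hx.mul h1
    rw [zero_mul] at this
    refine this.congr fun m => ?_
    have hp : ((m : ℝ) + 2) ≠ 0 := by positivity
    rw [hd]
    field_simp
  have hslope : Tendsto (fun m => dslope Real.exp 0 (d m)) atTop (𝓝 1) := by
    have hc : ContinuousAt (dslope Real.exp 0) 0 :=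
      continuousAt_dslope_same.2 Real.differentiableAt_exp
    have := hc.tendsto.comp hd0
    simpa [Real.deriv_exp, Function.comp_def] using this
  have h2 := (h1.mul hslope).mul_const (Real.exp (-1))
  rw [mul_one] at h2
  refine h2.congr fun m => ?_
  have h3 := sub_smul_dslope Real.exp 0 (d m)
  rw [Real.exp_zero, sub_zero, smul_eq_mul] at h3
  rw [hrd, mul_assoc ((m : ℝ) + 2), show (m : ℝ) * Real.log (1 - 1 / ((m : ℝ) + 2)) + 1 = d m from rfl,
    h3]
  ring

lemma tendsto_ratio : Tendsto (fun m : ℕ => (m : ℝ) * (ratio m - Real.exp (-1))) atTop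
    (𝓝 (3 / 2 * Real.exp (-1))) := by
  refine (tendsto_add_atTop_iff_nat 2).1 (tendsto_ratio_aux.congr fun m => ?_)
  push_cast
  rfl

lemma exists_ratio_bound : ∃ C : ℝ, 0 ≤ C ∧
    ∀ m : ℕ, |(m : ℝ) * (ratio m - Real.exp (-1))| ≤ C := by
  obtain ⟨C, hC⟩ := (Metric.isBounded_range_of_tendsto _ tendsto_ratio).exists_norm_le
  exact ⟨C, (norm_nonneg _).trans (hC _ ⟨0, rfl⟩), fun m => hC _ ⟨m, rfl⟩⟩

lemma exp_neg_one_le : Real.exp (-1) ≤ 2 / 3 := by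
  rw [Real.exp_neg, show (2 : ℝ) / 3 = (3 / 2)⁻¹ by norm_num]
  exact inv_anti₀ (by norm_num) (by linarith [Real.exp_one_gt_d9])

lemma tendsto_mul_xr_sub (k : ℕ) :
    Tendsto (fun n : ℕ => (n : ℝ) * (xr k n - Real.exp (-1) ^ k)) atTop
      (𝓝 (3 / 2 * (k * Real.exp (-1) ^ k))) ∧
    Tendsto (fun n : ℕ => xr k n) atTop (𝓝 (Real.exp (-1) ^ k)) := by
  have hlim : ∀ (f : ℕ → ℝ) (c d : ℝ), Tendsto (fun n : ℕ => (n : ℝ) * (f n - c)) atTop (𝓝 d) →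
      Tendsto f atTop (𝓝 c) := by
    intro f c d h
    have h1 := ((tendsto_one_div_atTop_nhds_zero_nat (𝕜 := ℝ)).mul h).add_const c
    rw [zero_mul, zero_add] at h1
    refine h1.congr' ?_
    filter_upwards [eventually_ne_atTop 0] with n hn
    have : (n : ℝ) ≠ 0 := by exact_mod_cast hn
    field_simp
    ring
  refine and_iff_left_of_imp (hlim _ _ _) |>.2 ?_
  induction k with
  | zero =>
    refine tendsto_const_nhds.congr' ?_
    filter_upwards [eventually_ne_atTop 0] with n hn
    rw [xr_zero hn]
    simp
  | succ k ih =>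
    have hx := hlim _ _ _ ih
    have h1 : Tendsto (fun n : ℕ => (n : ℝ) * (ratio (n - k) - Real.exp (-1))) atTop
        (𝓝 (3 / 2 * Real.exp (-1))) := by
      refine (tendsto_add_atTop_iff_nat k).1 ?_
      have h2 := tendsto_ratio.add ((hlim _ _ _ tendsto_ratio).sub_const (Real.exp (-1)) |>.const_mul
        (k : ℝ))
      rw [sub_self, mul_zero, add_zero] at h2
      refine h2.congr fun m => ?_
      rw [Nat.add_sub_cancel]
      push_cast
      ring
    have h2 := (hx.mul h1).add (ih.mul_const (Real.exp (-1)))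
    have e : Real.exp (-1) ^ k * (3 / 2 * Real.exp (-1)) +
        3 / 2 * (k * Real.exp (-1) ^ k) * Real.exp (-1) =
        3 / 2 * (((k + 1 : ℕ) : ℝ) * Real.exp (-1) ^ (k + 1)) := by
      push_cast
      ring
    rw [e] at h2
    refine h2.congr fun n => ?_
    rw [xr_succ]
    ring

lemma exists_xr_bound : ∃ C : ℝ, 0 ≤ C ∧
    ∀ k n : ℕ, |(n : ℝ) * (xr k n - Real.exp (-1) ^ k)| ≤ C * ((k : ℝ) ^ 2 * (2 / 3) ^ k) := by
  obtain ⟨C, hC0, hC⟩ := exists_ratio_bound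
  refine ⟨9 / 4 * C, by positivity, fun k n => ?_⟩
  induction k with
  | zero =>
    rcases Nat.eq_zero_or_pos n with rfl | hn
    · simp
    · rw [xr_zero hn.ne']
      simp
  | succ k ih =>
    have e : (n : ℝ) * (xr (k + 1) n - Real.exp (-1) ^ (k + 1)) =
        xr k n * (n * (ratio (n - k) - Real.exp (-1))) +
        Real.exp (-1) * (n * (xr k n - Real.exp (-1) ^ k)) := by
      rw [xr_succ]
      ring
    have h1 : |xr k n * (n * (ratio (n - k) - Real.exp (-1)))| ≤
        (3 / 2 * (2 / 3) ^ k) * ((k + 1) * C) := by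
      rcases Nat.lt_or_ge k n with h | h
      · rw [abs_mul, abs_of_nonneg (xr_nonneg _ _)]
        refine mul_le_mul (xr_le k n) ?_ (abs_nonneg _) (by positivity)
        refine le_trans ?_ (mul_le_mul_of_nonneg_left (hC (n - k)) (by positivity))
        rw [abs_mul, abs_mul, ← mul_assoc, Nat.abs_cast, Nat.abs_cast]
        refine mul_le_mul_of_nonneg_right ?_ (abs_nonneg _)
        have : n ≤ (k + 1) * (n - k) := by
          obtain ⟨m, rfl⟩ : ∃ m, n = k + 1 + m := ⟨n - (k + 1), by omega⟩
          rw [show k + 1 + m - k = m + 1 by omega]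
          nlinarith
        exact_mod_cast this
      · rw [xr_eq_zero h, zero_mul, abs_zero]
        positivity
    rw [e]
    refine (abs_add_le _ _).trans ?_
    rw [abs_mul (Real.exp (-1)), abs_of_pos (Real.exp_pos _)]
    have h2 : Real.exp (-1) * |(n : ℝ) * (xr k n - Real.exp (-1) ^ k)| ≤
        2 / 3 * (9 / 4 * C * ((k : ℝ) ^ 2 * (2 / 3) ^ k)) :=
      mul_le_mul exp_neg_one_le ih (abs_nonneg _) (by norm_num)
    refine (add_le_add h1 h2).trans ?_
    rw [pow_succ (2 / 3 : ℝ)]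
    push_cast
    have h3 : 0 ≤ C * (2 / 3 : ℝ) ^ k * k := by positivity
    nlinarith

end RatioAsymptotics

section Weights

/-- The number of compositions of `k` into `j` positive parts. -/
def comps : ℕ → ℕ → ℕ
  | 0, 0 => 1
  | 0, _ + 1 => 0
  | _ + 1, 0 => 0
  | j + 1, k + 1 => comps (j + 1) k + comps j k

lemma comps_succ_succ (j k : ℕ) : comps (j + 1) (k + 1) = k.choose j := by
  induction k generalizing j with
  | zero => cases j <;> simp [comps]
  | succ k ih =>
    cases j with
    | zero => rw [comps, ih]; simp [comps]
    | succ j => rw [comps, ih, ih, Nat.choose_succ_succ, add_comm]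

lemma comps_eq_zero {j k : ℕ} (h : k < j) : comps j k = 0 := by
  obtain ⟨j, rfl⟩ : ∃ i, j = i + 1 := ⟨j - 1, by omega⟩
  cases k with
  | zero => rfl
  | succ k => rw [comps_succ_succ, Nat.choose_eq_zero_of_lt (by omega)]

lemma mul_comps (j k : ℕ) : k * comps j k = j * comps (j + 1) (k + 1) := by
  cases k with
  | zero => cases j <;> simp [comps]
  | succ k =>
    cases j with
    | zero => simp [comps]
    | succ j => rw [comps_succ_succ, comps_succ_succ, Nat.add_one_mul_choose_eq, mul_comm]

lemma psum_eq_sum_comps (f : ℕ → ℝ) (j n : ℕ) :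
    psum f j n = ∑ k ∈ Finset.range (n + 1), comps j k * f (n - k) := by
  induction n generalizing j with
  | zero => cases j <;> simp [psum, comps]
  | succ n ih =>
    cases j with
    | zero => rw [Finset.sum_range_succ']; simp [psum, comps]
    | succ j =>
      have h1 : psum f (j + 1) (n + 1) = psum f (j + 1) n + psum f j n := by
        simp only [psum, Finset.sum_range_succ]
      rw [h1, ih, ih, Finset.sum_range_succ' _ (n + 1), ← Finset.sum_add_distrib]
      simp only [comps, Nat.cast_zero, zero_mul, add_zero]
      refine Finset.sum_congr rfl fun k _ => ?_
      rw [show n + 1 - (k + 1) = n - k by omega]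
      push_cast
      ring

lemma hasSum_comps {y : ℝ} (hy0 : 0 ≤ y) (hy : y < 1) (j : ℕ) :
    HasSum (fun k => comps j k * y ^ k) ((y / (1 - y)) ^ j) := by
  have h0 : 1 - y ≠ 0 := by linarith
  cases j with
  | zero =>
    rw [pow_zero]
    have := hasSum_ite_eq (0 : ℕ) (1 : ℝ)
    convert! this using 2 with k
    cases k <;> simp [comps]
  | succ j =>
    rw [← hasSum_nat_add_iff' (j + 1)]
    have h1 : ∑ i ∈ Finset.range (j + 1), (comps (j + 1) i : ℝ) * y ^ i = 0 :=
      Finset.sum_eq_zero fun i hi => by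
        rw [comps_eq_zero (Finset.mem_range.1 hi), Nat.cast_zero, zero_mul]
    rw [h1, sub_zero]
    have h2 := (hasSum_choose_mul_geometric_of_norm_lt_one j
      (by rwa [Real.norm_eq_abs, abs_of_nonneg hy0] : ‖y‖ < 1)).mul_left (y ^ (j + 1))
    convert! h2 using 2 with k
    · rw [← add_assoc, comps_succ_succ, pow_succ, pow_add, pow_succ]
      ring
    · rw [div_pow]
      ring

lemma hasSum_mul_comps {y : ℝ} (hy0 : 0 ≤ y) (hy : y < 1) (j : ℕ) :
    HasSum (fun k => k * (comps j k * y ^ k)) (j * (y / (1 - y)) ^ j / (1 - y)) := by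
  rcases hy0.eq_or_lt with rfl | hpos
  · have h1 : ∀ k : ℕ, (k : ℝ) * (comps j k * 0 ^ k) = 0 := by
      intro k; cases k <;> simp
    have h2 : (j : ℝ) * (0 / (1 - 0)) ^ j / (1 - 0) = 0 := by cases j <;> simp
    simp_rw [h1, h2]
    exact hasSum_zero
  have h0 : 1 - y ≠ 0 := by linarith
  have h1 := hasSum_comps hy0 hy (j + 1)
  rw [← hasSum_nat_add_iff' 1] at h1
  simp only [Finset.sum_range_one, comps, Nat.cast_zero, zero_mul, sub_zero] at h1
  have h2 := h1.mul_left ((j : ℝ) / y)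
  have e : (j : ℝ) / y * (y / (1 - y)) ^ (j + 1) = j * (y / (1 - y)) ^ j / (1 - y) := by
    rw [pow_succ]
    field_simp
  rw [e] at h2
  convert! h2 using 2 with k
  · have h3 := mul_comps j k
    have h3' : (k : ℝ) * comps j k = j * comps (j + 1) (k + 1) := by exact_mod_cast h3
    rw [← mul_assoc, h3', comps, pow_succ]
    field_simp

/-- Coefficient sequences of entire functions. -/
def EntireCoeff (c : ℕ → ℝ) : Prop := ∀ r : ℝ, Summable fun j => c j * r ^ j

/-- The weights of the shifts of a sequence in a combination of iterated partial sums. -/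
def weight (c : ℕ → ℝ) (k : ℕ) : ℝ := ∑ j ∈ Finset.range (k + 1), c j * comps j k

lemma hasSum_swap {c : ℕ → ℝ} {q : ℕ → ℕ → ℝ} {Q : ℕ → ℝ} (hq : ∀ j k, 0 ≤ q j k)
    (hq0 : ∀ j k, k < j → q j k = 0) (hQ : ∀ j, HasSum (q j) (Q j))
    (hc : Summable fun j => c j * Q j) :
    HasSum (fun k => ∑ j ∈ Finset.range (k + 1), c j * q j k) (∑' j, c j * Q j) := by
  have hQ0 : ∀ j, 0 ≤ Q j := fun j => (hQ j).nonneg (hq j)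
  have hs : Summable fun p : ℕ × ℕ => c p.1 * q p.1 p.2 := by
    rw [← summable_abs_iff, summable_prod_of_nonneg (fun _ => abs_nonneg _)]
    have h1 : ∀ j, HasSum (fun k => |c j * q j k|) (|c j * Q j|) := by
      intro j
      simp_rw [abs_mul, abs_of_nonneg (hq j _), abs_of_nonneg (hQ0 j)]
      exact (hQ j).mul_left _
    refine ⟨fun j => (h1 j).summable, ?_⟩
    simp_rw [(h1 _).tsum_eq]
    exact hc.abs
  have h1 : HasSum (fun p : ℕ × ℕ => c p.1 * q p.1 p.2) (∑' j, c j * Q j) := by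
    have h2 := hs.hasSum.prod_fiberwise fun j => (hQ j).mul_left (c j)
    rw [h2.tsum_eq]
    exact hs.hasSum
  have h3 : HasSum (fun p : ℕ × ℕ => c p.2 * q p.2 p.1) (∑' j, c j * Q j) :=
    (Equiv.prodComm ℕ ℕ).hasSum_iff.2 h1
  refine h3.prod_fiberwise fun k => ?_
  refine hasSum_sum_of_ne_finset_zero fun j hj => ?_
  rw [hq0 j k (by simpa using hj), mul_zero]

lemma EntireCoeff.mul_nat {c : ℕ → ℝ} (hc : EntireCoeff c) : EntireCoeff fun j => j * c j := by
  intro r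
  refine Summable.of_norm_bounded (hc (2 * r)).abs fun j => ?_
  have h1 : (j : ℝ) ≤ 2 ^ j := by exact_mod_cast Nat.lt_two_pow_self.le
  rw [Real.norm_eq_abs, mul_pow, abs_mul, abs_mul, abs_mul, abs_mul, Nat.abs_cast,
    abs_of_nonneg (by positivity : (0 : ℝ) ≤ 2 ^ j)]
  have h2 : 0 ≤ |c j| * |r ^ j| := by positivity
  nlinarith

lemma hasSum_weight {c : ℕ → ℝ} (hc : EntireCoeff c) {y : ℝ} (hy0 : 0 ≤ y) (hy : y < 1) :
    HasSum (fun k => weight c k * y ^ k) (∑' j, c j * (y / (1 - y)) ^ j) := by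
  have h := hasSum_swap (c := c) (q := fun j k => comps j k * y ^ k) (fun j k => by positivity)
    (fun j k h => by simp [comps_eq_zero h]) (hasSum_comps hy0 hy) (hc _)
  convert! h using 2 with k
  rw [weight, Finset.sum_mul]
  exact Finset.sum_congr rfl fun j _ => by ring

lemma hasSum_mul_weight {c : ℕ → ℝ} (hc : EntireCoeff c) {y : ℝ} (hy0 : 0 ≤ y) (hy : y < 1) :
    HasSum (fun k => k * weight c k * y ^ k) ((∑' j, j * c j * (y / (1 - y)) ^ j) / (1 - y)) := by
  have e : ∀ j : ℕ, c j * (j * (y / (1 - y)) ^ j / (1 - y)) =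
      j * c j * (y / (1 - y)) ^ j / (1 - y) := fun j => by ring
  have h := hasSum_swap (c := c) (q := fun j k => k * (comps j k * y ^ k)) (fun j k => by positivity)
    (fun j k h => by simp [comps_eq_zero h]) (hasSum_mul_comps hy0 hy)
    (by simp_rw [e]; exact (hc.mul_nat _).div_const _)
  simp_rw [e] at h
  rw [tsum_div_const] at h
  convert! h using 2 with k
  rw [weight, Finset.mul_sum, Finset.sum_mul]
  exact Finset.sum_congr rfl fun j _ => by ring

lemma sum_psum_eq {f : ℕ → ℝ} (hf : f 0 = 0) (c : ℕ → ℝ) (n : ℕ) :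
    ∑ j ∈ Finset.range n, c j * psum f j n = ∑ k ∈ Finset.range n, weight c k * f (n - k) := by
  have h1 : ∀ j ∈ Finset.range n, c j * psum f j n =
      ∑ k ∈ Finset.range n, c j * comps j k * f (n - k) := by
    intro j _
    rw [psum_eq_sum_comps, Finset.sum_range_succ, Nat.sub_self, hf, mul_zero, add_zero,
      Finset.mul_sum]
    exact Finset.sum_congr rfl fun k _ => by ring
  rw [Finset.sum_congr rfl h1, Finset.sum_comm]
  refine Finset.sum_congr rfl fun k hk => ?_
  rw [weight, Finset.sum_mul]
  symm
  refine Finset.sum_subset (Finset.range_subset_range.2 (Finset.mem_range.1 hk)) fun j _ hj => ?_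
  rw [comps_eq_zero (by simpa using hj), Nat.cast_zero, mul_zero, zero_mul]

/-- The square of a power series. -/
def sqCoeff (c : ℕ → ℝ) (n : ℕ) : ℝ := ∑ i ∈ Finset.range (n + 1), c i * c (n - i)

lemma hasSum_sqCoeff {c : ℕ → ℝ} (hc : EntireCoeff c) (r : ℝ) :
    HasSum (fun n => sqCoeff c n * r ^ n) ((∑' j, c j * r ^ j) ^ 2) := by
  have h := hasSum_sum_range_mul_of_summable_norm (hc r).norm (hc r).norm
  rw [pow_two]
  convert! h using 2 with n
  rw [sqCoeff, Finset.sum_mul]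
  refine Finset.sum_congr rfl fun i hi => ?_
  have : r ^ n = r ^ i * r ^ (n - i) := by
    rw [← pow_add, Nat.add_sub_cancel' (by simpa using Finset.mem_range_succ_iff.1 hi)]
  rw [this]
  ring

lemma hasSum_mul_sqCoeff {c : ℕ → ℝ} (hc : EntireCoeff c) (r : ℝ) :
    HasSum (fun n => n * sqCoeff c n * r ^ n)
      (2 * (∑' j, c j * r ^ j) * ∑' j, j * c j * r ^ j) := by
  have h1 := hasSum_sum_range_mul_of_summable_norm (hc r).norm (hc.mul_nat r).norm
  have h2 := hasSum_sum_range_mul_of_summable_norm (hc.mul_nat r).norm (hc r).norm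
  have h := h1.add h2
  beta_reduce at h
  rw [mul_comm (∑' n, n * c n * r ^ n), ← two_mul, ← mul_assoc] at h
  convert! h using 2 with n
  · rw [sqCoeff, Finset.mul_sum, Finset.sum_mul, ← Finset.sum_add_distrib]
    refine Finset.sum_congr rfl fun i hi => ?_
    have hi := Finset.mem_range_succ_iff.1 hi
    have : r ^ n = r ^ i * r ^ (n - i) := by
      rw [← pow_add, Nat.add_sub_cancel' hi]
    rw [this, Nat.cast_sub hi]
    ring

lemma EntireCoeff.sqCoeff {c : ℕ → ℝ} (hc : EntireCoeff c) : EntireCoeff (sqCoeff c) :=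
  fun r => (hasSum_sqCoeff hc r).summable

lemma sum_psum_pair_eq {f : ℕ → ℝ} (hf : f 0 = 0) (c : ℕ → ℝ) (n : ℕ) :
    ∑ i ∈ Finset.range n, ∑ j ∈ Finset.range n, c i * c j * psum f (i + j) n =
      ∑ m ∈ Finset.range n, sqCoeff c m * psum f m n := by
  have hz : ∀ m, n ≤ m → psum f m n = 0 := fun m hm =>
    psum_eq_zero (c := 1) (fun k hk => by rwa [show k = 0 by omega]) m (by omega)
  have h1 : ∀ i ∈ Finset.range n, ∑ j ∈ Finset.range n, c i * c j * psum f (i + j) n =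
      ∑ m ∈ Finset.range n, if i ≤ m then c i * c (m - i) * psum f m n else 0 := by
    intro i hi
    have hi := Finset.mem_range.1 hi
    rw [← Finset.sum_filter]
    have e : ∑ j ∈ Finset.range n, c i * c j * psum f (i + j) n =
        ∑ j ∈ Finset.range (n - i), c i * c j * psum f (i + j) n := by
      symm
      refine Finset.sum_subset (Finset.range_subset_range.2 (Nat.sub_le n i)) fun j _ hj => ?_
      rw [hz _ (by have := Finset.mem_range.not.1 hj; omega), mul_zero]
    rw [e]
    refine Finset.sum_bij' (fun j _ => i + j) (fun m _ => m - i) ?_ ?_ ?_ ?_ ?_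
    all_goals simp only [Finset.mem_filter, Finset.mem_range]
    · intro j hj; omega
    · intro j hj; omega
    · intro j hj; omega
    · intro j hj; omega
    · intro j hj; rw [Nat.add_sub_cancel_left]
  rw [Finset.sum_congr rfl h1, Finset.sum_comm]
  refine Finset.sum_congr rfl fun m hm => ?_
  rw [MetricDimPaper.sqCoeff, Finset.sum_mul, ← Finset.sum_filter]
  refine Finset.sum_congr ?_ fun _ _ => rfl
  ext i
  simp only [Finset.mem_filter, Finset.mem_range] at hm ⊢
  omega

/-- Weighted sums of the ratios `tau (n - k) / tau n`. -/
def wsum (w : ℕ → ℝ) (n : ℕ) : ℝ := ∑ k ∈ Finset.range n, w k * xr k n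

lemma wsum_eq_tsum (w : ℕ → ℝ) (n : ℕ) : wsum w n = ∑' k, w k * xr k n := by
  rw [wsum, tsum_eq_sum fun k hk => ?_]
  rw [xr_eq_zero (by simpa using hk), mul_zero]

/-- Weights whose generating function converges in the unit disc. -/
def Subexp (w : ℕ → ℝ) : Prop := ∀ r : ℝ, 0 ≤ r → r < 1 → Summable fun k => w k * r ^ k

lemma EntireCoeff.subexp_weight {c : ℕ → ℝ} (hc : EntireCoeff c) : Subexp (weight c) :=
  fun _ h0 h1 => (hasSum_weight hc h0 h1).summable

lemma EntireCoeff.subexp_mul_weight {c : ℕ → ℝ} (hc : EntireCoeff c) :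
    Subexp fun k => k * weight c k :=
  fun _ h0 h1 => (hasSum_mul_weight hc h0 h1).summable

lemma Subexp.summable_bound {w : ℕ → ℝ} (hw : Subexp w) :
    Summable fun k : ℕ => |w k| * ((k : ℝ) ^ 2 * (2 / 3) ^ k) := by
  have h1 := tendsto_pow_const_mul_const_pow_of_abs_lt_one 2
    (r := (4 / 5 : ℝ)) (by rw [abs_of_pos] <;> norm_num)
  obtain ⟨C, hC⟩ := (Metric.isBounded_range_of_tendsto _ h1).exists_norm_le
  refine Summable.of_norm_bounded ((hw (5 / 6) (by norm_num) (by norm_num)).abs.mul_left C)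
    fun k => ?_
  have h2 := hC _ ⟨k, rfl⟩
  rw [Real.norm_eq_abs, abs_of_nonneg (by positivity)] at h2 ⊢
  rw [show (2 / 3 : ℝ) = 4 / 5 * (5 / 6) by norm_num, mul_pow, abs_mul,
    abs_of_nonneg (by positivity : (0 : ℝ) ≤ (5 / 6) ^ k)]
  have h3 : 0 ≤ |w k| * (5 / 6 : ℝ) ^ k := by positivity
  nlinarith

lemma Subexp.tendsto_wsum {w : ℕ → ℝ} (hw : Subexp w) :
    Tendsto (wsum w) atTop (𝓝 (∑' k, w k * Real.exp (-1) ^ k)) := by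
  simp_rw [funext (wsum_eq_tsum w)]
  refine tendsto_tsum_of_dominated_convergence
    (bound := fun k => 3 / 2 * |w k * (2 / 3) ^ k|)
    ((hw (2 / 3) (by norm_num) (by norm_num)).abs.mul_left _) ?_ ?_
  · intro k
    exact (tendsto_mul_xr_sub k).2.const_mul _
  · refine Eventually.of_forall fun n k => ?_
    rw [Real.norm_eq_abs, abs_mul, abs_mul, abs_of_nonneg (xr_nonneg k n),
      abs_of_nonneg (by positivity : (0 : ℝ) ≤ (2 / 3) ^ k)]
    have := mul_le_mul_of_nonneg_left (xr_le k n) (abs_nonneg (w k))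
    linarith

lemma Subexp.tendsto_mul_wsum_sub {w : ℕ → ℝ} (hw : Subexp w) :
    Tendsto (fun n : ℕ => (n : ℝ) * (wsum w n - ∑' k, w k * Real.exp (-1) ^ k)) atTop
      (𝓝 (3 / 2 * ∑' k, k * w k * Real.exp (-1) ^ k)) := by
  have hs := hw _ (Real.exp_pos (-1)).le (exp_neg_one_le.trans_lt (by norm_num))
  have e : ∀ n : ℕ, (n : ℝ) * (wsum w n - ∑' k, w k * Real.exp (-1) ^ k) =
      ∑' k, w k * (n * (xr k n - Real.exp (-1) ^ k)) := by
    intro n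
    have hx : Summable fun k => w k * xr k n :=
      summable_of_ne_finset_zero (s := Finset.range n) fun k hk => by
        rw [xr_eq_zero (by simpa using hk), mul_zero]
    rw [wsum_eq_tsum, ← hx.tsum_sub hs, ← tsum_mul_left]
    exact tsum_congr fun k => by ring
  have e2 : 3 / 2 * ∑' k, k * w k * Real.exp (-1) ^ k =
      ∑' k, w k * (3 / 2 * (k * Real.exp (-1) ^ k)) := by
    rw [← tsum_mul_left]
    exact tsum_congr fun k => by ring
  simp_rw [e, e2]
  obtain ⟨C, hC0, hC⟩ := exists_xr_bound
  refine tendsto_tsum_of_dominated_convergence (hw.summable_bound.mul_left C) ?_ ?_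
  · intro k
    exact (tendsto_mul_xr_sub k).1.const_mul _
  · refine Eventually.of_forall fun n k => ?_
    rw [Real.norm_eq_abs, abs_mul]
    have := mul_le_mul_of_nonneg_left (hC k n) (abs_nonneg (w k))
    linarith

end Weights

section LegCoefficients

/-- Falling factorial coefficients of `l ↦ l - 1` (truncated). -/
def cA (j : ℕ) : ℝ :=
  (-1) ^ j / j.factorial - (if j = 0 then 1 else 0) + (if j = 1 then 1 else 0)

/-- Falling factorial coefficients of `l ↦ (l - 1) ^ 2` (truncated subtraction). -/
def cB (j : ℕ) : ℝ :=
  -((-1) ^ j / j.factorial) + (if j = 0 then 1 else 0) - (if j = 1 then 1 else 0) +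
    (if j = 2 then 1 else 0)

lemma sum_ite_mul_descFactorial (l i : ℕ) :
    ∑ j ∈ Finset.range (l + 1), (if j = i then (1 : ℝ) else 0) * l.descFactorial j =
      l.descFactorial i := by
  simp_rw [ite_mul, one_mul, zero_mul]
  rw [Finset.sum_ite_eq']
  split_ifs with h
  · rfl
  · rw [Nat.descFactorial_eq_zero_iff_lt.2 (by simpa using h), Nat.cast_zero]

lemma sum_alternating_descFactorial (l : ℕ) :
    ∑ j ∈ Finset.range (l + 1), ((-1 : ℝ) ^ j / j.factorial) * l.descFactorial j =
      if l = 0 then 1 else 0 := by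
  have h := congrArg (Int.cast : ℤ → ℝ) (Int.alternating_sum_range_choose (n := l))
  push_cast at h
  rw [← h]
  refine Finset.sum_congr rfl fun j _ => ?_
  rw [Nat.descFactorial_eq_factorial_mul_choose]
  have : (j.factorial : ℝ) ≠ 0 := by positivity
  push_cast
  field_simp

lemma fallingCoeff_cA : FallingCoeff (fun l => ((l - 1 : ℕ) : ℝ)) cA := by
  intro l
  simp only [cA, add_mul, sub_mul, Finset.sum_add_distrib, Finset.sum_sub_distrib,
    sum_ite_mul_descFactorial, sum_alternating_descFactorial]
  cases l <;> simp

lemma fallingCoeff_cB : FallingCoeff (fun l => ((l - 1 : ℕ) : ℝ) ^ 2) cB := by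
  intro l
  simp only [cB, add_mul, sub_mul, neg_mul, Finset.sum_add_distrib, Finset.sum_sub_distrib,
    Finset.sum_neg_distrib, sum_ite_mul_descFactorial, sum_alternating_descFactorial]
  cases l with
  | zero => simp [Nat.descFactorial]
  | succ l =>
    simp [Nat.descFactorial]
    ring

lemma hasSum_alternating (z : ℝ) :
    HasSum (fun j : ℕ => (-1 : ℝ) ^ j / j.factorial * z ^ j) (Real.exp (-z)) := by
  have h := NormedSpace.expSeries_div_hasSum_exp (-z)
  rw [← Real.exp_eq_exp_ℝ] at h
  convert! h using 2 with j
  rw [← neg_one_mul z, mul_pow]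
  ring

lemma hasSum_mul_alternating (z : ℝ) :
    HasSum (fun j : ℕ => j * ((-1 : ℝ) ^ j / j.factorial * z ^ j)) (-(z * Real.exp (-z))) := by
  rw [← hasSum_nat_add_iff' 1]
  have h := (hasSum_alternating z).mul_left (-z)
  simp only [Finset.sum_range_one, Nat.cast_zero, zero_mul, sub_zero]
  rw [← neg_mul]
  convert! h using 2 with j
  rw [Nat.factorial_succ, pow_succ, pow_succ]
  have : (j.factorial : ℝ) ≠ 0 := by positivity
  push_cast
  field_simp

lemma hasSum_ite_mul_pow (i : ℕ) (z : ℝ) :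
    HasSum (fun j : ℕ => (if j = i then (1 : ℝ) else 0) * z ^ j) (z ^ i) := by
  convert! hasSum_ite_eq i (z ^ i) using 2 with j
  split_ifs with h
  · rw [h, one_mul]
  · rw [zero_mul]

lemma hasSum_cA (z : ℝ) : HasSum (fun j => cA j * z ^ j) (z - 1 + Real.exp (-z)) := by
  have h := ((hasSum_alternating z).sub (hasSum_ite_mul_pow 0 z)).add (hasSum_ite_mul_pow 1 z)
  rw [show z - 1 + Real.exp (-z) = Real.exp (-z) - z ^ 0 + z ^ 1 by ring]
  convert! h using 2 with j
  rw [cA]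
  ring

lemma hasSum_mul_cA (z : ℝ) :
    HasSum (fun j => j * cA j * z ^ j) (z * (1 - Real.exp (-z))) := by
  have h := (hasSum_mul_alternating z).add (hasSum_ite_mul_pow 1 z)
  rw [show z * (1 - Real.exp (-z)) = -(z * Real.exp (-z)) + z ^ 1 by ring]
  convert! h using 2 with j
  rw [cA]
  by_cases h0 : j = 0
  · simp [h0]
  by_cases h1 : j = 1
  · subst h1
    simp
  · simp only [if_neg h0, if_neg h1]
    ring

lemma hasSum_cB (z : ℝ) :
    HasSum (fun j => cB j * z ^ j) (z ^ 2 - z + 1 - Real.exp (-z)) := by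
  have h := (((hasSum_alternating z).neg.add (hasSum_ite_mul_pow 0 z)).sub
    (hasSum_ite_mul_pow 1 z)).add (hasSum_ite_mul_pow 2 z)
  rw [show z ^ 2 - z + 1 - Real.exp (-z) = -Real.exp (-z) + z ^ 0 - z ^ 1 + z ^ 2 by ring]
  convert! h using 2 with j
  rw [cB]
  ring

lemma entireCoeff_cA : EntireCoeff cA := fun r => (hasSum_cA r).summable

lemma entireCoeff_cB : EntireCoeff cB := fun r => (hasSum_cB r).summable

/-- The value `1 / (e - 1)`. -/
def treeP : ℝ := Real.exp (-1) / (1 - Real.exp (-1))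

/-- The limiting mean of the metric dimension, normalized. -/
def meanC : ℝ := treeP - 1 + Real.exp (-treeP)

/-- The derivative term in the limiting variance. -/
def driftC : ℝ := treeP * (1 - Real.exp (-treeP)) / (1 - Real.exp (-1))

/-- The limiting variance of the metric dimension, normalized. -/
def varC : ℝ :=
  (treeP ^ 2 - treeP + 1 - Real.exp (-treeP)) - meanC ^ 2 - 2 * meanC * driftC

lemma tendsto_mean :
    Tendsto (fun n : ℕ => (n : ℝ) * (wsum (weight cA) n - meanC)) atTop (𝓝 (3 / 2 * driftC)) := by
  have h0 := (Real.exp_pos (-1)).le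
  have h1 := exp_neg_one_le.trans_lt (by norm_num : (2 / 3 : ℝ) < 1)
  have h := entireCoeff_cA.subexp_weight.tendsto_mul_wsum_sub
  rw [(hasSum_weight entireCoeff_cA h0 h1).tsum_eq, (hasSum_mul_weight entireCoeff_cA h0 h1).tsum_eq,
    (hasSum_cA _).tsum_eq, (hasSum_mul_cA _).tsum_eq] at h
  exact h

lemma tendsto_variance :
    Tendsto (fun n : ℕ => wsum (weight cB) n + ((n : ℝ) - 1) * wsum (weight (sqCoeff cA)) n -
      wsum (fun k => k * weight (sqCoeff cA) k) n - 2 * meanC * n * wsum (weight cA) n +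
      meanC ^ 2 * n) atTop (𝓝 varC) := by
  have h0 := (Real.exp_pos (-1)).le
  have h1 := exp_neg_one_le.trans_lt (by norm_num : (2 / 3 : ℝ) < 1)
  have hB := entireCoeff_cB.subexp_weight.tendsto_wsum
  rw [(hasSum_weight entireCoeff_cB h0 h1).tsum_eq, (hasSum_cB _).tsum_eq] at hB
  have hS := entireCoeff_cA.sqCoeff.subexp_weight.tendsto_wsum
  have hS2 := entireCoeff_cA.sqCoeff.subexp_weight.tendsto_mul_wsum_sub
  have hS3 := entireCoeff_cA.sqCoeff.subexp_mul_weight.tendsto_wsum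
  have e : ∑' k, weight (sqCoeff cA) k * Real.exp (-1) ^ k = meanC ^ 2 := by
    rw [(hasSum_weight entireCoeff_cA.sqCoeff h0 h1).tsum_eq,
      (hasSum_sqCoeff entireCoeff_cA _).tsum_eq, (hasSum_cA _).tsum_eq]
    rfl
  have e2 : ∑' k : ℕ, k * weight (sqCoeff cA) k * Real.exp (-1) ^ k = 2 * meanC * driftC := by
    rw [(hasSum_mul_weight entireCoeff_cA.sqCoeff h0 h1).tsum_eq,
      (hasSum_mul_sqCoeff entireCoeff_cA _).tsum_eq, (hasSum_cA _).tsum_eq,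
      (hasSum_mul_cA _).tsum_eq, mul_div_assoc]
    rfl
  rw [e] at hS hS2
  rw [e2] at hS2 hS3
  have h := (((hB.sub hS).sub hS3).add hS2).sub (tendsto_mean.const_mul (2 * meanC))
  have e3 : varC = (Real.exp (-1) / (1 - Real.exp (-1))) ^ 2 -
      (Real.exp (-1) / (1 - Real.exp (-1))) + 1 - Real.exp (-(Real.exp (-1) / (1 - Real.exp (-1)))) -
      meanC ^ 2 - 2 * meanC * driftC + 3 / 2 * (2 * meanC * driftC) -
      2 * meanC * (3 / 2 * driftC) := by
    rw [varC, treeP]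
    ring
  rw [e3]
  refine h.congr fun n => ?_
  ring

end LegCoefficients

section TreeMoments

variable {V : Type*} [Fintype V] {G : SimpleGraph V} {S : Finset V}

/-- The metric dimension of a tree which is not a path, in terms of its legs. -/
def legSum (S : Finset V) (G : SimpleGraph V) : ℝ :=
  ∑ v ∈ S, (((legs G v v).card - 1 : ℕ) : ℝ)

/-- The square of `legSum`, for a tree which is not a path. -/
def legSqSum (S : Finset V) (G : SimpleGraph V) : ℝ :=
  ∑ v ∈ S, (((legs G v v).card - 1 : ℕ) : ℝ) ^ 2 +
    ∑ v ∈ S, ∑ w ∈ S.erase v,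
      (((legs G v w).card - 1 : ℕ) : ℝ) * (((legs G w v).card - 1 : ℕ) : ℝ)

lemma sum_psum_tau (c : ℕ → ℝ) {n : ℕ} (hn : n ≠ 0) :
    ∑ j ∈ Finset.range n, c j * psum tau j n = tau n * wsum (weight c) n := by
  rw [sum_psum_eq tau_zero, wsum, Finset.mul_sum]
  refine Finset.sum_congr rfl fun k _ => ?_
  have := (tau_pos hn).ne'
  rw [xr]
  field_simp

lemma sum_psum_tau2 (c : ℕ → ℝ) {n : ℕ} (hn : n ≠ 0) :
    ∑ j ∈ Finset.range n, c j * psum tau2 j n =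
      tau n * (((n : ℝ) - 1) * wsum (weight c) n - wsum (fun k => k * weight c k) n) := by
  rw [sum_psum_eq (tau2_eq_zero 0 (by norm_num)), wsum, wsum, Finset.mul_sum,
    ← Finset.sum_sub_distrib, Finset.mul_sum]
  refine Finset.sum_congr rfl fun k hk => ?_
  have := (tau_pos hn).ne'
  rw [xr, tau2, Nat.cast_sub (Finset.mem_range.1 hk).le]
  field_simp
  ring

lemma sum_legSum (hS : S.Nonempty) : ∑ G ∈ trees S, legSum S G =
    (trees S).card * (S.card * wsum (weight cA) S.card) := by
  unfold legSum
  rw [Finset.sum_comm, Finset.sum_congr rfl fun v hv => sum_legs fallingCoeff_cA hv,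
    Finset.sum_const, nsmul_eq_mul, sum_psum_tau _ hS.card_pos.ne', card_trees_tau hS]
  ring

lemma sum_legSqSum (hS : S.Nonempty) : ∑ G ∈ trees S, legSqSum S G =
    (trees S).card * (S.card * (wsum (weight cB) S.card +
      ((S.card : ℝ) - 1) * wsum (weight (sqCoeff cA)) S.card -
      wsum (fun k => k * weight (sqCoeff cA) k) S.card)) := by
  unfold legSqSum
  have h1 : ∑ G ∈ trees S, ∑ v ∈ S, (((legs G v v).card - 1 : ℕ) : ℝ) ^ 2 =
      (trees S).card * (S.card * wsum (weight cB) S.card) := by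
    rw [Finset.sum_comm, Finset.sum_congr rfl fun v hv => sum_legs fallingCoeff_cB hv,
      Finset.sum_const, nsmul_eq_mul, sum_psum_tau _ hS.card_pos.ne', card_trees_tau hS]
    ring
  have h2 : ∑ G ∈ trees S, ∑ v ∈ S, ∑ w ∈ S.erase v,
      (((legs G v w).card - 1 : ℕ) : ℝ) * (((legs G w v).card - 1 : ℕ) : ℝ) =
      (trees S).card * (S.card * (((S.card : ℝ) - 1) * wsum (weight (sqCoeff cA)) S.card -
        wsum (fun k => k * weight (sqCoeff cA) k) S.card)) := by
    rw [Finset.sum_comm]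
    have h3 : ∀ v ∈ S, ∑ G ∈ trees S, ∑ w ∈ S.erase v,
        (((legs G v w).card - 1 : ℕ) : ℝ) * (((legs G w v).card - 1 : ℕ) : ℝ) =
        (S.card - 1) * ((S.card - 2).factorial * (tau S.card *
          (((S.card : ℝ) - 1) * wsum (weight (sqCoeff cA)) S.card -
            wsum (fun k => k * weight (sqCoeff cA) k) S.card))) := by
      intro v hv
      rw [Finset.sum_comm, Finset.sum_congr rfl fun w hw => sum_legs_pair fallingCoeff_cA hv
        (Finset.mem_of_mem_erase hw) (Finset.ne_of_mem_erase hw).symm, Finset.sum_const,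
        nsmul_eq_mul, Finset.card_erase_of_mem hv, Nat.cast_pred hS.card_pos,
        sum_psum_pair_eq (tau2_eq_zero 0 (by norm_num)), sum_psum_tau2 _ hS.card_pos.ne']
    rw [Finset.sum_congr rfl h3, Finset.sum_const, nsmul_eq_mul, card_trees_tau hS]
    have hpos := hS.card_pos
    generalize S.card = n at *
    obtain ⟨n, rfl⟩ : ∃ k, n = k + 1 := ⟨n - 1, by omega⟩
    cases n with
    | zero => simp [wsum]
    | succ n =>
      rw [show n + 1 + 1 - 1 = n + 1 by omega, show n + 1 + 1 - 2 = n by omega, Nat.factorial_succ]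
      push_cast
      ring
  rw [Finset.sum_add_distrib, h1, h2]
  ring

lemma TreeOn.legSum_eq (h : TreeOn S G) (hS : ∃ u ∈ S, Branch G u) :
    legSum S G = rdim S G := by
  rw [h.rdim_eq hS, legSum]
  push_cast
  rfl

lemma TreeOn.legSqSum_eq (h : TreeOn S G) (hS : ∃ u ∈ S, Branch G u) :
    legSqSum S G = (rdim S G : ℝ) ^ 2 := by
  rw [h.rdim_eq hS, legSqSum, pow_two]
  push_cast
  rw [Finset.sum_mul_sum, ← Finset.sum_add_distrib]
  refine Finset.sum_congr rfl fun v hv => ?_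
  rw [← Finset.add_sum_erase _ _ hv, pow_two]
  congr 1
  refine Finset.sum_congr rfl fun w _ => ?_
  exact_mod_cast (h.legs_pair (v := v) (w := w) hS).symm

lemma legSum_nonneg : 0 ≤ legSum S G := Finset.sum_nonneg fun _ _ => Nat.cast_nonneg _

lemma legSqSum_nonneg : 0 ≤ legSqSum S G := by unfold legSqSum; positivity

lemma TreeOn.card_legs_le (h : TreeOn S G) {v w : V} (hv : v ∈ S) :
    (((legs G v w).card - 1 : ℕ) : ℝ) ≤ S.card := by
  have h1 := Finset.card_le_card (legs_subset_legs_self G v w)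
  have h2 := h.card_legs_lt hv
  exact_mod_cast (show (legs G v w).card - 1 ≤ S.card by omega)

lemma TreeOn.legSum_le (h : TreeOn S G) : legSum S G ≤ (S.card : ℝ) ^ 2 := by
  rw [pow_two, ← nsmul_eq_mul]
  exact Finset.sum_le_card_nsmul _ _ _ fun v hv => h.card_legs_le hv

lemma TreeOn.legSqSum_le (h : TreeOn S G) : legSqSum S G ≤ 2 * (S.card : ℝ) ^ 4 := by
  have hc : (1 : ℝ) ≤ S.card := by exact_mod_cast h.1.card_pos
  have h1 : ∑ v ∈ S, (((legs G v v).card - 1 : ℕ) : ℝ) ^ 2 ≤ (S.card : ℝ) ^ 3 := by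
    rw [pow_succ' _ 2, ← nsmul_eq_mul]
    exact Finset.sum_le_card_nsmul _ _ _ fun v hv =>
      pow_le_pow_left₀ (Nat.cast_nonneg _) (h.card_legs_le hv) 2
  have h2 : ∑ v ∈ S, ∑ w ∈ S.erase v,
      (((legs G v w).card - 1 : ℕ) : ℝ) * (((legs G w v).card - 1 : ℕ) : ℝ) ≤ (S.card : ℝ) ^ 4 := by
    rw [show (S.card : ℝ) ^ 4 = S.card * (S.card : ℝ) ^ 3 by ring, ← nsmul_eq_mul]
    refine Finset.sum_le_card_nsmul _ _ _ fun v hv => ?_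
    refine (Finset.sum_le_sum_of_subset_of_nonneg (Finset.erase_subset v S)
      fun _ _ _ => by positivity).trans ?_
    rw [show (S.card : ℝ) ^ 3 = S.card * ((S.card : ℝ) * S.card) by ring, ← nsmul_eq_mul]
    exact Finset.sum_le_card_nsmul _ _ _ fun w hw =>
      mul_le_mul (h.card_legs_le hv) (h.card_legs_le hw) (Nat.cast_nonneg _) (Nat.cast_nonneg _)
  have h3 : (S.card : ℝ) ^ 3 ≤ (S.card : ℝ) ^ 4 := pow_le_pow_right₀ hc (by norm_num)
  unfold legSqSum
  linarith

lemma card_paths_mul_le (hS : 8 ≤ S.card) :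
    ((trees S).filter (fun G => ¬ ∃ u ∈ S, Branch G u)).card * S.card ^ 6 ≤
      Nat.factorial 8 * (trees S).card := by
  have h1 := card_paths_le (S := S) (by omega)
  have h2 := Nat.factorial_mul_descFactorial (n := S.card) (k := S.card - 8) (by omega)
  rw [Nat.sub_sub_self hS] at h2
  rw [card_trees (Finset.card_pos.1 (by omega)),
    show S.card - 2 = (S.card - 8) + 6 by omega, pow_add, ← mul_assoc]
  refine Nat.mul_le_mul_right _ (h1.trans ?_)
  rw [← h2]
  exact Nat.mul_le_mul_left _ (Nat.descFactorial_le_pow _ _)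

/-- Quantities which agree off the paths have almost the same sum over all trees. -/
lemma abs_sum_sub_sum_le {f g : SimpleGraph V → ℝ} {K : ℝ} (hK : 0 ≤ K) (hS : 8 ≤ S.card)
    (hfg : ∀ G, TreeOn S G → (∃ u ∈ S, Branch G u) → f G = g G)
    (hK' : ∀ G, TreeOn S G → |f G - g G| ≤ K * (S.card : ℝ) ^ 4) :
    |∑ G ∈ trees S, f G - ∑ G ∈ trees S, g G| ≤ K * Nat.factorial 8 * (trees S).card / S.card ^ 2 := by
  have hpos : (0 : ℝ) < S.card := by exact_mod_cast (by omega : 0 < S.card)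
  have h1 := card_paths_mul_le hS
  rw [← Finset.sum_sub_distrib, ← Finset.sum_filter_add_sum_filter_not _
    (fun G => ∃ u ∈ S, Branch G u), Finset.sum_eq_zero (s := (trees S).filter _) fun G hG => ?_,
    zero_add]
  · refine (Finset.abs_sum_le_sum_abs _ _).trans ?_
    refine (Finset.sum_le_card_nsmul _ _ (K * (S.card : ℝ) ^ 4) fun G hG =>
      hK' G (mem_trees.1 (Finset.mem_filter.1 hG).1)).trans ?_
    rw [nsmul_eq_mul, le_div_iff₀ (by positivity)]
    have h2 : (((trees S).filter (fun G => ¬ ∃ u ∈ S, Branch G u)).card : ℝ) * (S.card : ℝ) ^ 6 ≤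
        Nat.factorial 8 * (trees S).card := by exact_mod_cast h1
    calc _ = K * ((((trees S).filter (fun G => ¬ ∃ u ∈ S, Branch G u)).card : ℝ) *
          (S.card : ℝ) ^ 6) := by ring
      _ ≤ _ := by
        rw [mul_assoc]
        exact mul_le_mul_of_nonneg_left h2 hK
  · rw [Finset.mem_filter] at hG
    rw [hfg G (mem_trees.1 hG.1) hG.2, sub_self]

lemma card_trees_pos (hS : S.Nonempty) : (0 : ℝ) < (trees S).card := by
  rw [card_trees hS]
  have := hS.card_pos
  positivity

end TreeMoments

lemma abs_rdim_sub_le {V : Type*} (S : Finset V) (G : SimpleGraph V) (x : ℝ) :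
    |(rdim S G : ℝ) - x * S.card| ≤ (1 + |x|) * S.card := by
  have h1 : (rdim S G : ℝ) ≤ S.card := by exact_mod_cast rdim_le_card S G
  have h2 := abs_sub (rdim S G : ℝ) (x * S.card)
  rw [Nat.abs_cast, abs_mul, Nat.abs_cast] at h2
  linarith

/-- The centered first moment of the metric dimension of trees is bounded. -/
theorem exists_tree_mean_bound : ∃ C : ℝ, 0 ≤ C ∧ ∀ (V : Type) [Fintype V] (S : Finset V),
    |∑ G ∈ trees S, ((rdim S G : ℝ) - meanC * S.card)| ≤ C * (trees S).card := by
  obtain ⟨C, hC⟩ := (Metric.isBounded_range_of_tendsto _ tendsto_mean).exists_norm_le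
  have hC0 : 0 ≤ C := (norm_nonneg _).trans (hC _ ⟨0, rfl⟩)
  refine ⟨C + 2 * Nat.factorial 8 + (1 + |meanC|) * 8, by positivity, fun V _ S => ?_⟩
  have hT : (0 : ℝ) ≤ (trees S).card := Nat.cast_nonneg _
  rcases Nat.lt_or_ge S.card 8 with hS | hS
  · refine (Finset.abs_sum_le_sum_abs _ _).trans ?_
    refine (Finset.sum_le_card_nsmul _ _ ((1 + |meanC|) * 8) fun G _ => ?_).trans ?_
    · refine (abs_rdim_sub_le S G _).trans ?_
      have : (S.card : ℝ) ≤ 8 := by exact_mod_cast hS.le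
      gcongr
    · rw [nsmul_eq_mul, mul_comm]
      refine mul_le_mul_of_nonneg_right ?_ hT
      have : (0 : ℝ) ≤ 2 * Nat.factorial 8 := by positivity
      linarith
  · have hne : S.Nonempty := Finset.card_pos.1 (by omega)
    have hm : (1 : ℝ) ≤ S.card := by exact_mod_cast hne.card_pos
    have h1 := abs_sum_sub_sum_le (S := S) (f := fun G => (rdim S G : ℝ)) (g := legSum S)
      (K := 2) (by norm_num) hS (fun G hG hb => (hG.legSum_eq hb).symm) (by
        intro G hG
        have h1 : (rdim S G : ℝ) ≤ S.card := by exact_mod_cast rdim_le_card S G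
        have h2 := hG.legSum_le
        have h3 := abs_sub (rdim S G : ℝ) (legSum S G)
        rw [Nat.abs_cast, abs_of_nonneg legSum_nonneg] at h3
        have h4 : (S.card : ℝ) ^ 1 ≤ (S.card : ℝ) ^ 4 := pow_le_pow_right₀ hm (by norm_num)
        have h5 : (S.card : ℝ) ^ 2 ≤ (S.card : ℝ) ^ 4 := pow_le_pow_right₀ hm (by norm_num)
        linarith)
    have h2 : |∑ G ∈ trees S, legSum S G - (trees S).card * (meanC * S.card)| ≤
        C * (trees S).card := by
      have h3 := hC _ ⟨S.card, rfl⟩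
      rw [Real.norm_eq_abs] at h3
      rw [sum_legSum hne, show (trees S).card * (S.card * wsum (weight cA) S.card) -
        (trees S).card * (meanC * S.card) =
        (S.card * (wsum (weight cA) S.card - meanC)) * (trees S).card by ring, abs_mul,
        Nat.abs_cast]
      exact mul_le_mul_of_nonneg_right h3 hT
    have h4 : 2 * Nat.factorial 8 * ((trees S).card : ℝ) / S.card ^ 2 ≤
        2 * Nat.factorial 8 * (trees S).card := div_le_self (by positivity) (one_le_pow₀ hm)
    rw [Finset.sum_sub_distrib, Finset.sum_const, nsmul_eq_mul]
    have h5 := abs_sub_le (∑ G ∈ trees S, (rdim S G : ℝ)) (∑ G ∈ trees S, legSum S G)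
      ((trees S).card * (meanC * S.card))
    have h6 : 0 ≤ (1 + |meanC|) * 8 * ((trees S).card : ℝ) := by positivity
    refine (h5.trans (add_le_add (h1.trans h4) h2)).trans ?_
    rw [add_mul, add_mul]
    linarith

/-- The centered second moment of the metric dimension of trees. -/
theorem tree_sq_moment {ε : ℝ} (hε : 0 < ε) : ∃ N : ℕ, ∀ (V : Type) [Fintype V] (S : Finset V),
    N ≤ S.card → |∑ G ∈ trees S, ((rdim S G : ℝ) - meanC * S.card) ^ 2 -
      varC * S.card * (trees S).card| ≤ ε * S.card * (trees S).card := by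
  have h1 := Metric.tendsto_atTop.1 tendsto_variance (ε / 2) (by positivity)
  obtain ⟨N, hN⟩ := h1
  have h0 : Tendsto (fun n : ℕ => (3 + 4 * |meanC|) * Nat.factorial 8 / (n : ℝ)) atTop (𝓝 0) :=
    tendsto_const_div_atTop_nhds_zero_nat _
  obtain ⟨M, hM⟩ := Metric.tendsto_atTop.1 h0 (ε / 2) (by positivity)
  refine ⟨max N (max M 8), fun V _ S hS => ?_⟩
  have hS1 : N ≤ S.card := (le_max_left _ _).trans hS
  have hS2 : M ≤ S.card := ((le_max_left _ _).trans (le_max_right _ _)).trans hS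
  have hS3 : 8 ≤ S.card := ((le_max_right _ _).trans (le_max_right _ _)).trans hS
  have hT : (0 : ℝ) ≤ (trees S).card := Nat.cast_nonneg _
  have hne : S.Nonempty := Finset.card_pos.1 (by omega)
  have hm : (1 : ℝ) ≤ S.card := by exact_mod_cast hne.card_pos
  have hN := hN _ hS1
  have hM := hM _ hS2
  rw [Real.dist_eq] at hN
  rw [Real.dist_eq, sub_zero, abs_of_nonneg (by positivity)] at hM
  have h2 := abs_sum_sub_sum_le (S := S) (f := fun G => ((rdim S G : ℝ) - meanC * S.card) ^ 2)
    (g := fun G => legSqSum S G - 2 * meanC * S.card * legSum S G + (meanC * S.card) ^ 2)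
    (K := 3 + 4 * |meanC|) (by positivity) hS3 (fun G hG hb => by
      rw [hG.legSum_eq hb, hG.legSqSum_eq hb]
      ring) (by
      intro G hG
      have h1 : (rdim S G : ℝ) ≤ S.card := by exact_mod_cast rdim_le_card S G
      have h0 : (0 : ℝ) ≤ rdim S G := Nat.cast_nonneg _
      have h2 := hG.legSum_le
      have h3 := hG.legSqSum_le
      have e : ((rdim S G : ℝ) - meanC * S.card) ^ 2 -
          (legSqSum S G - 2 * meanC * S.card * legSum S G + (meanC * S.card) ^ 2) =
          ((rdim S G : ℝ) ^ 2 - legSqSum S G) -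
            2 * meanC * (S.card * (rdim S G - legSum S G)) := by ring
      rw [e]
      refine (abs_sub _ _).trans ?_
      rw [abs_mul, abs_mul, abs_two]
      have h4 : |(rdim S G : ℝ) ^ 2 - legSqSum S G| ≤ 3 * (S.card : ℝ) ^ 4 := by
        have h5 : (S.card : ℝ) ^ 2 ≤ (S.card : ℝ) ^ 4 := pow_le_pow_right₀ hm (by norm_num)
        have h6 := legSqSum_nonneg (S := S) (G := G)
        rw [abs_le]
        constructor <;> nlinarith
      have h7 : |(S.card : ℝ) * (rdim S G - legSum S G)| ≤ 2 * (S.card : ℝ) ^ 4 := by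
        rw [abs_mul, Nat.abs_cast]
        have h8 : |(rdim S G : ℝ) - legSum S G| ≤ 2 * (S.card : ℝ) ^ 2 := by
          have h9 := abs_sub (rdim S G : ℝ) (legSum S G)
          rw [Nat.abs_cast, abs_of_nonneg legSum_nonneg] at h9
          nlinarith
        have h5 : (S.card : ℝ) ^ 3 ≤ (S.card : ℝ) ^ 4 := pow_le_pow_right₀ hm (by norm_num)
        have h10 := mul_le_mul_of_nonneg_left h8 (by linarith : (0 : ℝ) ≤ S.card)
        nlinarith
      have h8 := mul_le_mul_of_nonneg_left h7 (by positivity : 0 ≤ 2 * |meanC|)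
      linarith)
  have e1 : ∑ G ∈ trees S, (legSqSum S G - 2 * meanC * S.card * legSum S G +
      (meanC * S.card) ^ 2) = S.card * (trees S).card *
      (wsum (weight cB) S.card + ((S.card : ℝ) - 1) * wsum (weight (sqCoeff cA)) S.card -
      wsum (fun k => k * weight (sqCoeff cA) k) S.card -
      2 * meanC * S.card * wsum (weight cA) S.card + meanC ^ 2 * S.card) := by
    rw [Finset.sum_add_distrib, Finset.sum_sub_distrib, ← Finset.mul_sum, sum_legSum hne,
      sum_legSqSum hne, Finset.sum_const, nsmul_eq_mul]
    ring
  rw [e1] at h2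
  set X := wsum (weight cB) S.card + ((S.card : ℝ) - 1) * wsum (weight (sqCoeff cA)) S.card -
      wsum (fun k => k * weight (sqCoeff cA) k) S.card -
      2 * meanC * S.card * wsum (weight cA) S.card + meanC ^ 2 * S.card with hX
  have h3 : |S.card * (trees S).card * X - varC * S.card * (trees S).card| ≤
      ε / 2 * S.card * (trees S).card := by
    rw [show S.card * (trees S).card * X - varC * S.card * (trees S).card =
      (X - varC) * (S.card * (trees S).card) by ring, abs_mul, mul_assoc,
      abs_of_nonneg (by positivity : (0 : ℝ) ≤ S.card * (trees S).card)]
    exact mul_le_mul_of_nonneg_right hN.le (by positivity)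
  have h4 : (3 + 4 * |meanC|) * Nat.factorial 8 * ((trees S).card : ℝ) / S.card ^ 2 ≤
      ε / 2 * S.card * (trees S).card := by
    have h5 : (3 + 4 * |meanC|) * Nat.factorial 8 * ((trees S).card : ℝ) / S.card ^ 2 =
        (3 + 4 * |meanC|) * Nat.factorial 8 / S.card * ((trees S).card / S.card) := by
      field_simp
    rw [h5, mul_assoc]
    refine mul_le_mul hM.le ?_ (by positivity) (by positivity)
    rw [div_le_iff₀ (by positivity)]
    have h6 : (1 : ℝ) ≤ S.card * S.card := by nlinarith
    have h7 := mul_le_mul_of_nonneg_right h6 hT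
    linarith
  have h5 := abs_sub_le (∑ G ∈ trees S, ((rdim S G : ℝ) - meanC * S.card) ^ 2)
    (S.card * (trees S).card * X) (varC * S.card * (trees S).card)
  linarith

/-- A uniform bound on the centered second moment of the metric dimension of trees. -/
theorem exists_tree_sq_bound : ∃ C : ℝ, 0 ≤ C ∧ ∀ (V : Type) [Fintype V] (S : Finset V),
    ∑ G ∈ trees S, ((rdim S G : ℝ) - meanC * S.card) ^ 2 ≤ C * S.card * (trees S).card := by
  obtain ⟨N, hN⟩ := tree_sq_moment one_pos
  refine ⟨(|varC| + 1) + (1 + |meanC|) ^ 2 * N, by positivity, fun V _ S => ?_⟩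
  have hT : (0 : ℝ) ≤ S.card * (trees S).card := by positivity
  rcases Nat.lt_or_ge S.card N with h | h
  · refine (Finset.sum_le_card_nsmul _ _ ((1 + |meanC|) ^ 2 * N * S.card) fun G _ => ?_).trans ?_
    · have h1 := abs_rdim_sub_le S G meanC
      have h2 : (S.card : ℝ) ≤ N := by exact_mod_cast h.le
      rw [← sq_abs]
      refine (pow_le_pow_left₀ (abs_nonneg _) h1 2).trans ?_
      rw [mul_pow, pow_two (S.card : ℝ), mul_assoc]
      gcongr
    · rw [nsmul_eq_mul]
      have h3 : 0 ≤ (|varC| + 1) * ((S.card : ℝ) * (trees S).card) := by positivity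
      nlinarith
  · have h1 := (abs_le.1 (hN V S h)).2
    have h2 := mul_le_mul_of_nonneg_right (le_abs_self varC) hT
    have h3 : 0 ≤ (1 + |meanC|) ^ 2 * N * ((S.card : ℝ) * (trees S).card) := by positivity
    nlinarith

section Forests

variable {V : Type*} {F G H T : SimpleGraph V} {S U : Finset V} {u v w x y : V}

/-- `F` is a forest all of whose edges lie inside `U`. -/
def ForestOn (U : Finset V) (F : SimpleGraph V) : Prop :=
  (∀ u v, F.Adj u v → u ∈ U) ∧ F.IsAcyclic

/-- The labelled forests on a set of vertices. -/
def forests [Fintype V] (U : Finset V) : Finset (SimpleGraph V) :=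
  Finset.univ.filter (ForestOn U)

/-- The vertices of the component of `v`. -/
def comp (U : Finset V) (F : SimpleGraph V) (v : V) : Finset V :=
  U.filter (F.Reachable v)

lemma mem_comp : x ∈ comp U F v ↔ x ∈ U ∧ F.Reachable v x := Finset.mem_filter

lemma mem_forests [Fintype V] : F ∈ forests U ↔ ForestOn U F := by simp [forests]

lemma ForestOn.mem_right (h : ForestOn U F) (hxy : F.Adj x y) : y ∈ U := h.1 y x hxy.symm

lemma edges_of_closed {P : V → Prop} (hP : ∀ z w, P z → G.Adj z w → P w ∧ H.Adj z w)
    (p : G.Walk x y) (hx : P x) : ∀ e ∈ p.edges, e ∈ H.edgeSet := by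
  induction p with
  | nil => simp
  | cons hadj p ih =>
    have h1 := hP _ _ hx hadj
    intro e he
    rw [SimpleGraph.Walk.edges_cons, List.mem_cons] at he
    rcases he with rfl | he
    · exact h1.2
    · exact ih h1.1 e he

lemma edist_eq_of_closed {P : V → Prop} (hP : ∀ z w, P z → G.Adj z w → P w ∧ H.Adj z w)
    (hHG : H ≤ G) (hx : P x) (y : V) : G.edist x y = H.edist x y := by
  refine le_antisymm (SimpleGraph.edist_anti hHG) ?_
  by_cases h : G.Reachable x y
  · obtain ⟨p, hp⟩ := h.exists_walk_length_eq_edist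
    rw [← hp, ← SimpleGraph.Walk.length_transfer p (edges_of_closed hP p hx)]
    exact SimpleGraph.edist_le _
  · rw [SimpleGraph.edist_eq_top_of_not_reachable h]
    exact le_top

lemma ForestOn.reachable_mem (h : ForestOn U F) (hx : x ∈ U) (hxy : F.Reachable x y) : y ∈ U := by
  obtain ⟨p⟩ := hxy
  induction p with
  | nil => exact hx
  | cons hadj _ ih => exact ih (h.mem_right hadj)

lemma TreeOn.forestOn (h : TreeOn S T) : ForestOn S T := ⟨h.2.1, h.2.2.2⟩

lemma ForestOn.join_left (hF : ForestOn (U \ S) F) (hT : ForestOn S T) (z w : V) (hz : z ∈ S)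
    (hzw : (T ⊔ F).Adj z w) : w ∈ S ∧ T.Adj z w := by
  rcases hzw with h | h
  · exact ⟨hT.mem_right h, h⟩
  · exact absurd hz (Finset.mem_sdiff.1 (hF.1 _ _ h)).2

lemma ForestOn.join_right (hF : ForestOn (U \ S) F) (hT : ForestOn S T) (z w : V) (hz : z ∉ S)
    (hzw : (T ⊔ F).Adj z w) : w ∉ S ∧ F.Adj z w := by
  rcases hzw with h | h
  · exact absurd (hT.1 _ _ h) hz
  · exact ⟨(Finset.mem_sdiff.1 (hF.mem_right h)).2, h⟩

lemma ForestOn.join (hF : ForestOn (U \ S) F) (hT : ForestOn S T) (hSU : S ⊆ U) :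
    ForestOn U (T ⊔ F) := by
  refine ⟨fun u v huv => ?_, fun v c hc => ?_⟩
  · rcases huv with h | h
    · exact hSU (hT.1 _ _ h)
    · exact (Finset.mem_sdiff.1 (hF.1 _ _ h)).1
  · by_cases hv : v ∈ S
    · exact hT.2 _ (hc.transfer (edges_of_closed (hF.join_left hT) c hv))
    · exact hF.2 _ (hc.transfer (edges_of_closed (P := (· ∉ S)) (hF.join_right hT) c hv))

lemma ForestOn.comp_join (hF : ForestOn (U \ S) F) (hT : TreeOn S T) (hSU : S ⊆ U) (hv : v ∈ S) :
    comp U (T ⊔ F) v = S := by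
  ext x
  rw [mem_comp]
  constructor
  · rintro ⟨_, ⟨p⟩⟩
    exact hT.forestOn.reachable_mem hv
      ⟨p.transfer T (edges_of_closed (hF.join_left hT.forestOn) p hv)⟩
  · exact fun hx => ⟨hSU hx, (hT.2.2.1 v hv x hx).mono le_sup_left⟩

lemma ForestOn.detach_join_left (hF : ForestOn (U \ S) F) (hT : ForestOn S T) [Fintype V] :
    detach (T ⊔ F) Sᶜ = T := by
  ext x y
  simp only [detach, SimpleGraph.sup_adj, Finset.mem_compl, not_not]
  constructor
  · rintro ⟨h | h, hx, -⟩
    · exact h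
    · exact absurd hx (Finset.mem_sdiff.1 (hF.1 _ _ h)).2
  · exact fun h => ⟨Or.inl h, hT.1 _ _ h, hT.mem_right h⟩

lemma ForestOn.detach_join_right (hF : ForestOn (U \ S) F) (hT : ForestOn S T) :
    detach (T ⊔ F) S = F := by
  ext x y
  simp only [detach, SimpleGraph.sup_adj]
  constructor
  · rintro ⟨h | h, hx, -⟩
    · exact absurd (hT.1 _ _ h) hx
    · exact h
  · exact fun h => ⟨Or.inr h, (Finset.mem_sdiff.1 (hF.1 _ _ h)).2,
      (Finset.mem_sdiff.1 (hF.mem_right h)).2⟩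

lemma ForestOn.comp_closed (hF : ForestOn U F) {z w : V} (hz : z ∈ comp U F v)
    (hzw : F.Adj z w) : w ∈ comp U F v := by
  rw [mem_comp] at hz ⊢
  exact ⟨hF.mem_right hzw, hz.2.trans hzw.reachable⟩

lemma ForestOn.detach_comp (hF : ForestOn U F) : ForestOn (U \ comp U F v) (detach F (comp U F v)) :=
  ⟨fun _ _ h => Finset.mem_sdiff.2 ⟨hF.1 _ _ h.1, h.2.1⟩, hF.2.anti (detach_le _ _)⟩

lemma ForestOn.treeOn_comp [Fintype V] (hF : ForestOn U F) (hv : v ∈ U) :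
    TreeOn (comp U F v) (detach F (comp U F v)ᶜ) := by
  have hvc : v ∈ comp U F v := mem_comp.2 ⟨hv, SimpleGraph.Reachable.refl _⟩
  refine ⟨⟨v, hvc⟩, fun x y h => by simpa using h.2.1, ?_, hF.2.anti (detach_le _ _)⟩
  have key : ∀ x ∈ comp U F v, (detach F (comp U F v)ᶜ).Reachable v x := by
    intro x hx
    obtain ⟨p⟩ := (mem_comp.1 hx).2
    refine ⟨p.transfer _ (edges_of_closed (P := (· ∈ comp U F v)) (fun z w hz hzw => ?_) p hvc)⟩
    have hw := hF.comp_closed hz hzw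
    exact ⟨hw, hzw, by simpa using hz, by simpa using hw⟩
  exact fun x hx y hy => (key x hx).symm.trans (key y hy)

lemma ForestOn.comp_sup_detach [Fintype V] (hF : ForestOn U F) :
    detach F (comp U F v)ᶜ ⊔ detach F (comp U F v) = F := by
  ext x y
  simp only [detach, SimpleGraph.sup_adj, Finset.mem_compl, not_not]
  constructor
  · rintro (h | h) <;> exact h.1
  · intro h
    by_cases hx : x ∈ comp U F v
    · exact Or.inl ⟨h, hx, hF.comp_closed hx h⟩
    · exact Or.inr ⟨h, hx, fun hy => hx (hF.comp_closed hy h.symm)⟩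

/-- Splitting a forest into the component of a vertex and the remaining forest. -/
lemma sum_forests [Fintype V] (hv : v ∈ U) (g : Finset V → SimpleGraph V → ℝ) :
    ∑ F ∈ forests U, g (comp U F v) F =
      ∑ S ∈ U.powerset.filter (v ∈ ·), ∑ T ∈ trees S, ∑ F ∈ forests (U \ S), g S (T ⊔ F) := by
  rw [← Finset.sum_fiberwise_of_maps_to (s := forests U) (t := U.powerset.filter (v ∈ ·))
    (g := fun F => comp U F v)]
  · refine Finset.sum_congr rfl fun S hS => ?_
    obtain ⟨hSU, hvS⟩ := Finset.mem_filter.1 hS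
    rw [Finset.mem_powerset] at hSU
    rw [← Finset.sum_product']
    refine Finset.sum_bij' (fun F _ => (detach F Sᶜ, detach F S)) (fun p _ => p.1 ⊔ p.2)
      ?_ ?_ ?_ ?_ ?_
    · intro F hF
      obtain ⟨hF', rfl⟩ := Finset.mem_filter.1 hF
      have hF := mem_forests.1 hF'
      exact Finset.mem_product.2 ⟨mem_trees.2 (hF.treeOn_comp hv), mem_forests.2 hF.detach_comp⟩
    · rintro ⟨T, F⟩ h
      obtain ⟨hT, hF⟩ := Finset.mem_product.1 h
      rw [mem_trees] at hT
      rw [mem_forests] at hF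
      exact Finset.mem_filter.2 ⟨mem_forests.2 (hF.join hT.forestOn hSU), hF.comp_join hT hSU hvS⟩
    · intro F hF
      obtain ⟨hF', rfl⟩ := Finset.mem_filter.1 hF
      exact (mem_forests.1 hF').comp_sup_detach
    · rintro ⟨T, F⟩ h
      obtain ⟨hT, hF⟩ := Finset.mem_product.1 h
      rw [mem_trees] at hT
      rw [mem_forests] at hF
      have h1 := hF.detach_join_left hT.forestOn
      have h2 := hF.detach_join_right hT.forestOn
      simp only [h1, h2]
    · intro F hF
      obtain ⟨hF', rfl⟩ := Finset.mem_filter.1 hF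
      rw [(mem_forests.1 hF').comp_sup_detach]
  · intro F hF
    exact Finset.mem_filter.2 ⟨Finset.mem_powerset.2 fun x hx => (mem_comp.1 hx).1,
      mem_comp.2 ⟨hv, SimpleGraph.Reachable.refl _⟩⟩

lemma ForestOn.sum_degree_le (hF : ForestOn U F) :
    ∑ u ∈ U, (U.filter (F.Adj u)).card ≤ 2 * U.card := by
  rcases U.eq_empty_or_nonempty with rfl | ⟨u₀, hu₀⟩
  · simp
  have : Nonempty U := ⟨⟨u₀, hu₀⟩⟩
  obtain ⟨T, hFT, -, hT⟩ := (SimpleGraph.connected_top (V := U)).exists_isTree_le_of_le_of_isAcyclic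
    le_top (hF.2.induce (U : Set V))
  have h1 := hT.card_edgeFinset
  rw [Fintype.card_coe] at h1
  have h2 := T.sum_degrees_eq_twice_card_edges
  rw [← Finset.sum_coe_sort U]
  refine (Finset.sum_le_sum fun u _ => ?_).trans (h2.le.trans (by omega))
  rw [← SimpleGraph.card_neighborFinset_eq_degree]
  refine Finset.card_le_card_of_injOn (fun x => if h : x ∈ U then ⟨x, h⟩ else u) ?_ ?_
  · intro x hx
    simp only [Finset.coe_filter, Set.mem_ofPred_eq] at hx
    simp only [hx.1, dite_true, Finset.mem_coe, SimpleGraph.mem_neighborFinset]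
    exact hFT hx.2
  · intro x hx y hy hxy
    simp only [Finset.coe_filter, Set.mem_ofPred_eq] at hx hy
    simpa [hx.1, hy.1] using hxy

lemma sup_edge_left_cancel (hF : ¬ F.Adj x y) (hG : ¬ G.Adj x y)
    (h : F ⊔ SimpleGraph.edge x y = G ⊔ SimpleGraph.edge x y) : F = G := by
  ext a b
  have h1 : (F ⊔ SimpleGraph.edge x y).Adj a b ↔ (G ⊔ SimpleGraph.edge x y).Adj a b := by rw [h]
  simp only [SimpleGraph.sup_adj, SimpleGraph.edge_adj] at h1
  have h2 := fun h => hF (F.symm.symm _ _ h)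
  have h3 := fun h => hG (G.symm.symm _ _ h)
  grind

/-- On average, at most two vertices lie outside the component of a given vertex. -/
lemma sum_card_sdiff_comp_le [Fintype V] (U : Finset V) :
    ∑ v ∈ U, ∑ F ∈ forests U, (U \ comp U F v).card ≤ 2 * U.card * (forests U).card := by
  have h1 : ∑ F ∈ forests U, ∑ u ∈ U, (U.filter (F.Adj u)).card ≤
      2 * U.card * (forests U).card := by
    rw [mul_comm, ← smul_eq_mul]
    exact Finset.sum_le_card_nsmul _ _ _ fun F hF => (mem_forests.1 hF).sum_degree_le
  rw [Finset.sum_comm] at h1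
  refine (Finset.sum_le_sum fun v hv => ?_).trans h1
  rw [← Finset.card_sigma, ← Finset.card_sigma]
  refine Finset.card_le_card_of_injOn (fun p => ⟨p.1 ⊔ SimpleGraph.edge v p.2, p.2⟩) ?_ ?_
  · rintro ⟨F, x⟩ h
    simp only [Finset.coe_sigma, Set.mem_sigma_iff, Finset.mem_coe, mem_forests, Finset.mem_sdiff,
      mem_comp, Finset.mem_filter, not_and] at h ⊢
    obtain ⟨hF, hx, hvx⟩ := h
    have hvx := hvx hx
    have hne : v ≠ x := fun e => hvx (e ▸ SimpleGraph.Reachable.refl _)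
    refine ⟨⟨fun a b hab => ?_, hF.2.sup_edge_of_not_reachable hvx⟩, hx, ?_⟩
    · simp only [SimpleGraph.sup_adj, SimpleGraph.edge_adj] at hab
      rcases hab with hab | hab
      · exact hF.1 _ _ hab
      · grind
    · simp [SimpleGraph.edge_adj, hne]
  · rintro ⟨F, x⟩ h ⟨G, y⟩ h' e
    simp only [Finset.coe_sigma, Set.mem_sigma_iff, Finset.mem_coe, mem_forests, Finset.mem_sdiff,
      mem_comp, not_and] at h h'
    simp only [Sigma.mk.injEq, heq_eq_eq] at e
    obtain ⟨e, rfl⟩ := e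
    have := sup_edge_left_cancel (fun hh => h.2.2 h.2.1 hh.reachable)
      (fun hh => h'.2.2 h'.2.1 hh.reachable) e
    rw [this]

lemma ForestOn.rdim_add_le (hF : ForestOn (U \ S) F) (hT : ForestOn S T) (hSU : S ⊆ U) :
    rdim S T + rdim (U \ S) F ≤ rdim U (T ⊔ F) := by
  obtain ⟨R, hRU, hR, hres⟩ := exists_rdim U (T ⊔ F)
  have hedge : ∀ u v, u ∈ S → v ∉ S → ¬ (T ⊔ F).Reachable u v := by
    rintro u v hu hv ⟨p⟩
    exact hv (hT.reachable_mem hu ⟨p.transfer T (edges_of_closed (hF.join_left hT) p hu)⟩)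
  have h1 : rdim S T ≤ (R ∩ S).card := by
    refine rdim_le Finset.inter_subset_right fun u hu v hv huv => ?_
    obtain ⟨w, hw, hne⟩ := hres u (hSU hu) v (hSU hv) huv
    by_cases hwS : w ∈ S
    · refine ⟨w, Finset.mem_inter.2 ⟨hw, hwS⟩, ?_⟩
      rwa [edist_eq_of_closed (hF.join_left hT) le_sup_left hu,
        edist_eq_of_closed (hF.join_left hT) le_sup_left hv] at hne
    · rw [SimpleGraph.edist_eq_top_of_not_reachable (hedge u w hu hwS),
        SimpleGraph.edist_eq_top_of_not_reachable (hedge v w hv hwS)] at hne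
      exact absurd rfl hne
  have h2 : rdim (U \ S) F ≤ (R \ S).card := by
    refine rdim_le (Finset.sdiff_subset_sdiff hRU subset_rfl) fun u hu v hv huv => ?_
    rw [Finset.mem_sdiff] at hu hv
    obtain ⟨w, hw, hne⟩ := hres u hu.1 v hv.1 huv
    by_cases hwS : w ∈ S
    · rw [SimpleGraph.edist_eq_top_of_not_reachable fun h => hedge w u hwS hu.2 h.symm,
        SimpleGraph.edist_eq_top_of_not_reachable fun h => hedge w v hwS hv.2 h.symm] at hne
      exact absurd rfl hne
    · refine ⟨w, Finset.mem_sdiff.2 ⟨hw, hwS⟩, ?_⟩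
      rwa [edist_eq_of_closed (P := (· ∉ S)) (hF.join_right hT) le_sup_right hu.2,
        edist_eq_of_closed (P := (· ∉ S)) (hF.join_right hT) le_sup_right hv.2] at hne
  have := Finset.card_inter_add_card_sdiff R S
  omega

lemma ForestOn.rdim_join_le (hF : ForestOn (U \ S) F) (hT : TreeOn S T) (hSU : S ⊆ U) :
    rdim U (T ⊔ F) ≤ rdim S T + rdim (U \ S) F + 1 := by
  obtain ⟨R₁, hR₁, h₁, hres₁⟩ := exists_rdim S T
  obtain ⟨R₂, hR₂, h₂, hres₂⟩ := exists_rdim (U \ S) F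
  obtain ⟨s, hs⟩ := hT.1
  have hin : ∀ u ∈ S, ∀ v, v ∉ S → ∃ w ∈ insert s (R₁ ∪ R₂),
      (T ⊔ F).edist u w ≠ (T ⊔ F).edist v w := by
    intro u hu v hv
    refine ⟨s, Finset.mem_insert_self _ _, ?_⟩
    rw [SimpleGraph.edist_eq_top_of_not_reachable (u := v)]
    · exact SimpleGraph.edist_ne_top_iff_reachable.2 ((hT.2.2.1 u hu s hs).mono le_sup_left)
    · intro h
      obtain ⟨p⟩ := h.symm
      exact hv (hT.forestOn.reachable_mem hs
        ⟨p.transfer T (edges_of_closed (hF.join_left hT.forestOn) p hs)⟩)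
  have h : rdim U (T ⊔ F) ≤ (insert s (R₁ ∪ R₂)).card := by
    refine rdim_le ?_ fun u hu v hv huv => ?_
    · intro x hx
      grind
    · by_cases hu' : u ∈ S <;> by_cases hv' : v ∈ S
      · obtain ⟨w, hw, hne⟩ := hres₁ u hu' v hv' huv
        refine ⟨w, by simp [hw], ?_⟩
        rwa [edist_eq_of_closed (hF.join_left hT.forestOn) le_sup_left hu',
          edist_eq_of_closed (hF.join_left hT.forestOn) le_sup_left hv']
      · exact hin u hu' v hv'
      · obtain ⟨w, hw, hne⟩ := hin v hv' u hu'
        exact ⟨w, hw, hne.symm⟩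
      · obtain ⟨w, hw, hne⟩ := hres₂ u (by simp [hu, hu']) v (by simp [hv, hv']) huv
        refine ⟨w, by simp [hw], ?_⟩
        rwa [edist_eq_of_closed (P := (· ∉ S)) (hF.join_right hT.forestOn) le_sup_right hu',
          edist_eq_of_closed (P := (· ∉ S)) (hF.join_right hT.forestOn) le_sup_right hv']
  have h3 := Finset.card_insert_le s (R₁ ∪ R₂)
  have h4 := Finset.card_union_le R₁ R₂
  omega

end Forests

section ForestMoments

section Split

variable {V : Type*} [Fintype V] {S U : Finset V} {g g' : Finset V → SimpleGraph V → SimpleGraph V → ℝ}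

/-- The sum of `g` over all forests on `U` with a distinguished vertex, split into the component of
that vertex and the remaining forest. -/
def split (U : Finset V) (g : Finset V → SimpleGraph V → SimpleGraph V → ℝ) : ℝ :=
  ∑ S ∈ U.powerset, S.card * ∑ T ∈ trees S, ∑ F ∈ forests (U \ S), g S T F

lemma split_join (U : Finset V) (g : Finset V → SimpleGraph V → ℝ) :
    split U (fun S T F => g S (T ⊔ F)) = ∑ v ∈ U, ∑ F ∈ forests U, g (comp U F v) F := by
  rw [Finset.sum_congr rfl fun v hv => sum_forests hv g]
  rw [Finset.sum_comm' (s' := id) (t' := U.powerset)]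
  · exact Finset.sum_congr rfl fun S _ => by rw [Finset.sum_const, nsmul_eq_mul, id]
  · intro v S
    simp only [Finset.mem_filter, Finset.mem_powerset, id]
    grind

lemma split_forest (U : Finset V) (f : SimpleGraph V → ℝ) :
    split U (fun _ T F => f (T ⊔ F)) = U.card * ∑ F ∈ forests U, f F := by
  rw [split_join U fun _ => f, Finset.sum_const, nsmul_eq_mul]

lemma split_const (U : Finset V) (c : ℝ) :
    split U (fun _ _ _ => c) = c * (U.card * (forests U).card) := by
  rw [split_forest U fun _ => c, Finset.sum_const, nsmul_eq_mul]
  ring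

lemma split_sdiff_le (U : Finset V) :
    split U (fun S _ _ => ((U \ S).card : ℝ)) ≤ 2 * (U.card * (forests U).card) := by
  rw [split_join U fun S _ => ((U \ S).card : ℝ)]
  have h := sum_card_sdiff_comp_le U
  rw [mul_assoc] at h
  exact_mod_cast h

lemma split_add : split U (fun S T F => g S T F + g' S T F) = split U g + split U g' := by
  simp only [split, Finset.sum_add_distrib, mul_add]

lemma split_mul (c : ℝ) : split U (fun S T F => c * g S T F) = c * split U g := by
  simp only [split, ← Finset.mul_sum]
  simp only [Finset.mul_sum]
  exact Finset.sum_congr rfl fun S _ => by ring_nf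

lemma split_sub : split U (fun S T F => g S T F - g' S T F) = split U g - split U g' := by
  simp only [split, Finset.sum_sub_distrib, mul_sub]

lemma split_le (h : ∀ S ⊆ U, ∀ T ∈ trees S, ∀ F ∈ forests (U \ S), g S T F ≤ g' S T F) :
    split U g ≤ split U g' := by
  refine Finset.sum_le_sum fun S hS => mul_le_mul_of_nonneg_left ?_ (Nat.cast_nonneg _)
  exact Finset.sum_le_sum fun T hT => Finset.sum_le_sum fun F hF =>
    h S (Finset.mem_powerset.1 hS) T hT F hF

lemma abs_split_le (h : ∀ S ⊆ U, ∀ T ∈ trees S, ∀ F ∈ forests (U \ S), |g S T F| ≤ g' S T F) :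
    |split U g| ≤ split U g' := by
  rw [abs_le]
  constructor
  · have h1 : split U (fun S T F => -1 * g' S T F) ≤ split U g :=
      split_le fun S hS T hT F hF => by linarith [(abs_le.1 (h S hS T hT F hF)).1]
    rw [split_mul] at h1
    linarith
  · exact split_le fun S hS T hT F hF => (abs_le.1 (h S hS T hT F hF)).2

lemma abs_split_tree_le {x : Finset V → SimpleGraph V → ℝ} {c : Finset V → ℝ}
    (h : ∀ S ⊆ U, |∑ T ∈ trees S, x S T| ≤ c S * (trees S).card) :
    |split U (fun S T _ => x S T)| ≤ split U (fun S _ _ => c S) := by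
  refine (Finset.abs_sum_le_sum_abs _ _).trans (Finset.sum_le_sum fun S hS => ?_)
  rw [abs_mul, Nat.abs_cast]
  refine mul_le_mul_of_nonneg_left ?_ (Nat.cast_nonneg _)
  simp only [Finset.sum_const, nsmul_eq_mul, ← Finset.mul_sum]
  rw [abs_mul, Nat.abs_cast]
  have h1 := mul_le_mul_of_nonneg_left (h S (Finset.mem_powerset.1 hS))
    (Nat.cast_nonneg (α := ℝ) (forests (U \ S)).card)
  linarith

lemma split_forest_le {x : Finset V → SimpleGraph V → ℝ} {c : Finset V → ℝ}
    (h : ∀ S ⊆ U, ∑ F ∈ forests (U \ S), x S F ≤ c S * (forests (U \ S)).card) :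
    split U (fun S _ F => x S F) ≤ split U (fun S _ _ => c S) := by
  refine Finset.sum_le_sum fun S hS => mul_le_mul_of_nonneg_left ?_ (Nat.cast_nonneg _)
  refine Finset.sum_le_sum fun T _ => ?_
  rw [Finset.sum_const, nsmul_eq_mul, mul_comm]
  exact h S (Finset.mem_powerset.1 hS)

end Split

/-- The centered metric dimension. -/
def dev {V : Type*} (S : Finset V) (G : SimpleGraph V) : ℝ := rdim S G - meanC * S.card

lemma abs_dev_le {V : Type*} (S : Finset V) (G : SimpleGraph V) :
    |dev S G| ≤ (1 + |meanC|) * S.card := abs_rdim_sub_le S G meanC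

lemma abs_dev_join_sub_le {V : Type*} [Fintype V] {S U : Finset V} {T F : SimpleGraph V} (hSU : S ⊆ U)
    (hT : T ∈ trees S) (hF : F ∈ forests (U \ S)) :
    |dev U (T ⊔ F) - dev S T - dev (U \ S) F| ≤ 1 := by
  rw [mem_trees] at hT
  rw [mem_forests] at hF
  have h1 : (rdim S T : ℝ) + rdim (U \ S) F ≤ rdim U (T ⊔ F) := by
    exact_mod_cast hF.rdim_add_le hT.forestOn hSU
  have h2 : (rdim U (T ⊔ F) : ℝ) ≤ rdim S T + rdim (U \ S) F + 1 := by
    exact_mod_cast hF.rdim_join_le hT hSU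
  have h3 : (U.card : ℝ) = S.card + (U \ S).card := by
    rw [add_comm]; exact_mod_cast (Finset.card_sdiff_add_card_eq_card hSU).symm
  rw [abs_le, dev, dev, dev, h3]
  constructor <;> linarith

lemma abs_dev_join_sub_le' {V : Type*} [Fintype V] {S U : Finset V} {T F : SimpleGraph V} (hSU : S ⊆ U)
    (hT : T ∈ trees S) (hF : F ∈ forests (U \ S)) :
    |dev U (T ⊔ F) - dev S T| ≤ (1 + |meanC|) * (U \ S).card + 1 := by
  have h1 := abs_le.1 (abs_dev_join_sub_le hSU hT hF)
  have h2 := abs_le.1 (abs_dev_le (U \ S) F)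
  rw [abs_le]
  constructor <;> linarith

lemma dev_empty {V : Type*} (G : SimpleGraph V) : dev ∅ G = 0 := by
  simpa using abs_dev_le ∅ G

/-- The centered first moment of the metric dimension of forests is bounded. -/
theorem exists_forest_mean_bound : ∃ C : ℝ, 0 ≤ C ∧ ∀ (V : Type) [Fintype V] (U : Finset V),
    |∑ F ∈ forests U, dev U F| ≤ C * (forests U).card := by
  obtain ⟨C, hC0, hC⟩ := exists_tree_mean_bound
  refine ⟨C + (2 * (1 + |meanC|) + 1), by positivity, fun V _ U => ?_⟩
  rcases U.eq_empty_or_nonempty with rfl | hU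
  · simp only [dev_empty, Finset.sum_const_zero, abs_zero]
    positivity
  have hn : (0 : ℝ) < U.card := by exact_mod_cast hU.card_pos
  refine le_of_mul_le_mul_left ?_ hn
  have e : (U.card : ℝ) * |∑ F ∈ forests U, dev U F| = |split U fun _ T F => dev U (T ⊔ F)| := by
    rw [split_forest U (dev U), abs_mul, Nat.abs_cast]
  have e2 : split U (fun _ T F => dev U (T ⊔ F)) = split U (fun S T _ => dev S T) +
      split U (fun S T F => dev U (T ⊔ F) - dev S T) := by
    rw [← split_add]
    simp only [add_sub_cancel]
  rw [e, e2]
  refine (abs_add_le _ _).trans ?_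
  have h1 := abs_split_tree_le (U := U) (x := dev) (c := fun _ => C) fun S _ => hC V S
  have h2 := abs_split_le (U := U) (g := fun S T F => dev U (T ⊔ F) - dev S T)
    (g' := fun S _ _ => (1 + |meanC|) * (U \ S).card + 1)
    fun S hS T hT F hF => abs_dev_join_sub_le' hS hT hF
  rw [split_add (g := fun S _ _ => (1 + |meanC|) * ((U \ S).card : ℝ)) (g' := fun _ _ _ => 1),
    split_mul, split_const] at h2
  rw [split_const] at h1
  have h3 := mul_le_mul_of_nonneg_left (split_sdiff_le U) (by positivity : 0 ≤ 1 + |meanC|)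
  linarith

lemma abs_split_dev_sq_le {C : ℝ} (hC0 : 0 ≤ C) {V : Type} [Fintype V] (U : Finset V)
    (hC : ∀ S : Finset V, ∑ G ∈ trees S, dev S G ^ 2 ≤ C * S.card * (trees S).card) :
    split U (fun S T _ => dev S T ^ 2) ≤ C * U.card * (U.card * (forests U).card) := by
  rw [← split_const]
  refine (le_abs_self _).trans (abs_split_tree_le (x := fun S T => dev S T ^ 2)
    (c := fun _ => C * U.card) fun S hS => ?_)
  rw [abs_of_nonneg (Finset.sum_nonneg fun _ _ => sq_nonneg _)]
  have h1 : (S.card : ℝ) ≤ U.card := by exact_mod_cast Finset.card_le_card hS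
  exact (hC S).trans (by gcongr)

/-- A uniform bound on the centered second moment of the metric dimension of forests. -/
theorem exists_forest_sq_bound : ∃ C : ℝ, 0 ≤ C ∧ ∀ (V : Type) [Fintype V] (U : Finset V),
    ∑ F ∈ forests U, dev U F ^ 2 ≤ C * U.card * (forests U).card := by
  obtain ⟨C, hC0, hC⟩ := exists_tree_sq_bound
  refine ⟨2 * C + 12 * (1 + |meanC|) ^ 2, by positivity, fun V _ U => ?_⟩
  rcases U.eq_empty_or_nonempty with rfl | hU
  · simp [dev_empty]
  have hn : (1 : ℝ) ≤ U.card := by exact_mod_cast hU.card_pos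
  refine le_of_mul_le_mul_left ?_ (zero_lt_one.trans_le hn)
  rw [← split_forest U fun F => dev U F ^ 2]
  set A := 1 + |meanC| with hA
  have hA1 : 1 ≤ A := by rw [hA]; linarith [abs_nonneg meanC]
  have h1 : split U (fun _ T F => dev U (T ⊔ F) ^ 2) ≤
      split U (fun S T _ => 2 * dev S T ^ 2 + 4 * A ^ 2 * U.card * ((U \ S).card + 1)) := by
    refine split_le fun S hS T hT F hF => ?_
    have h2 := abs_dev_join_sub_le' hS hT hF
    have hk : ((U \ S).card : ℝ) ≤ U.card := by
      exact_mod_cast Finset.card_le_card Finset.sdiff_subset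
    have hk0 : (0 : ℝ) ≤ (U \ S).card := Nat.cast_nonneg _
    have h3 : (dev U (T ⊔ F) - dev S T) ^ 2 ≤ (A * ((U \ S).card + 1)) ^ 2 := by
      rw [← sq_abs]
      refine pow_le_pow_left₀ (abs_nonneg _) (h2.trans ?_) 2
      linarith
    have h4 : (A * (((U \ S).card : ℝ) + 1)) ^ 2 ≤ 2 * A ^ 2 * U.card * ((U \ S).card + 1) := by
      have h5 : (((U \ S).card : ℝ) + 1) * ((U \ S).card + 1) ≤
          (2 * U.card) * ((U \ S).card + 1) := by gcongr; linarith
      have h6 := mul_le_mul_of_nonneg_left h5 (sq_nonneg A)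
      linarith
    nlinarith [sq_nonneg (dev U (T ⊔ F) - 2 * dev S T)]
  refine h1.trans ?_
  rw [split_add (g := fun S T _ => 2 * dev S T ^ 2)
    (g' := fun S _ _ => 4 * A ^ 2 * U.card * (((U \ S).card : ℝ) + 1)), split_mul, split_mul,
    split_add (g := fun S _ _ => ((U \ S).card : ℝ)) (g' := fun _ _ _ => 1), split_const]
  have h2 := abs_split_dev_sq_le hC0 U (hC V)
  have h3 := mul_le_mul_of_nonneg_left (split_sdiff_le U)
    (by positivity : 0 ≤ 4 * A ^ 2 * U.card)
  linarith

lemma tree_sq_moment_le {ε : ℝ} (hε : 0 < ε) : ∃ B : ℝ, 0 ≤ B ∧ ∀ (V : Type) [Fintype V]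
    (S : Finset V), |∑ G ∈ trees S, (dev S G ^ 2 - varC * S.card)| ≤
      (ε * S.card + B) * (trees S).card := by
  obtain ⟨N, hN⟩ := tree_sq_moment hε
  obtain ⟨C, hC0, hC⟩ := exists_tree_sq_bound
  refine ⟨(C + |varC|) * N, by positivity, fun V _ S => ?_⟩
  have e : ∑ G ∈ trees S, (dev S G ^ 2 - varC * S.card) =
      ∑ G ∈ trees S, dev S G ^ 2 - varC * S.card * (trees S).card := by
    rw [Finset.sum_sub_distrib, Finset.sum_const, nsmul_eq_mul]
    ring
  have hT : (0 : ℝ) ≤ (trees S).card := Nat.cast_nonneg _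
  rw [e]
  rcases Nat.lt_or_ge S.card N with h | h
  · refine (abs_sub _ _).trans ?_
    rw [abs_of_nonneg (Finset.sum_nonneg fun _ _ => sq_nonneg _), abs_mul, abs_mul, Nat.abs_cast,
      Nat.abs_cast]
    have h1 : (S.card : ℝ) ≤ N := by exact_mod_cast h.le
    refine (add_le_add_left (hC V S) _).trans ?_
    rw [← add_mul, ← add_mul]
    refine mul_le_mul_of_nonneg_right ?_ hT
    have h2 := mul_le_mul_of_nonneg_left h1 (by positivity : 0 ≤ C + |varC|)
    have h3 : 0 ≤ ε * S.card := by positivity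
    linarith
  · refine (hN V S h).trans ?_
    refine mul_le_mul_of_nonneg_right ?_ hT
    have : 0 ≤ (C + |varC|) * N := by positivity
    linarith

/-- The centered second moment of the metric dimension of forests. -/
theorem forest_sq_moment {ε : ℝ} (hε : 0 < ε) : ∃ B : ℝ, 0 ≤ B ∧ ∀ (V : Type) [Fintype V]
    (U : Finset V), |∑ F ∈ forests U, dev U F ^ 2 - varC * U.card * (forests U).card| ≤
      (ε * U.card + B) * (forests U).card := by
  obtain ⟨B, hB0, hB⟩ := tree_sq_moment_le (half_pos hε)
  obtain ⟨C, hC0, hC⟩ := exists_tree_sq_bound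
  obtain ⟨D, hD0, hD⟩ := exists_forest_sq_bound
  set η := ε / 2 / (C + 1) with hη
  have hη0 : 0 < η := by positivity
  refine ⟨B + 2 * |varC| + (1 + η⁻¹) * (4 * D + 2), by positivity, fun V _ U => ?_⟩
  rcases U.eq_empty_or_nonempty with rfl | hU
  · simp only [dev_empty, Finset.card_empty, Nat.cast_zero, mul_zero, zero_mul, sub_zero, ne_eq,
      OfNat.ofNat_ne_zero, not_false_eq_true, zero_pow, Finset.sum_const_zero, abs_zero]
    positivity
  have hn : (0 : ℝ) < U.card := by exact_mod_cast hU.card_pos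
  refine le_of_mul_le_mul_left ?_ hn
  have e : (U.card : ℝ) * |∑ F ∈ forests U, dev U F ^ 2 - varC * U.card * (forests U).card| =
      |split U (fun _ T F => dev U (T ⊔ F) ^ 2) - varC * U.card * (U.card * (forests U).card)| := by
    rw [split_forest U fun F => dev U F ^ 2, ← Nat.abs_cast, ← abs_mul, Nat.abs_cast]
    congr 1
    ring
  rw [e]
  set M : ℝ := U.card * (forests U).card with hM
  have hM0 : 0 ≤ M := by positivity
  have hsq := abs_split_dev_sq_le hC0 U (hC V)
  have h1 : |split U (fun _ T F => dev U (T ⊔ F) ^ 2) - split U (fun S T _ => dev S T ^ 2)| ≤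
      ε / 2 * U.card * M + (1 + η⁻¹) * ((4 * D + 2) * M) := by
    rw [← split_sub]
    refine (abs_split_le (g' := fun S T F => η * dev S T ^ 2 + (1 + η⁻¹) *
      (2 * dev (U \ S) F ^ 2 + 2)) fun S hS T hT F hF => ?_).trans ?_
    · have h2 := abs_dev_join_sub_le hS hT hF
      set z := dev U (T ⊔ F) - dev S T - dev (U \ S) F with hz
      have h3 : z ^ 2 ≤ 1 := by rw [← sq_abs]; exact pow_le_one₀ (abs_nonneg _) h2
      have h4 : dev U (T ⊔ F) = dev S T + (dev (U \ S) F + z) := by rw [hz]; ring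
      set y := dev (U \ S) F + z with hy
      have h5 : y ^ 2 ≤ 2 * dev (U \ S) F ^ 2 + 2 := by
        have := sq_nonneg (dev (U \ S) F - z)
        rw [hy]
        nlinarith
      have h6 : |2 * (dev S T * y)| ≤ η * dev S T ^ 2 + η⁻¹ * y ^ 2 := by
        have e1 : η * dev S T ^ 2 + η⁻¹ * y ^ 2 - 2 * (dev S T * y) =
            η * (dev S T - η⁻¹ * y) ^ 2 := by field_simp; ring
        have e2 : η * dev S T ^ 2 + η⁻¹ * y ^ 2 + 2 * (dev S T * y) =
            η * (dev S T + η⁻¹ * y) ^ 2 := by field_simp; ring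
        have p1 : 0 ≤ η * (dev S T - η⁻¹ * y) ^ 2 := by positivity
        have p2 : 0 ≤ η * (dev S T + η⁻¹ * y) ^ 2 := by positivity
        rw [abs_le]
        constructor <;> linarith
      have h7 : dev U (T ⊔ F) ^ 2 - dev S T ^ 2 = 2 * (dev S T * y) + y ^ 2 := by rw [h4]; ring
      rw [h7]
      have h8 := mul_le_mul_of_nonneg_left h5 (by positivity : 0 ≤ 1 + η⁻¹)
      refine (abs_add_le _ _).trans ?_
      rw [abs_of_nonneg (sq_nonneg y)]
      linarith
    · rw [split_add (g := fun S T _ => η * dev S T ^ 2)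
        (g' := fun S _ F => (1 + η⁻¹) * (2 * dev (U \ S) F ^ 2 + 2)), split_mul, split_mul,
        split_add (g := fun S _ F => 2 * dev (U \ S) F ^ 2) (g' := fun _ _ _ => 2), split_mul,
        split_const]
      have h2 := split_forest_le (U := U) (x := fun S F => dev (U \ S) F ^ 2)
        (c := fun S => D * (U \ S).card) fun S _ => hD V (U \ S)
      rw [split_mul (g := fun S _ _ => ((U \ S).card : ℝ))] at h2
      have h3 := mul_le_mul_of_nonneg_left (split_sdiff_le U) hD0
      have h4 : η * split U (fun S T _ => dev S T ^ 2) ≤ ε / 2 * U.card * M := by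
        refine (mul_le_mul_of_nonneg_left hsq hη0.le).trans ?_
        have h5 : η * C ≤ ε / 2 := by
          rw [hη, div_mul_eq_mul_div, div_le_iff₀ (by positivity)]
          nlinarith
        have := mul_le_mul_of_nonneg_right h5 (by positivity : 0 ≤ U.card * M)
        linarith
      have h5 : 2 * split U (fun S _ F => dev (U \ S) F ^ 2) + 2 * M ≤ (4 * D + 2) * M := by
        linarith
      have h6 := mul_le_mul_of_nonneg_left h5 (by positivity : 0 ≤ 1 + η⁻¹)
      linarith
  have h2 : |split U (fun S T _ => dev S T ^ 2) - split U (fun S _ _ => varC * S.card)| ≤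
      (ε / 2 * U.card + B) * M := by
    rw [← split_sub, ← split_const]
    refine (abs_split_tree_le (x := fun S T => dev S T ^ 2 - varC * S.card)
      (c := fun _ => ε / 2 * U.card + B) fun S hS => (hB V S).trans ?_)
    have h1 : (S.card : ℝ) ≤ U.card := by exact_mod_cast Finset.card_le_card hS
    gcongr
  have h3 : |split U (fun S _ _ => varC * S.card) - varC * U.card * M| ≤ 2 * |varC| * M := by
    rw [← split_const, ← split_sub]
    refine (abs_split_le (g' := fun S _ _ => |varC| * (U \ S).card) fun S hS T _ F _ => ?_).trans ?_
    · have h3 : (U.card : ℝ) = S.card + (U \ S).card := by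
        rw [add_comm]; exact_mod_cast (Finset.card_sdiff_add_card_eq_card hS).symm
      rw [h3, show varC * (S.card : ℝ) - varC * (S.card + (U \ S).card) =
        -(varC * (U \ S).card) by ring, abs_neg, abs_mul, Nat.abs_cast]
    · rw [split_mul (g := fun S _ _ => ((U \ S).card : ℝ))]
      have := mul_le_mul_of_nonneg_left (split_sdiff_le U) (abs_nonneg varC)
      linarith
  have h4 := abs_sub_le (split U (fun _ T F => dev U (T ⊔ F) ^ 2))
    (split U (fun S T _ => dev S T ^ 2)) (varC * U.card * M)
  have h5 := abs_sub_le (split U (fun S T _ => dev S T ^ 2))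
    (split U (fun S _ _ => varC * S.card)) (varC * U.card * M)
  have h6 : (U.card : ℝ) * ((ε * U.card + (B + 2 * |varC| + (1 + η⁻¹) * (4 * D + 2))) *
      (forests U).card) = (ε * U.card + (B + 2 * |varC| + (1 + η⁻¹) * (4 * D + 2))) * M := by
    rw [hM]; ring
  rw [h6]
  linarith

end ForestMoments

section Link

lemma ncard_coe_eq_sInf {n : ℕ} (G : SimpleGraph (Fin n)) :
    {m : ℕ | ∃ R : Set (Fin n), R.ncard = m ∧ Resolves G R} =
      {m | ∃ R ⊆ (Finset.univ : Finset (Fin n)), R.card = m ∧ Res Finset.univ G R} := by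
  ext m
  constructor
  · rintro ⟨R, hR, hres⟩
    refine ⟨R.toFinset, Finset.subset_univ _, ?_, fun u _ v _ huv => ?_⟩
    · rw [← hR, Set.ncard_eq_toFinset_card']
    · obtain ⟨w, hw, h⟩ := hres u v huv
      exact ⟨w, by simpa using hw, h⟩
  · rintro ⟨R, -, hR, hres⟩
    refine ⟨R, by rw [Set.ncard_coe_finset, hR], fun u v huv => ?_⟩
    obtain ⟨w, hw, h⟩ := hres u (Finset.mem_univ _) v (Finset.mem_univ _) huv
    exact ⟨w, hw, h⟩

lemma betaR_eq {n : ℕ} (hn : n ≠ 1) (G : SimpleGraph (Fin n)) :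
    betaR G = meanC * n + dev Finset.univ G := by
  rw [betaR, metricDim, if_neg (by simpa using hn), ncard_coe_eq_sInf, dev, rdim, Finset.card_univ,
    Fintype.card_fin]
  ring

lemma treeSet_eq {n : ℕ} : treeSet n = ↑(trees (Finset.univ : Finset (Fin n))) := by
  ext G
  rw [Finset.mem_coe, mem_trees, treeSet, Set.mem_ofPred_eq, IsTree, TreeOn,
    SimpleGraph.connected_iff]
  simp only [Finset.mem_univ, implies_true, true_and, forall_const,
    Finset.univ_nonempty_iff, SimpleGraph.Preconnected]
  tauto

lemma forestSet_eq {n : ℕ} : forestSet n = ↑(forests (Finset.univ : Finset (Fin n))) := by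
  ext G
  simp [mem_forests, forestSet, ForestOn]

lemma unifExp_coe {n : ℕ} (A : Finset (SimpleGraph (Fin n))) (f : SimpleGraph (Fin n) → ℝ) :
    unifExp (A : Set (SimpleGraph (Fin n))) f = (∑ G ∈ A, f G) / A.card := by
  rw [unifExp, finsum_mem_coe_finset, Nat.card_coe_set_eq, Set.ncard_coe_finset]

/-- The mean and the variance are determined by the moments of the deviation from `meanC * n`. -/
lemma tendsto_moments (A : ∀ n, Finset (SimpleGraph (Fin n))) (hA : ∀ n, n ≠ 0 → (A n).Nonempty)
    {C : ℝ} (hC : ∀ n, |∑ G ∈ A n, dev Finset.univ G| ≤ C * (A n).card)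
    (hV : ∀ ε : ℝ, 0 < ε → ∃ B : ℝ, 0 ≤ B ∧ ∀ n : ℕ,
      |∑ G ∈ A n, dev Finset.univ G ^ 2 - varC * n * (A n).card| ≤ (ε * n + B) * (A n).card) :
    Tendsto (fun n : ℕ => unifExp (A n : Set (SimpleGraph (Fin n))) betaR / n) atTop (𝓝 meanC) ∧
    Tendsto (fun n : ℕ => unifVar (A n : Set (SimpleGraph (Fin n))) betaR / n) atTop (𝓝 varC) := by
  set δ : ℕ → ℝ := fun n => (∑ G ∈ A n, dev Finset.univ G) / (A n).card with hδ
  have hcard : ∀ n, n ≠ 0 → (0 : ℝ) < (A n).card := fun n hn => by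
    exact_mod_cast (hA n hn).card_pos
  have hδC : ∀ n, n ≠ 0 → |δ n| ≤ C := by
    intro n hn
    rw [hδ]
    simp only
    rw [abs_div, Nat.abs_cast, div_le_iff₀ (hcard n hn)]
    exact hC n
  have hmean : ∀ n, 2 ≤ n → unifExp (A n : Set (SimpleGraph (Fin n))) betaR = meanC * n + δ n := by
    intro n hn
    have hc := (hcard n (by omega)).ne'
    rw [unifExp_coe, Finset.sum_congr rfl fun G _ => betaR_eq (by omega) G, Finset.sum_add_distrib,
      Finset.sum_const, nsmul_eq_mul, hδ]
    field_simp
  have hvar : ∀ n, 2 ≤ n → unifVar (A n : Set (SimpleGraph (Fin n))) betaR =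
      (∑ G ∈ A n, dev Finset.univ G ^ 2) / (A n).card - δ n ^ 2 := by
    intro n hn
    have hc := (hcard n (by omega)).ne'
    rw [unifVar, unifExp_coe, hmean n hn]
    have e : ∀ G ∈ A n, (betaR G - (meanC * n + δ n)) ^ 2 =
        dev Finset.univ G ^ 2 - 2 * δ n * dev Finset.univ G + δ n ^ 2 := by
      intro G _
      rw [betaR_eq (by omega) G]
      ring
    have e2 : ∑ G ∈ A n, dev Finset.univ G = δ n * (A n).card := by
      rw [hδ]
      field_simp
    rw [Finset.sum_congr rfl e, Finset.sum_add_distrib, Finset.sum_sub_distrib, ← Finset.mul_sum,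
      e2, Finset.sum_const, nsmul_eq_mul]
    field_simp
    ring
  constructor
  · rw [tendsto_iff_norm_sub_tendsto_zero]
    refine squeeze_zero' (g := fun n : ℕ => C / n) (Eventually.of_forall fun _ => norm_nonneg _) ?_
      (tendsto_const_div_atTop_nhds_zero_nat C)
    filter_upwards [eventually_ge_atTop 2] with n hn
    have hn0 : (0 : ℝ) < n := by exact_mod_cast (by omega : 0 < n)
    rw [hmean n hn, Real.norm_eq_abs, show (meanC * n + δ n) / n - meanC = δ n / n by
      field_simp; ring, abs_div, Nat.abs_cast]
    exact div_le_div_of_nonneg_right (hδC n (by omega)) hn0.le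
  · rw [Metric.tendsto_atTop]
    intro ε hε
    obtain ⟨B, hB0, hB⟩ := hV (ε / 2) (half_pos hε)
    obtain ⟨N, hN⟩ := Metric.tendsto_atTop.1
      (tendsto_const_div_atTop_nhds_zero_nat (𝕜 := ℝ) (B + C ^ 2)) (ε / 2) (half_pos hε)
    refine ⟨max N 2, fun n hn => ?_⟩
    have hn2 : 2 ≤ n := (le_max_right _ _).trans hn
    have hn0 : (0 : ℝ) < n := by exact_mod_cast (by omega : 0 < n)
    have hc := hcard n (by omega)
    have h1 := hN n ((le_max_left _ _).trans hn)
    rw [Real.dist_eq, sub_zero, abs_of_nonneg (by positivity), div_lt_iff₀ hn0] at h1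
    have h2 := hB n
    rw [← div_le_iff₀ hc, ← abs_of_pos hc, ← abs_div, abs_of_pos hc, sub_div,
      mul_div_cancel_right₀ _ hc.ne'] at h2
    have h3 : δ n ^ 2 ≤ C ^ 2 := by
      rw [← sq_abs]
      exact pow_le_pow_left₀ (abs_nonneg _) (hδC n (by omega)) 2
    rw [hvar n hn2, Real.dist_eq]
    set Q := (∑ G ∈ A n, dev Finset.univ G ^ 2) / ((A n).card : ℝ) with hQ
    rw [show (Q - δ n ^ 2) / n - varC = (Q - varC * n - δ n ^ 2) / n by field_simp; ring, abs_div,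
      Nat.abs_cast, div_lt_iff₀ hn0]
    refine (abs_sub _ _).trans_lt ?_
    rw [abs_of_nonneg (sq_nonneg (δ n))]
    linarith

lemma tendsto_treeSet :
    Tendsto (fun n : ℕ => unifExp (treeSet n) betaR / n) atTop (𝓝 meanC) ∧
    Tendsto (fun n : ℕ => unifVar (treeSet n) betaR / n) atTop (𝓝 varC) := by
  obtain ⟨C, -, hC⟩ := exists_tree_mean_bound
  simp only [treeSet_eq]
  refine tendsto_moments (fun n => trees Finset.univ) (fun n hn => ?_)
    (fun n => hC (Fin n) Finset.univ) fun ε hε => ?_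
  · have : Nonempty (Fin n) := ⟨⟨0, Nat.pos_of_ne_zero hn⟩⟩
    exact Finset.card_pos.1 (by exact_mod_cast card_trees_pos (Finset.univ_nonempty (α := Fin n)))
  · obtain ⟨B, hB0, hB⟩ := tree_sq_moment_le hε
    refine ⟨B, hB0, fun n => ?_⟩
    have h := hB (Fin n) Finset.univ
    rw [Finset.sum_sub_distrib, Finset.sum_const, nsmul_eq_mul, Finset.card_univ,
      Fintype.card_fin] at h
    rwa [mul_comm (varC * (n : ℝ))]

lemma tendsto_forestSet :
    Tendsto (fun n : ℕ => unifExp (forestSet n) betaR / n) atTop (𝓝 meanC) ∧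
    Tendsto (fun n : ℕ => unifVar (forestSet n) betaR / n) atTop (𝓝 varC) := by
  obtain ⟨C, -, hC⟩ := exists_forest_mean_bound
  simp only [forestSet_eq]
  refine tendsto_moments (fun n => forests Finset.univ) (fun n _ => ?_)
    (fun n => hC (Fin n) Finset.univ) fun ε hε => ?_
  · exact ⟨⊥, mem_forests.2 ⟨fun _ _ h => h.elim, SimpleGraph.isAcyclic_bot⟩⟩
  · obtain ⟨B, hB0, hB⟩ := forest_sq_moment hε
    refine ⟨B, hB0, fun n => ?_⟩
    have h := hB (Fin n) Finset.univ
    rwa [Finset.card_univ, Fintype.card_fin] at h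

end Link

section Singularity

lemma treeP_eq : treeP = 1 / (Real.exp 1 - 1) := by
  have h1 := Real.exp_one_gt_d9
  rw [treeP, Real.exp_neg]
  have : Real.exp 1 - 1 ≠ 0 := by linarith
  field_simp

lemma exp_neg_treeP_bounds : 11 / 20 < Real.exp (-treeP) ∧ Real.exp (-treeP) < 57 / 100 ∧
    581 / 1000 < treeP ∧ treeP < 583 / 1000 := by
  have h1 := Real.exp_one_gt_d9
  have h2 := Real.exp_one_lt_d9
  have hp := treeP_eq
  have hp1 : 581 / 1000 < treeP := by
    rw [hp, lt_div_iff₀ (by linarith)]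
    linarith
  have hp2 : treeP < 583 / 1000 := by
    rw [hp, div_lt_iff₀ (by linarith)]
    linarith
  have b1 := Real.exp_bound (x := -(581 / 1000)) (by rw [abs_le]; norm_num) (n := 5) (by norm_num)
  have b2 := Real.exp_bound (x := -(583 / 1000)) (by rw [abs_le]; norm_num) (n := 5) (by norm_num)
  norm_num [Finset.sum_range_succ, Nat.factorial, abs_le] at b1 b2
  refine ⟨?_, ?_, hp1, hp2⟩
  · have := Real.exp_le_exp.2 (by linarith : -(583 / 1000 : ℝ) ≤ -treeP)
    linarith [b2.1]
  · have := Real.exp_le_exp.2 (by linarith : -treeP ≤ -(581 / 1000 : ℝ))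
    linarith [b1.2]

lemma driftC_eq : driftC = treeP * (1 - Real.exp (-treeP)) * (1 + treeP) := by
  have h1 := exp_neg_one_le
  have : 1 - Real.exp (-1) ≠ 0 := by linarith
  have e : 1 + treeP = 1 / (1 - Real.exp (-1)) := by
    rw [treeP]
    field_simp
    ring
  rw [e, driftC]
  ring

lemma varC_pos : 0 < varC := by
  obtain ⟨h1, h2, h3, h4⟩ := exp_neg_treeP_bounds
  rw [varC, driftC_eq, meanC]
  set p := treeP
  set q := Real.exp (-treeP)
  have a1 : (p - 1 + q) ^ 2 ≤ (153 / 1000) ^ 2 := by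
    apply pow_le_pow_left₀ <;> linarith
  have a2 : p * (1 - q) * (1 + p) ≤ 583 / 1000 * (9 / 20) * (1583 / 1000) := by
    have : 0 ≤ p * (1 - q) := mul_nonneg (by linarith) (by linarith)
    gcongr <;> linarith
  have a0 : 0 ≤ p * (1 - q) * (1 + p) :=
    mul_nonneg (mul_nonneg (by linarith) (by linarith)) (by linarith)
  have a3 : (p - 1 + q) * (p * (1 - q) * (1 + p)) ≤
      (153 / 1000) * (583 / 1000 * (9 / 20) * (1583 / 1000)) := by
    apply mul_le_mul <;> linarith
  have a4 : (581 / 1000) ^ 2 ≤ p ^ 2 := by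
    apply pow_le_pow_left₀ <;> linarith
  norm_num at a1 a3 a4
  nlinarith

/-- First and second derivative at `1` of the solution of the implicit equation. -/
lemma deriv_singularity {ρ : ℝ → ℝ} (hρan : AnalyticAt ℝ ρ 1) (hρ1 : ρ 1 = treeP)
    (hρeq : ∀ᶠ y in 𝓝 (1 : ℝ),
      1 + ρ y = (1 + (Real.exp (y * ρ y) - 1) / y) * ρ y * Real.exp (1 - ρ y)) :
    deriv ρ 1 = -(treeP * (1 + treeP) * meanC) ∧
    deriv (deriv ρ) 1 = 2 * deriv ρ 1 * treeP
      - treeP * (1 + treeP) * (2 * deriv ρ 1 + (treeP + deriv ρ 1) ^ 2)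
      - (1 + treeP) * (2 * (Real.exp (-treeP) + treeP + deriv ρ 1) * deriv ρ 1 * (1 - treeP)
        - 2 * deriv ρ 1 ^ 2 + treeP * deriv ρ 1 ^ 2) := by
  have heq : ∀ᶠ y in 𝓝 (1 : ℝ),
      (1 + ρ y) * y = (y + Real.exp (y * ρ y) - 1) * (ρ y * Real.exp (1 - ρ y)) := by
    filter_upwards [hρeq, eventually_ne_nhds (one_ne_zero : (1 : ℝ) ≠ 0)] with y hy hy0
    rw [hy]
    field_simp
    ring
  have hd : ∀ y, AnalyticAt ℝ ρ y →
      HasDerivAt (fun y => (1 + ρ y) * y) (deriv ρ y * y + (1 + ρ y)) y ∧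
      HasDerivAt (fun y => Real.exp (y * ρ y))
        (Real.exp (y * ρ y) * (ρ y + y * deriv ρ y)) y ∧
      HasDerivAt (fun y => ρ y * Real.exp (1 - ρ y))
        ((1 - ρ y) * deriv ρ y * Real.exp (1 - ρ y)) y := by
    intro y hy
    have h := hy.differentiableAt.hasDerivAt
    refine ⟨?_, ?_, ?_⟩
    · exact ((h.const_add 1).mul (hasDerivAt_id y)).congr_deriv (by simp)
    · exact ((hasDerivAt_id y).mul h).exp.congr_deriv (by simp)
    · exact (h.mul (h.const_sub 1).exp).congr_deriv (by ring)
  have heq1 : ∀ᶠ y in 𝓝 (1 : ℝ), deriv ρ y * y + (1 + ρ y) =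
      (1 + Real.exp (y * ρ y) * (ρ y + y * deriv ρ y)) * (ρ y * Real.exp (1 - ρ y))
      + (y + Real.exp (y * ρ y) - 1) * ((1 - ρ y) * deriv ρ y * Real.exp (1 - ρ y)) := by
    filter_upwards [eventually_eventually_nhds.2 heq, hρan.eventually_analyticAt] with y hy hya
    obtain ⟨d1, d2, d3⟩ := hd y hya
    refine (d1.congr_of_eventuallyEq ?_).unique
      ((((hasDerivAt_id y).add d2).sub_const 1).mul d3)
    filter_upwards [hy] with z hz
    exact hz.symm
  have he : Real.exp 1 * treeP = 1 + treeP := by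
    have h1 := Real.exp_one_gt_d9
    have : Real.exp 1 - 1 ≠ 0 := by linarith
    rw [treeP_eq]
    field_simp
    ring
  have hW : Real.exp (1 - treeP) = Real.exp 1 * Real.exp (-treeP) := by
    rw [← Real.exp_add, sub_eq_add_neg]
  have hE : Real.exp treeP * Real.exp (-treeP) = 1 := by
    rw [← Real.exp_add, add_neg_cancel, Real.exp_zero]
  have e1 := heq1.self_of_nhds
  have h' := hρan.deriv.differentiableAt.hasDerivAt
  obtain ⟨-, d2, d3⟩ := hd 1 hρan
  have h := hρan.differentiableAt.hasDerivAt
  have l2 := (h'.mul (hasDerivAt_id 1)).add (h.const_add 1)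
  have r2 := (((d2.mul (h.add ((hasDerivAt_id 1).mul h'))).const_add 1).mul d3).add
    ((((hasDerivAt_id 1).add d2).sub_const 1).mul
      (((h.const_sub 1).mul h').mul (h.const_sub 1).exp))
  have e2 := (l2.congr_of_eventuallyEq (by
    filter_upwards [heq1] with z hz
    exact hz.symm)).unique r2
  simp only [id, Pi.mul_apply, Pi.add_apply, hρ1, hW, one_mul, mul_one] at e1 e2
  rw [meanC]
  generalize Real.exp (-treeP) = q at *
  generalize Real.exp treeP = E at *
  generalize Real.exp 1 = e at *
  generalize deriv (deriv ρ) 1 = b at *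
  generalize deriv ρ 1 = a at *
  generalize treeP = p at *
  constructor
  · linear_combination -p * e1 - p * e * (p ^ 2 + a) * hE - (p * q + p ^ 2 + a) * he
  · linear_combination -p * e2 - p * e * ((2 * a + b) * p + (p + a) ^ 2 * p
      + 2 * (p + a) * a * (1 - p) + (b - 2 * a ^ 2 - p * b + p * a ^ 2)) * hE
      - ((2 * a + b) * p + (p + a) ^ 2 * p
      + 2 * (p + a) * a * (1 - p) + (b - 2 * a ^ 2 - p * b + p * a ^ 2)
      + 2 * q * a * (1 - p)) * he

lemma iteratedDeriv_two_div_one_add {ρ : ℝ → ℝ} (hρan : AnalyticAt ℝ ρ 1) (h0 : 1 + ρ 1 ≠ 0) :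
    deriv (fun y => ρ y / (1 + ρ y)) 1 = deriv ρ 1 / (1 + ρ 1) ^ 2 ∧
    iteratedDeriv 2 (fun y => ρ y / (1 + ρ y)) 1 =
      deriv (deriv ρ) 1 / (1 + ρ 1) ^ 2 - 2 * deriv ρ 1 ^ 2 / (1 + ρ 1) ^ 3 := by
  have hd : ∀ᶠ y in 𝓝 (1 : ℝ),
      deriv (fun y => ρ y / (1 + ρ y)) y = deriv ρ y / (1 + ρ y) ^ 2 := by
    filter_upwards [hρan.eventually_analyticAt,
      (continuousAt_const.add hρan.continuousAt).eventually_ne h0] with y hy hy0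
    have h := hy.differentiableAt.hasDerivAt
    exact (h.div (h.const_add 1) hy0).deriv.trans (by ring)
  refine ⟨hd.self_of_nhds, ?_⟩
  have h := hρan.differentiableAt.hasDerivAt
  have h' := hρan.deriv.differentiableAt.hasDerivAt
  have hq := (h'.div ((h.const_add 1).pow 2) (pow_ne_zero 2 h0)).congr_of_eventuallyEq hd
  rw [iteratedDeriv_succ, iteratedDeriv_one, hq.deriv]
  simp only [Pi.pow_apply]
  field_simp
  ring

end Singularity

/-- with `ρ` the analytic solution of the implicit equation with
`ρ(1) = 1/(e−1)`, `R(y) = ρ(y)/(1+ρ(y))`, `μ = −R′(1)/R(1)` and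
`σ² = −R″(1)/R(1) − R′(1)/R(1) + (R′(1)/R(1))²`, one has `σ² ≠ 0`,
`E[β] = μ n (1+o(1))` and `Var[β] = σ² n (1+o(1))` for uniformly random labelled
trees and forests. -/
theorem tree_forest_metricDim_moments (ρ : ℝ → ℝ) (hρan : AnalyticAt ℝ ρ 1)
    (hρ1 : ρ 1 = 1 / (Real.exp 1 - 1))
    (hρeq : ∀ᶠ y in 𝓝 (1 : ℝ),
      1 + ρ y = (1 + (Real.exp (y * ρ y) - 1) / y) * ρ y * Real.exp (1 - ρ y))
    (R : ℝ → ℝ) (hR : R = fun y => ρ y / (1 + ρ y))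
    (μ σ2 : ℝ) (hμ : μ = -(deriv R 1) / R 1)
    (hσ2 : σ2 = -(iteratedDeriv 2 R 1) / R 1 - deriv R 1 / R 1 + (deriv R 1 / R 1) ^ 2) :
    σ2 ≠ 0 ∧
    Tendsto (fun n : ℕ => unifExp (treeSet n) betaR / n) atTop (𝓝 μ) ∧
    Tendsto (fun n : ℕ => unifExp (forestSet n) betaR / n) atTop (𝓝 μ) ∧
    Tendsto (fun n : ℕ => unifVar (treeSet n) betaR / n) atTop (𝓝 σ2) ∧
    Tendsto (fun n : ℕ => unifVar (forestSet n) betaR / n) atTop (𝓝 σ2) := by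
  rw [← treeP_eq] at hρ1
  have hp : 0 < treeP := by linarith [exp_neg_treeP_bounds.2.2.1]
  have h0 : 1 + ρ 1 ≠ 0 := by
    rw [hρ1]
    positivity
  obtain ⟨hR1, hR2⟩ := iteratedDeriv_two_div_one_add hρan h0
  obtain ⟨ha, hb⟩ := deriv_singularity hρan hρ1 hρeq
  rw [← hR, hρ1] at hR1 hR2
  have hR0 : R 1 = treeP / (1 + treeP) := by rw [hR, ← hρ1]
  have h1 : μ = meanC := by
    rw [hμ, hR1, hR0, ha]
    field_simp
  have h2 : σ2 = varC := by
    rw [hσ2, hR2, hR1, hR0, hb, ha, varC, driftC_eq, meanC]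
    field_simp
    ring
  rw [h1, h2]
  exact ⟨varC_pos.ne', tendsto_treeSet.1, tendsto_forestSet.1, tendsto_treeSet.2,
    tendsto_forestSet.2⟩

end MetricDimPaper
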